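/- Let B be a block of a profinite group G with defect group D ≅ Z_p, and suppose B has exactly n isomorphism classes of simple modules. Then B is Morita equivalent to the completed path algebra k⟦Q⟧, where Q is the quiver that is an oriented cycle of length n. -/

import Mathlib

open scoped Classical
set_option maxHeartbeats 1000000
set_option synthInstance.maxHeartbeats 400000

noncomputable section

namespace ProfiniteBlocks

variable (k : Type) [Field k] (G : Type) [Group G] [TopologicalSpace G]

/-- Discrete topology on each finite level group algebra. -/
instance (X : Type) : TopologicalSpace (MonoidAlgebra k X) := ⊥

/-- The canonical quotient homomorphism `G/N → G/M` for `N ≤ M`. -/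
def qHom (N M : OpenNormalSubgroup G) (h : N ≤ M) :
    G ⧸ N.toSubgroup →* G ⧸ M.toSubgroup :=
  QuotientGroup.map _ _ (MonoidHom.id G) (fun x hx => h hx)

/-- The induced algebra homomorphism `k[G/N] → k[G/M]` for `N ≤ M`. -/
def tHom (N M : OpenNormalSubgroup G) (h : N ≤ M) :
    MonoidAlgebra k (G ⧸ N.toSubgroup) →ₐ[k] MonoidAlgebra k (G ⧸ M.toSubgroup) :=
  MonoidAlgebra.mapDomainAlgHom k k (qHom G N M h)

/-- The completed group algebra `k⟦G⟧`, realized as the inverse limit of the finite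
level group algebras `k[G/N]` over all open normal subgroups `N` of `G`, sitting inside
their product. -/
def CGA : Subalgebra k (∀ N : OpenNormalSubgroup G, MonoidAlgebra k (G ⧸ N.toSubgroup)) where
  carrier := {x | ∀ (N M : OpenNormalSubgroup G) (h : N ≤ M), tHom k G N M h (x N) = x M}
  add_mem' hx hy N M h := by simp [map_add, hx N M h, hy N M h]
  mul_mem' hx hy N M h := by simp [map_mul, hx N M h, hy N M h]
  algebraMap_mem' r N M h := by
    simp [tHom, MonoidAlgebra.mapDomainAlgHom, MonoidAlgebra.mapDomainRingHom,
      Finsupp.mapDomain_single]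

instance : Ring (CGA k G) := inferInstance
instance : Algebra k (CGA k G) := inferInstance

/-- `k⟦G⟧` carries the inverse limit topology (each `k[G/N]` being discrete). -/
instance : TopologicalSpace (CGA k G) := inferInstanceAs (TopologicalSpace (Subtype _))

/-- The canonical (continuous) inclusion of `G` into `k⟦G⟧`. -/
def ofG : G →* CGA k G where
  toFun g := ⟨fun N => MonoidAlgebra.single ((g : G) : G ⧸ N.toSubgroup) 1, by
    intro N M h
    simp [tHom, MonoidAlgebra.mapDomainAlgHom, MonoidAlgebra.mapDomainRingHom,
      Finsupp.mapDomain_single, qHom, QuotientGroup.map_mk]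
    rfl⟩
  map_one' := by
    ext N
    simp [MonoidAlgebra.one_def]
  map_mul' g g' := by
    ext N
    simp [MonoidAlgebra.single_mul_single]


/-- The map between quotient modules induced by `f` (the canonical map whenever
`f` carries `P` into `Q`). -/
def mapQ' {R X Y : Type} [Ring R] [AddCommGroup X] [AddCommGroup Y] [Module R X]
    [Module R Y] (P : Submodule R X) (Q : Submodule R Y) (f : X →ₗ[R] Y) :
    (X ⧸ P) →ₗ[R] (Y ⧸ Q) :=
  if h : P ≤ Q.comap f then Submodule.mapQ P Q f h else 0

/-- The map between submodules induced by `f` (the canonical restriction whenever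
`f` carries `P` into `Q`). -/
def restrict' {R X Y : Type} [Ring R] [AddCommGroup X] [AddCommGroup Y] [Module R X]
    [Module R Y] (P : Submodule R X) (Q : Submodule R Y) (f : X →ₗ[R] Y) :
    P →ₗ[R] Q :=
  if h : ∀ x ∈ P, f x ∈ Q then f.restrict h else 0

/-- The subquotient `W / W'` of a module. -/
abbrev subQuot {R X : Type} [Ring R] [AddCommGroup X] [Module R X]
    (W W' : Submodule R X) : Type :=
  W ⧸ (W'.comap W.subtype)

/-- The radical of a topological module: the intersection of its maximal open
submodules. -/
def radical (R : Type) [Ring R] (X : Type) [AddCommGroup X] [Module R X]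
    [TopologicalSpace X] : Submodule R X :=
  sInf {W : Submodule R X | IsCoatom W ∧ IsOpen (W : Set X)}

/-- Iterated radicals `Rad^i(X)`, with `Rad^0(X) = X`. -/
def radPow (R : Type) [Ring R] (X : Type) [AddCommGroup X] [Module R X]
    [TopologicalSpace X] : ℕ → Submodule R X
  | 0 => ⊤
  | (n + 1) => (radical R (radPow R X n)).map (radPow R X n).subtype

/-- A topological module is semisimple if every closed submodule has a closed
complement. -/
def IsSemisimpleTop (R : Type) [Ring R] (X : Type) [AddCommGroup X] [Module R X]
    [TopologicalSpace X] : Prop :=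
  ∀ W : Submodule R X, IsClosed (W : Set X) →
    ∃ W' : Submodule R X, IsClosed (W' : Set X) ∧ IsCompl W W'

/-- The socle of a topological module: the largest closed semisimple submodule
(defined as the join of all closed semisimple submodules). -/
def socle (R : Type) [Ring R] (X : Type) [AddCommGroup X] [Module R X]
    [TopologicalSpace X] : Submodule R X :=
  sSup {W : Submodule R X | IsClosed (W : Set X) ∧ IsSemisimpleTop R W}

/-- A module is uniserial if its submodules form a chain. -/
def Uniserial (R : Type) [Ring R] (X : Type) [AddCommGroup X] [Module R X] : Prop :=
  ∀ W W' : Submodule R X, W ≤ W' ∨ W' ≤ W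

/-- A topological module is (topologically) indecomposable if it is non-zero and
admits no non-trivial decomposition into closed direct summands. -/
def IsIndecTop (R : Type) [Ring R] (X : Type) [AddCommGroup X] [Module R X]
    [TopologicalSpace X] : Prop :=
  Nontrivial X ∧ ∀ W W' : Submodule R X, IsClosed (W : Set X) → IsClosed (W' : Set X) →
    IsCompl W W' → W = ⊥ ∨ W' = ⊥

/-- The inverse limit of a compatible system of modules indexed by a preorder,
realized as the submodule of compatible families in the product. -/
def compatLim {ι : Type} [Preorder ι] {R : Type} [Ring R] (T : ι → Type)
    [∀ i, AddCommGroup (T i)] [∀ i, Module R (T i)]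
    (t : ∀ i j, i ≤ j → (T i →ₗ[R] T j)) : Submodule R (∀ i, T i) where
  carrier := {f | ∀ (i j : ι) (h : i ≤ j), t i j h (f i) = f j}
  add_mem' ha hb i j h := by simp only [Pi.add_apply, map_add]; rw [ha i j h, hb i j h]
  zero_mem' i j h := by simp
  smul_mem' c a ha i j h := by simp only [Pi.smul_apply, map_smul]; rw [ha i j h]

/-- `X` has exactly `n` composition factors (measured along the radical series). -/
def HasNFactors (R : Type) [Ring R] (X : Type) [AddCommGroup X] [Module R X]
    [TopologicalSpace X] (n : ℕ) : Prop :=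
  radPow R X n = ⊥ ∧ ∀ m < n, radPow R X m ≠ ⊥

/-- `X` has infinitely many composition factors. -/
def HasInfFactors (R : Type) [Ring R] (X : Type) [AddCommGroup X] [Module R X]
    [TopologicalSpace X] : Prop :=
  ∀ n : ℕ, radPow R X n ≠ ⊥



section Coinvariants

variable {k : Type} [Field k] {G : Type} [Group G] [TopologicalSpace G]

variable (k G) in
/-- The (closed) submodule `I_N U` of a topological `k⟦G⟧`-module `U`: the smallest
closed submodule containing all elements `n • u - u` for `n ∈ N`.  Its quotient is the
module of `N`-coinvariants. -/
def coinvKer (N : OpenNormalSubgroup G) (U : Type) [AddCommGroup U]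
    [Module (CGA k G) U] [TopologicalSpace U] : Submodule (CGA k G) U :=
  sInf {W : Submodule (CGA k G) U | IsClosed (W : Set U) ∧
    ∀ n ∈ N.toSubgroup, ∀ u : U, ofG k G n • u - u ∈ W}

variable (k G) in
/-- The module of `N`-coinvariants `U_N` of a topological `k⟦G⟧`-module `U`. -/
abbrev coinv (N : OpenNormalSubgroup G) (U : Type) [AddCommGroup U]
    [Module (CGA k G) U] [TopologicalSpace U] : Type :=
  U ⧸ coinvKer k G N U

variable (k G) in
/-- The canonical projection `φ_N : U → U_N`. -/
def phi (N : OpenNormalSubgroup G) (U : Type) [AddCommGroup U]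
    [Module (CGA k G) U] [TopologicalSpace U] : U →ₗ[CGA k G] coinv k G N U :=
  (coinvKer k G N U).mkQ

lemma coinvKer_mono {N M : OpenNormalSubgroup G} (h : N ≤ M) (U : Type) [AddCommGroup U]
    [Module (CGA k G) U] [TopologicalSpace U] : coinvKer k G N U ≤ coinvKer k G M U :=
  sInf_le_sInf (fun W hW => ⟨hW.1, fun n hn u => hW.2 n (h hn) u⟩)

variable (k G) in
/-- The canonical projection `φ_{MN} : U_N → U_M` for `N ≤ M`. -/
def phiT (N M : OpenNormalSubgroup G) (h : N ≤ M) (U : Type) [AddCommGroup U]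
    [Module (CGA k G) U] [TopologicalSpace U] :
    coinv k G N U →ₗ[CGA k G] coinv k G M U :=
  Submodule.mapQ _ _ LinearMap.id (fun _ hx => coinvKer_mono h U hx)

variable (k G) in
/-- `N` acts trivially on the `k⟦G⟧`-module `W`. -/
def NTrivial (N : OpenNormalSubgroup G) (W : Type) [AddCommGroup W]
    [Module (CGA k G) W] : Prop :=
  ∀ n ∈ N.toSubgroup, ∀ w : W, ofG k G n • w = w

end Coinvariants

section Pseudocompact

variable (k : Type) [Field k]

/-- A pseudocompact module over a topological `k`-algebra `A`: a Hausdorff topological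
module possessing a basis of neighbourhoods of `0` consisting of open submodules of
finite codimension which intersect in `0`, and which is the inverse limit of the
corresponding discrete quotients. -/
structure IsPseudocompactMod (A : Type) [Ring A] [Algebra k A] [TopologicalSpace A]
    (X : Type) [AddCommGroup X] [Module k X] [Module A X] [IsScalarTower k A X]
    [TopologicalSpace X] : Prop where
  t2 : T2Space X
  addGroup : IsTopologicalAddGroup X
  contSMul : ContinuousSMul A X
  basis : (nhds (0 : X)).HasBasis
    (fun V : Submodule A X => IsOpen (V : Set X) ∧
      FiniteDimensional k (X ⧸ V.restrictScalars k))
    (fun V => (V : Set X))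
  inf_bot : (⨅ (V : Submodule A X) (_ : IsOpen (V : Set X) ∧
      FiniteDimensional k (X ⧸ V.restrictScalars k)), V) = ⊥
  complete : ∀ c : ∀ V : {V : Submodule A X // IsOpen (V : Set X) ∧
      FiniteDimensional k (X ⧸ V.restrictScalars k)}, X ⧸ V.1,
    (∀ (V W : {V : Submodule A X // IsOpen (V : Set X) ∧
        FiniteDimensional k (X ⧸ V.restrictScalars k)}), V.1 ≤ W.1 →
      mapQ' V.1 W.1 LinearMap.id (c V) = c W) →
    ∃ x : X, ∀ V, c V = Submodule.Quotient.mk x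

end Pseudocompact

section Blocks

variable (R : Type) [Ring R]

/-- A block idempotent: a centrally primitive idempotent of `R`. -/
structure IsBlockIdem (e : R) : Prop where
  idem : IsIdempotentElem e
  ne_zero : e ≠ 0
  central : e ∈ Set.center R
  primitive : ∀ f g : R, f ∈ Set.center R → g ∈ Set.center R → IsIdempotentElem f →
    IsIdempotentElem g → f * g = 0 → g * f = 0 → e = f + g → f = 0 ∨ g = 0

/-- The block `B = Re` determined by a central idempotent `e`, as a left `R`-module. -/
def blockMod (e : R) (he : e ∈ Set.center R) : Submodule R R where
  carrier := {a : R | a * e = a}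
  add_mem' := by intro a b ha hb; simp only [Set.mem_setOf_eq, add_mul] at *; rw [ha, hb]
  zero_mem' := by simp
  smul_mem' := by
    intro c a ha
    simp only [Set.mem_setOf_eq, smul_eq_mul, mul_assoc] at *
    rw [ha]

/-- A module belongs to the block of the central idempotent `e` if `e` acts as the
identity on it. -/
def InBlock {X : Type} [AddCommGroup X] [Module R X] (e : R) : Prop :=
  ∀ x : X, e • x = x

end Blocks

section Defect

variable {k : Type} [Field k] {G : Type} [Group G] [TopologicalSpace G]

variable (k G) in
/-- The conjugation action of `G` on `k⟦G⟧`. -/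
def conjAct (g : G) (x : CGA k G) : CGA k G :=
  ofG k G g * x * ofG k G g⁻¹

variable (k G) in
/-- The `H`-fixed points of `k⟦G⟧` under conjugation. -/
def fixedBy (H : Subgroup G) : Set (CGA k G) :=
  {x : CGA k G | ∀ h ∈ H, conjAct k G h x = x}

variable (k G) in
/-- The relative trace map `Tr_H^G` on `k⟦G⟧` (a finite sum over coset
representatives when `H` is open). -/
def trMap (H : Subgroup G) (x : CGA k G) : CGA k G :=
  ∑ᶠ c : G ⧸ H, conjAct k G (Quotient.out c) x

variable (k G) in
/-- The image `Tr_H^G(k⟦G⟧^H)`. -/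
def trImage (H : Subgroup G) : Set (CGA k G) :=
  trMap k G H '' fixedBy k G H

variable (k G) in
/-- `D` satisfies the defect property for `e`:
`e ∈ ⋂_N Tr_{DN}^G (k⟦G⟧^{DN})`. -/
def DefectProp (e : CGA k G) (D : Subgroup G) : Prop :=
  ∀ N : OpenNormalSubgroup G, e ∈ trImage k G (D ⊔ N.toSubgroup)

variable (k G) in
/-- `D` is a defect group of the block of `e`: a closed subgroup, minimal subject to
the defect property. -/
structure IsDefectGroup (e : CGA k G) (D : Subgroup G) : Prop where
  closed : IsClosed (D : Set G)
  defect : DefectProp k G e D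
  minimal : ∀ D' : Subgroup G, IsClosed ((D' : Set G)) → D' ≤ D →
    DefectProp k G e D' → D' = D

end Defect

section FiniteDefect

variable (k : Type) [Field k] (Q : Type) [Group Q]

/-- Conjugation on a finite level group algebra `k[Q]`. -/
def conjActF (q : Q) (x : MonoidAlgebra k Q) : MonoidAlgebra k Q :=
  MonoidAlgebra.single q 1 * x * MonoidAlgebra.single q⁻¹ 1

/-- `H`-fixed points of `k[Q]` under conjugation. -/
def fixedByF (H : Subgroup Q) : Set (MonoidAlgebra k Q) :=
  {x | ∀ h ∈ H, conjActF k Q h x = x}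

/-- The relative trace map `Tr_H^Q` on `k[Q]`. -/
def trMapF (H : Subgroup Q) (x : MonoidAlgebra k Q) : MonoidAlgebra k Q :=
  ∑ᶠ c : Q ⧸ H, conjActF k Q (Quotient.out c) x

/-- The image `Tr_H^Q(k[Q]^H)`. -/
def trImageF (H : Subgroup Q) : Set (MonoidAlgebra k Q) :=
  trMapF k Q H '' fixedByF k Q H

/-- `Dq` is a defect group of the block of `e` in the group algebra `k[Q]`. -/
structure IsDefectGroupF (e : MonoidAlgebra k Q) (Dq : Subgroup Q) : Prop where
  defect : e ∈ trImageF k Q Dq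
  minimal : ∀ D' : Subgroup Q, D' ≤ Dq → e ∈ trImageF k Q D' → D' = Dq

end FiniteDefect

section CyclicDefect

variable {k : Type} [Field k] {G : Type} [Group G] [TopologicalSpace G]

variable (G) in
/-- A subgroup is procyclic if it possesses a dense cyclic (abstract) subgroup. -/
def IsProcyclic (D : Subgroup G) : Prop :=
  ∃ g : G, closure ((Subgroup.zpowers g : Subgroup G) : Set G) = (D : Set G)

variable (G) in
/-- `D` is isomorphic, as a topological group, to the `p`-adic integers `ℤ_p`. -/
def IsZpGroup (p : ℕ) [Fact p.Prime] (D : Subgroup G) : Prop :=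
  ∃ φ : D ≃ₜ Multiplicative ℤ_[p], ∀ x y : D, φ (x * y) = φ x * φ y

variable (G) in
/-- `D` is a cyclic pro-`p` group: either a finite cyclic `p`-group or `ℤ_p`. -/
def IsCyclicProP (p : ℕ) [Fact p.Prime] (D : Subgroup G) : Prop :=
  (Finite D ∧ IsPGroup p D ∧ IsCyclic D) ∨ IsZpGroup G p D

end CyclicDefect

section Simples

variable {k : Type} [Field k] {G : Type} [Group G] [TopologicalSpace G]

variable (k G) in
/-- The projection `k⟦G⟧ → k[G/N]`. -/
def projN (N : OpenNormalSubgroup G) (x : CGA k G) :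
    MonoidAlgebra k (G ⧸ N.toSubgroup) :=
  (x : ∀ N : OpenNormalSubgroup G, MonoidAlgebra k (G ⧸ N.toSubgroup)) N

variable (k G) in
/-- `N` acts trivially on every simple module of the block of `e`. -/
def TrivOnSimples (e : CGA k G) (N : OpenNormalSubgroup G) : Prop :=
  ∀ (S : Type) [AddCommGroup S] [Module (CGA k G) S],
    IsSimpleModule (CGA k G) S → InBlock (CGA k G) (X := S) e → NTrivial k G N S

variable (k G) in
/-- Membership of `N` in the standard cofinal system `𝒩` for the block `B` of `e`
with defect group `D`: the coinvariant algebra `B_N` is a block of `k[G/N]` with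
defect group `DN/N`, and `N` acts trivially on every simple `B`-module. -/
structure GoodN (e : CGA k G) (D : Subgroup G) (N : OpenNormalSubgroup G) : Prop where
  blockN : IsBlockIdem (MonoidAlgebra k (G ⧸ N.toSubgroup)) (projN k G N e)
  defectN : IsDefectGroupF k (G ⧸ N.toSubgroup) (projN k G N e)
    (D.map (QuotientGroup.mk' N.toSubgroup))
  triv : TrivOnSimples k G e N

/-- A cofinal set of open normal subgroups. -/
def IsCofinal {G : Type} [Group G] [TopologicalSpace G]
    (𝒩 : Set (OpenNormalSubgroup G)) : Prop :=
  ∀ M : OpenNormalSubgroup G, ∃ N ∈ 𝒩, N ≤ M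

variable (k G) in
/-- A pseudocompact module is pro-uniserial (w.r.t. the cofinal system `𝒩`) if all
its coinvariant quotients at members of `𝒩` are uniserial. -/
def ProUniserial (𝒩 : Set (OpenNormalSubgroup G)) (U : Type) [AddCommGroup U]
    [Module (CGA k G) U] [TopologicalSpace U] : Prop :=
  ∀ N ∈ 𝒩, Uniserial (CGA k G) (coinv k G N U)

variable (k G) in
/-- `S` is a composition factor of the pseudocompact module `U`: it is a composition
factor of some finite coinvariant quotient `U_N`. -/
def IsCompFactorOf (U : Type) [AddCommGroup U] [Module (CGA k G) U]
    [TopologicalSpace U] (S : Type) [AddCommGroup S] [Module (CGA k G) S] : Prop :=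
  ∃ (N : OpenNormalSubgroup G) (W W' : Submodule (CGA k G) (coinv k G N U)),
    W' ≤ W ∧ Nonempty (subQuot W W' ≃ₗ[CGA k G] S)

variable (k G) in
/-- `S` is a composition factor of the finite-dimensional module `X`. -/
def IsCompFactorFin (X : Type) [AddCommGroup X] [Module (CGA k G) X]
    (S : Type) [AddCommGroup S] [Module (CGA k G) S] : Prop :=
  ∃ W W' : Submodule (CGA k G) X, W' ≤ W ∧ Nonempty (subQuot W W' ≃ₗ[CGA k G] S)

end Simples

section Projective

variable {k : Type} [Field k] {G : Type} [Group G] [TopologicalSpace G]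

variable (k G) in
/-- A pseudocompact `k⟦G⟧`-module is (categorically) projective if every continuous
surjection onto it from a pseudocompact module splits. -/
def IsPCProjective (P : Type) [AddCommGroup P] [Module (CGA k G) P]
    [TopologicalSpace P] : Prop :=
  ∀ (W : Type) [AddCommGroup W] [Module k W] [Module (CGA k G) W]
    [IsScalarTower k (CGA k G) W] [TopologicalSpace W],
    IsPseudocompactMod k (CGA k G) W →
    ∀ f : W →ₗ[CGA k G] P, Continuous f → Function.Surjective f →
      ∃ s : P →ₗ[CGA k G] W, Continuous s ∧ f.comp s = LinearMap.id

variable (k G) in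
/-- `P` is a projective cover of the simple module `S` in the block of `e`:
a pseudocompact projective module of the block together with a surjection onto `S`
whose kernel is superfluous (contained in the radical). -/
structure IsProjCover (e : CGA k G) (P : Type) [AddCommGroup P] [Module k P]
    [Module (CGA k G) P] [IsScalarTower k (CGA k G) P] [TopologicalSpace P]
    (S : Type) [AddCommGroup S] [Module (CGA k G) S] : Prop where
  pseudocompact : IsPseudocompactMod k (CGA k G) P
  inBlock : InBlock (CGA k G) (X := P) e
  projective : IsPCProjective k G P
  cover : ∃ π : P →ₗ[CGA k G] S, Function.Surjective π ∧
    LinearMap.ker π ≤ radical (CGA k G) P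

end Projective




/-- The map between subquotients induced by `f`. -/
def subQuotMap {R X Y : Type} [Ring R] [AddCommGroup X] [AddCommGroup Y] [Module R X]
    [Module R Y] (W W' : Submodule R X) (V V' : Submodule R Y) (f : X →ₗ[R] Y) :
    subQuot W W' →ₗ[R] subQuot V V' :=
  mapQ' (W'.comap W.subtype) (V'.comap V.subtype) (restrict' W V f)

/-- The conditions of Proposition 3.8 on a pair of pro-uniserial submodules `X`, `Y`
of an indecomposable projective `P`: `X ∩ Y = Soc(P)`, `X + Y = Rad(P)`, and
`Rad(P)/Soc(P) ≅ X/Soc(P) ⊕ Y/Soc(P)` with no common composition factors. -/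
def ProUniserialPair (k : Type) [Field k] (G : Type) [Group G] [TopologicalSpace G]
    (𝒩 : Set (OpenNormalSubgroup G)) (P : Type) [AddCommGroup P]
    [Module (CGA k G) P] [TopologicalSpace P]
    (X Y : Submodule (CGA k G) P) : Prop :=
  ProUniserial k G 𝒩 X ∧ ProUniserial k G 𝒩 Y ∧
  X ⊓ Y = socle (CGA k G) P ∧
  X ⊔ Y = radical (CGA k G) P ∧
  Nonempty ((subQuot (radical (CGA k G) P) (socle (CGA k G) P)) ≃ₗ[CGA k G]
    (subQuot X (socle (CGA k G) P) × subQuot Y (socle (CGA k G) P))) ∧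
  ∀ (T : Type) [AddCommGroup T] [Module (CGA k G) T], IsSimpleModule (CGA k G) T →
    ¬ (IsCompFactorOf k G (subQuot X (socle (CGA k G) P)) T ∧
       IsCompFactorOf k G (subQuot Y (socle (CGA k G) P)) T)

/-- `S : ι → Type` is a complete set of pairwise non-isomorphic representatives of
the simple modules of the block of `e`. -/
def IsSimpleReps (k : Type) [Field k] (G : Type) [Group G] [TopologicalSpace G]
    (e : CGA k G) {ι : Type} (S : ι → Type) [∀ i, AddCommGroup (S i)]
    [∀ i, Module (CGA k G) (S i)] : Prop :=
  (∀ i, IsSimpleModule (CGA k G) (S i) ∧ InBlock (CGA k G) (X := S i) e) ∧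
  (∀ i j, i ≠ j → IsEmpty (S i ≃ₗ[CGA k G] S j)) ∧
  (∀ (T : Type) [AddCommGroup T] [Module (CGA k G) T],
    IsSimpleModule (CGA k G) T → InBlock (CGA k G) (X := T) e →
      ∃ i, Nonempty (T ≃ₗ[CGA k G] S i))

section Brauer

/-- The size of the `ρ`-orbit of `i` (the number of edges at the corresponding vertex
of the Brauer tree). -/
def orbSize {ι : Type} (ρ : Equiv.Perm ι) (i : ι) : ℕ :=
  Function.minimalPeriod ρ i

/-- Data describing the exceptional vertex of a Brauer tree: `none` if there is no
exceptional vertex, and otherwise a flag recording whether it is a `ρ`-vertex or a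
`σ`-vertex together with an edge adjacent to it. -/
abbrev ExcVertex (ι : Type) : Type := Option (Bool × ι)

/-- The edge `i` is adjacent to the exceptional vertex, its `ρ`-endpoint being
exceptional. -/
def AdjExcRho {ι : Type} (ρ : Equiv.Perm ι) (exc : ExcVertex ι) (i : ι) : Prop :=
  ∃ j : ι, exc = some (true, j) ∧ ρ.SameCycle j i

/-- The edge `i` is adjacent to the exceptional vertex, its `σ`-endpoint being
exceptional. -/
def AdjExcSigma {ι : Type} (σ : Equiv.Perm ι) (exc : ExcVertex ι) (i : ι) : Prop :=
  ∃ j : ι, exc = some (false, j) ∧ σ.SameCycle j i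

/-- The edge `i` is adjacent to the exceptional vertex. -/
def AdjExc {ι : Type} (ρ σ : Equiv.Perm ι) (exc : ExcVertex ι) (i : ι) : Prop :=
  AdjExcRho ρ exc i ∨ AdjExcSigma σ exc i

end Brauer


/-- The completed path algebra `k⟦Q⟧` of the cyclic quiver `Q` with `n` vertices,
realized as the algebra of matrices over `k⟦X⟧` whose `(i,j)` entry is supported on
the powers `X^m` with `m ≡ i - j (mod n)` (this entry recording the sum of all paths
from the vertex `j` to the vertex `i`, a path being determined by its source and its
length). -/
def cycleAlgebra (k : Type) [Field k] (n : ℕ) :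
    Subalgebra k (Matrix (Fin n) (Fin n) (PowerSeries k)) where
  carrier := {M | ∀ (i j : Fin n) (m : ℕ),
    ((m : ZMod n) ≠ ((i : ℕ) : ZMod n) - ((j : ℕ) : ZMod n)) →
      PowerSeries.coeff m (M i j) = 0}
  add_mem' := by
    intro a b ha hb i j m hm
    simp only [Matrix.add_apply, map_add, ha i j m hm, hb i j m hm, add_zero]
  mul_mem' := by
    intro a b ha hb i j m hm
    rw [Matrix.mul_apply, map_sum]
    apply Finset.sum_eq_zero
    intro l _
    rw [PowerSeries.coeff_mul]
    apply Finset.sum_eq_zero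
    intro ab hab
    by_cases h1 : ((ab.1 : ZMod n) = ((i : ℕ) : ZMod n) - ((l : ℕ) : ZMod n))
    · by_cases h2 : ((ab.2 : ZMod n) = ((l : ℕ) : ZMod n) - ((j : ℕ) : ZMod n))
      · exfalso
        apply hm
        have : ab.1 + ab.2 = m := Finset.HasAntidiagonal.mem_antidiagonal.mp hab
        calc ((m : ℕ) : ZMod n) = ((ab.1 + ab.2 : ℕ) : ZMod n) := by rw [this]
        _ = (ab.1 : ZMod n) + (ab.2 : ZMod n) := by push_cast; ring
        _ = _ := by rw [h1, h2]; ring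
      · rw [hb l j ab.2 h2, mul_zero]
    · rw [ha i l ab.1 h1, zero_mul]
  algebraMap_mem' := by
    intro r i j m hm
    rw [Matrix.algebraMap_matrix_apply]
    by_cases h : i = j
    · subst h
      simp only [if_pos rfl]
      have hm0 : m ≠ 0 := by
        intro h0
        apply hm
        subst h0
        simp
      simp [PowerSeries.algebraMap_apply, PowerSeries.coeff_C, hm0]
    · simp [h]

/-- The completed path algebra of the cyclic quiver carries its natural
(coefficientwise) pseudocompact topology. -/
instance (k : Type) [Field k] (n : ℕ) : TopologicalSpace (cycleAlgebra k n) :=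
  TopologicalSpace.induced
    (fun M (t : Fin n × Fin n × ℕ) =>
      PowerSeries.coeff t.2.2
        ((M : Matrix (Fin n) (Fin n) (PowerSeries k)) t.1 t.2.1))
    (@Pi.topologicalSpace (Fin n × Fin n × ℕ) (fun _ => k) (fun _ => ⊥))

/-- The category of pseudocompact modules over a topological `k`-algebra `A`, with
continuous `A`-linear maps as morphisms. -/
structure PCMod (k : Type) [Field k] (A : Type) [Ring A] [Algebra k A]
    [TopologicalSpace A] where
  X : Type
  [acg : AddCommGroup X]
  [mdk : Module k X]
  [ma : Module A X]
  [tow : IsScalarTower k A X]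
  [ts : TopologicalSpace X]
  pc : IsPseudocompactMod k A X

attribute [instance] PCMod.acg PCMod.mdk PCMod.ma PCMod.tow PCMod.ts

instance PCMod.category (k : Type) [Field k] (A : Type) [Ring A] [Algebra k A]
    [TopologicalSpace A] : CategoryTheory.Category (PCMod k A) where
  Hom M N := {f : M.X →ₗ[A] N.X // Continuous f}
  id M := ⟨LinearMap.id, continuous_id⟩
  comp f g := ⟨g.1.comp f.1, g.2.comp f.2⟩
  id_comp f := Subtype.ext (LinearMap.comp_id f.1)
  comp_id f := Subtype.ext (LinearMap.id_comp f.1)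
  assoc f g h := rfl

set_option linter.unusedSectionVars false

section LinearCompactness

variable {k}

/-- The evaluation of a finitely supported family on a vector. -/
def finPair {ι : Type*} (v : ι → k) : (ι →₀ k) →ₗ[k] k :=
  Finsupp.lsum k (fun i => LinearMap.lsmul k k (v i))

lemma finPair_apply {ι : Type*} (v : ι → k) (φ : ι →₀ k) :
    finPair v φ = φ.sum fun i a => v i * a := by
  simp only [finPair, Finsupp.lsum_apply]
  rfl

lemma finPair_single {ι : Type*} (v : ι → k) (i : ι) (a : k) :
    finPair v (Finsupp.single i a) = v i * a := by
  simp [finPair]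

lemma finPair_sub {ι : Type*} (v w : ι → k) (φ : ι →₀ k) :
    finPair (v - w) φ = finPair v φ - finPair w φ := by
  simp [finPair_apply, Finsupp.sum, sub_mul]

/-- A subspace of `k^ι` which is cofinite in the product topology is determined by the
finitely supported functionals vanishing on it. -/
lemma mem_of_finPair_eq_zero {ι : Type*} (K : Submodule k (ι → k)) (F : Finset ι)
    (hF : ∀ w : ι → k, (∀ i ∈ F, w i = 0) → w ∈ K) (u : ι → k)
    (hu : ∀ φ : ι →₀ k, (∀ w ∈ K, finPair w φ = 0) → finPair u φ = 0) : u ∈ K := by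
  by_contra hne
  obtain ⟨g, hg, hgK⟩ := Submodule.exists_le_ker_of_notMem hne
  have key : ∀ w : ι → k, g w = finPair w (∑ i ∈ F, Finsupp.single i (g (Pi.single i 1))) := by
    intro w
    have h1 : w - ∑ i ∈ F, w i • (Pi.single i 1 : ι → k) ∈ K := by
      apply hF
      intro i hi
      simp [Finset.sum_apply, Pi.single_apply, hi]
    have h2 : g (w - ∑ i ∈ F, w i • (Pi.single i 1 : ι → k)) = 0 := hgK h1
    rw [map_sub, sub_eq_zero, map_sum] at h2
    rw [h2, map_sum]
    simp [finPair_single]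
  apply hg
  rw [key u]
  apply hu
  intro w hw
  rw [← key w]
  exact hgK hw

/-- Linear compactness of `k^ι`: a directed system of cosets of cofinite closed subspaces
has a common point. -/
lemma exists_forall_sub_mem {ι : Type*} {J : Type*} [Preorder J] [Nonempty J]
    (dir : ∀ i j : J, ∃ l, l ≤ i ∧ l ≤ j) (K : J → Submodule k (ι → k)) (F : J → Finset ι)
    (hF : ∀ j (w : ι → k), (∀ i ∈ F j, w i = 0) → w ∈ K j)
    (mono : ∀ i j, i ≤ j → K i ≤ K j) (v : J → ι → k)
    (hv : ∀ i j, i ≤ j → v i - v j ∈ K j) : ∃ w : ι → k, ∀ j, w - v j ∈ K j := by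
  let U : J → Submodule k (ι →₀ k) := fun j =>
    { carrier := {φ | ∀ w ∈ K j, finPair w φ = 0}
      add_mem' := fun ha hb w hw => by rw [map_add, ha w hw, hb w hw, add_zero]
      zero_mem' := fun w _ => map_zero _
      smul_mem' := fun c φ h w hw => by rw [map_smul, h w hw, smul_zero] }
  let f : J → ((ι →₀ k) →ₗ.[k] k) := fun j => ⟨U j, (finPair (v j)).domRestrict (U j)⟩
  have hle : ∀ i j, i ≤ j → f j ≤ f i := by
    intro i j hij
    refine ⟨fun φ hφ w hw => hφ w (mono i j hij hw), ?_⟩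
    rintro ⟨x, hx⟩ ⟨y, hy⟩ (rfl : x = y)
    have := hx _ (hv i j hij)
    rw [finPair_sub, sub_eq_zero] at this
    exact this.symm
  have hdir : DirectedOn (· ≤ ·) (Set.range f) := by
    rintro _ ⟨i, rfl⟩ _ ⟨j, rfl⟩
    obtain ⟨l, h1, h2⟩ := dir i j
    exact ⟨f l, ⟨l, rfl⟩, hle _ _ h1, hle _ _ h2⟩
  obtain ⟨g, hg⟩ := LinearMap.exists_extend (LinearPMap.sSup (Set.range f) hdir).toFun
  refine ⟨fun i => g (Finsupp.single i 1), fun j => ?_⟩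
  have hgf : ∀ φ, finPair (fun i => g (Finsupp.single i 1)) φ = g φ := by
    intro φ
    have : finPair (fun i => g (Finsupp.single i 1)) = g := by
      ext i; simp [finPair_single]
    rw [this]
  apply mem_of_finPair_eq_zero (K j) (F j) (hF j)
  intro φ hφ
  rw [finPair_sub, hgf, sub_eq_zero]
  have h1 := LinearPMap.le_sSup hdir (Set.mem_range_self j)
  have h2 := h1.1 (show φ ∈ (f j).domain from hφ)
  have h3 := h1.2 (x := ⟨φ, hφ⟩) (y := ⟨φ, h2⟩) rfl
  have h4 := LinearMap.congr_fun hg ⟨φ, h2⟩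
  exact h4.trans h3.symm

end LinearCompactness

section LevelSystems

/-- A compatible system of finite-dimensional quotients exhibiting an algebra as an
inverse limit. -/
structure IsLevSys {k : Type} [Field k] {R : Type} [Ring R] [Algebra k R] {J : Type} [Preorder J]
    {A : J → Type} [∀ j, Ring (A j)] [∀ j, Algebra k (A j)] (lev : ∀ j, R →ₐ[k] A j) :
    Prop where
  fin : ∀ j, Module.Finite k (A j)
  surj : ∀ j, Function.Surjective (lev j)
  ext : ∀ x y : R, (∀ j, lev j x = lev j y) → x = y
  mono : ∀ i j, i ≤ j → ∀ x, lev i x = 0 → lev j x = 0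
  dir : ∀ i j : J, ∃ l, l ≤ i ∧ l ≤ j
  nonempty : Nonempty J
  complete : ∀ x : ∀ j, A j, (∀ i j, i ≤ j → ∀ r, lev i r = x i → lev j r = x j) →
    ∃ r, ∀ j, lev j r = x j

variable {k} {R : Type} [Ring R] [Algebra k R] {J : Type} [Preorder J]
    {A : J → Type} [∀ j, Ring (A j)] [∀ j, Algebra k (A j)] {lev : ∀ j, R →ₐ[k] A j}

lemma IsLevSys.mono_eq (hl : IsLevSys lev) {i j : J} (h : i ≤ j) {x y : R}
    (hxy : lev i x = lev i y) : lev j x = lev j y := by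
  rw [← sub_eq_zero, ← map_sub] at hxy ⊢
  exact hl.mono i j h _ hxy

open PowerSeries in
lemma aeval_trunc_coe {B : Type*} [Ring B] [Algebra k B] (a : B) (s : ℕ) (ha : a ^ s = 0)
    (P : Polynomial k) : Polynomial.aeval a (trunc s (P : PowerSeries k)) = Polynomial.aeval a P := by
  have : (Polynomial.X ^ s : Polynomial k) ∣ P - trunc s (P : PowerSeries k) := by
    rw [Polynomial.X_pow_dvd_iff]
    intro d hd
    simp [coeff_trunc, hd]
  obtain ⟨q, hq⟩ := this
  have h2 := congrArg (Polynomial.aeval a) hq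
  simp only [map_sub, map_mul, map_pow, Polynomial.aeval_X, ha, zero_mul, sub_eq_zero] at h2
  exact h2.symm

open PowerSeries in
lemma aeval_trunc_eq {B : Type*} [Ring B] [Algebra k B] (a : B) (s t : ℕ) (hs : a ^ s = 0)
    (hst : s ≤ t) (f : PowerSeries k) :
    Polynomial.aeval a (trunc t f) = Polynomial.aeval a (trunc s f) := by
  rw [← aeval_trunc_coe a s hs (trunc t f)]
  congr 1
  ext d
  by_cases h : d < s
  · simp [coeff_trunc, h, h.trans_le hst]
  · simp [coeff_trunc, h]

open PowerSeries in
lemma aeval_trunc_eq' {B : Type*} [Ring B] [Algebra k B] (a : B) (s t : ℕ) (hs : a ^ s = 0)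
    (ht : a ^ t = 0) (f : PowerSeries k) :
    Polynomial.aeval a (trunc t f) = Polynomial.aeval a (trunc s f) := by
  rcases le_total s t with h | h
  · exact aeval_trunc_eq a s t hs h f
  · exact (aeval_trunc_eq a t s ht h f).symm

open PowerSeries in
lemma exists_rho (hl : IsLevSys lev) (x : R) (hx : ∀ j, IsNilpotent (lev j x)) (f : PowerSeries k) :
    ∃ r : R, ∀ j s, lev j x ^ s = 0 → lev j r = Polynomial.aeval (lev j x) (trunc s f) := by
  choose s hs using hx
  obtain ⟨r, hr⟩ := hl.complete (fun j => Polynomial.aeval (lev j x) (trunc (s j) f)) (by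
    intro i j hij r hr
    have h1 : lev i r = lev i (Polynomial.aeval x (trunc (s i) f)) := by
      rw [hr, ← Polynomial.aeval_algHom_apply]
    have h2 := hl.mono_eq hij h1
    rw [h2, ← Polynomial.aeval_algHom_apply]
    apply aeval_trunc_eq' _ _ _ (hs j)
    have := hs i
    rw [← map_pow] at this ⊢
    exact hl.mono i j hij _ this)
  exact ⟨r, fun j t ht => (hr j).trans (aeval_trunc_eq' _ _ _ ht (hs j) f)⟩

open PowerSeries in
/-- Substitution of a topologically nilpotent element in power series. -/
def rho (hl : IsLevSys lev) (x : R) (hx : ∀ j, IsNilpotent (lev j x)) : PowerSeries k →ₐ[k] R :=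
  AlgHom.ofLinearMap
    { toFun := fun f => (exists_rho hl x hx f).choose
      map_add' := fun f g => by
        apply hl.ext
        intro j
        obtain ⟨s, hs⟩ := hx j
        rw [map_add, (exists_rho hl x hx _).choose_spec j s hs,
          (exists_rho hl x hx _).choose_spec j s hs, (exists_rho hl x hx _).choose_spec j s hs]
        simp
      map_smul' := fun c g => by
        apply hl.ext
        intro j
        obtain ⟨s, hs⟩ := hx j
        rw [map_smul, (exists_rho hl x hx _).choose_spec j s hs,
          (exists_rho hl x hx _).choose_spec j s hs, ← map_smul]
        congr 1
        ext d
        simp [coeff_trunc] }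
    (by
      apply hl.ext
      intro j
      obtain ⟨s, hs⟩ := hx j
      change lev j (exists_rho hl x hx _).choose = _
      rw [(exists_rho hl x hx _).choose_spec j s hs, ← Polynomial.coe_one, aeval_trunc_coe _ _ hs]
      simp)
    (fun f g => by
      apply hl.ext
      intro j
      obtain ⟨s, hs⟩ := hx j
      change lev j (exists_rho hl x hx _).choose =
        lev j ((exists_rho hl x hx _).choose * (exists_rho hl x hx _).choose)
      rw [map_mul, (exists_rho hl x hx _).choose_spec j s hs,
        (exists_rho hl x hx _).choose_spec j s hs, (exists_rho hl x hx _).choose_spec j s hs,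
        ← trunc_trunc_mul_trunc, ← Polynomial.coe_mul, aeval_trunc_coe _ _ hs, map_mul])

lemma lev_rho (hl : IsLevSys lev) (x : R) (hx : ∀ j, IsNilpotent (lev j x)) (f : PowerSeries k)
    (j : J) (s : ℕ) (hs : lev j x ^ s = 0) :
    lev j (rho hl x hx f) = Polynomial.aeval (lev j x) (PowerSeries.trunc s f) :=
  (exists_rho hl x hx f).choose_spec j s hs

lemma rho_coe (hl : IsLevSys lev) (x : R) (hx : ∀ j, IsNilpotent (lev j x)) (P : Polynomial k) :
    rho hl x hx (P : PowerSeries k) = Polynomial.aeval x P := by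
  apply hl.ext
  intro j
  obtain ⟨s, hs⟩ := hx j
  rw [lev_rho hl x hx _ j s hs, aeval_trunc_coe _ _ hs, Polynomial.aeval_algHom_apply]

lemma rho_X (hl : IsLevSys lev) (x : R) (hx : ∀ j, IsNilpotent (lev j x)) :
    rho hl x hx PowerSeries.X = x := by
  rw [← Polynomial.coe_X, rho_coe, Polynomial.aeval_X]

/-- At each level, `rho` has polynomial values. -/
lemma exists_lev_rho_eq (hl : IsLevSys lev) (x : R) (hx : ∀ j, IsNilpotent (lev j x))
    (f : PowerSeries k) (j : J) :
    ∃ P : Polynomial k, lev j (rho hl x hx f) = lev j (Polynomial.aeval x P) := by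
  obtain ⟨s, hs⟩ := hx j
  exact ⟨_, (lev_rho hl x hx f j s hs).trans (Polynomial.aeval_algHom_apply _ _ _)⟩

/-- The evaluation map `K^m → R` attached to a finite family. -/
def rhoSum (hl : IsLevSys lev) (x : R) (hx : ∀ j, IsNilpotent (lev j x)) {ι : Type*} [Fintype ι]
    (b : ι → R) : (ι → PowerSeries k) →ₗ[k] R where
  toFun f := ∑ i, rho hl x hx (f i) * b i
  map_add' f g := by simp [add_mul, Finset.sum_add_distrib]
  map_smul' c f := by simp [Finset.smul_sum]

/-- Coefficientwise description of families of power series. -/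
def psCoeffEquiv (k : Type) [Field k] (ι : Type*) : (ι × ℕ → k) ≃ₗ[k] (ι → PowerSeries k) where
  toFun w i := PowerSeries.mk fun d => w (i, d)
  invFun f t := PowerSeries.coeff t.2 (f t.1)
  left_inv w := by ext ⟨i, d⟩; simp
  right_inv f := by ext i d; simp
  map_add' f g := by ext i d; simp
  map_smul' c f := by ext i d; simp

lemma lev_rho_eq_zero (hl : IsLevSys lev) (x : R) (hx : ∀ j, IsNilpotent (lev j x)) (j : J) (s : ℕ)
    (hs : lev j x ^ s = 0) (f : PowerSeries k) (hf : ∀ d < s, PowerSeries.coeff d f = 0) :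
    lev j (rho hl x hx f) = 0 := by
  rw [lev_rho hl x hx f j s hs]
  have : PowerSeries.trunc s f = 0 := by
    ext d
    by_cases h : d < s
    · simp [PowerSeries.coeff_trunc, h, hf d h]
    · simp [PowerSeries.coeff_trunc, h]
  rw [this, map_zero]

/-- A directed system of cosets of the preimages of the level kernels, intersected with
`X^t`, has a common point. -/
lemma exists_rhoSum_lift (hl : IsLevSys lev) (x : R) (hx : ∀ j, IsNilpotent (lev j x))
    {ι : Type} [Fintype ι] (b : ι → R) (t : ℕ) (v : J → ι → PowerSeries k) (r : J → R)
    (hr : ∀ i j, i ≤ j → lev j (r i) = lev j (r j))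
    (hv : ∀ j, lev j (rhoSum hl x hx b (v j)) = lev j (r j))
    (ht : ∀ i j l, ∀ d < t, PowerSeries.coeff d (v i l) = PowerSeries.coeff d (v j l)) :
    ∃ f : ι → PowerSeries k, (∀ j, lev j (rhoSum hl x hx b f) = lev j (r j)) ∧
      ∀ j l, ∀ d < t, PowerSeries.coeff d (f l) = PowerSeries.coeff d (v j l) := by
  have hx' := hx
  choose s hs using hx'
  have := hl.nonempty
  let ψ : (ι × ℕ → k) →ₗ[k] R := (rhoSum hl x hx b).comp (psCoeffEquiv k ι).toLinearMap
  let K : J → Submodule k (ι × ℕ → k) := fun j =>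
    LinearMap.ker ((lev j).toLinearMap.comp ψ) ⊓
      { carrier := {w | ∀ l, ∀ d < t, w (l, d) = 0}
        add_mem' := fun ha hb l d hd => by simp [ha l d hd, hb l d hd]
        zero_mem' := fun l d hd => rfl
        smul_mem' := fun c a ha l d hd => by simp [ha l d hd] }
  have hK : ∀ j w, w ∈ K j ↔ lev j (ψ w) = 0 ∧ ∀ l, ∀ d < t, w (l, d) = 0 := by
    intro j w; rfl
  obtain ⟨w, hw⟩ := exists_forall_sub_mem hl.dir K
    (fun j => Finset.univ ×ˢ (Finset.range (max (s j) t))) (by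
      intro j w hw
      have hw' : ∀ l, ∀ d < max (s j) t, w (l, d) = 0 := by
        intro l d hd
        exact hw _ (by simp at hd ⊢; exact hd)
      rw [hK]
      refine ⟨?_, fun l d hd => hw' l d (lt_max_of_lt_right hd)⟩
      change lev j (∑ i, _) = 0
      rw [map_sum]
      refine Finset.sum_eq_zero fun i _ => ?_
      rw [map_mul, lev_rho_eq_zero hl x hx j (s j) (hs j), zero_mul]
      intro d hd
      simpa [psCoeffEquiv] using hw' i d (lt_max_of_lt_left hd))
    (fun i j hij w hw => by
      rw [hK] at hw ⊢
      exact ⟨hl.mono i j hij _ hw.1, hw.2⟩)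
    (fun j => (psCoeffEquiv k ι).symm (v j)) (by
      intro i j hij
      rw [hK]
      constructor
      · simp only [ψ, LinearMap.comp_apply, map_sub, LinearEquiv.coe_coe,
          LinearEquiv.apply_symm_apply]
        rw [hl.mono_eq hij (hv i), hv j, hr i j hij, sub_self]
      · intro l d hd
        simp [psCoeffEquiv, ht i j l d hd])
  refine ⟨psCoeffEquiv k ι w, fun j => ?_, fun j l d hd => ?_⟩
  · have := ((hK _ _).1 (hw j)).1
    simp only [ψ, LinearMap.comp_apply, map_sub, LinearEquiv.coe_coe,
          LinearEquiv.apply_symm_apply, sub_eq_zero] at this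
    rw [this, hv]
  · have := ((hK _ _).1 (hw j)).2 l d hd
    simp only [psCoeffEquiv, Pi.sub_apply, sub_eq_zero] at this
    simpa [psCoeffEquiv] using this

/-- Finitely generated `K`-submodules are closed. -/
lemma exists_rhoSum_eq (hl : IsLevSys lev) (x : R) (hx : ∀ j, IsNilpotent (lev j x))
    {ι : Type} [Fintype ι] (b : ι → R) (r : R)
    (h : ∀ j, ∃ f : ι → PowerSeries k, lev j (∑ i, rho hl x hx (f i) * b i) = lev j r) :
    ∃ f : ι → PowerSeries k, r = ∑ i, rho hl x hx (f i) * b i := by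
  choose v hv using h
  obtain ⟨f, hf, -⟩ := exists_rhoSum_lift hl x hx b 0 v (fun _ => r) (fun _ _ _ => rfl) hv
    (by simp)
  exact ⟨f, (hl.ext _ _ hf).symm⟩

/-- The powers of `x` generate open submodules in a finitely generated `K`-submodule. -/
lemma exists_lev_ker_le (hl : IsLevSys lev) (x : R) (hx : ∀ j, IsNilpotent (lev j x))
    {ι : Type} [Fintype ι] (b : ι → R) (t : ℕ) :
    ∃ j, ∀ f : ι → PowerSeries k, lev j (∑ i, rho hl x hx (f i) * b i) = 0 →
      ∃ g : ι → PowerSeries k,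
        ∑ i, rho hl x hx (f i) * b i = x ^ t * ∑ i, rho hl x hx (g i) * b i := by
  have := hl.nonempty
  let τ : (ι → PowerSeries k) →ₗ[k] (ι → Fin t → k) :=
    { toFun := fun f i d => PowerSeries.coeff d (f i)
      map_add' := fun f g => by ext; simp
      map_smul' := fun c f => by ext; simp }
  let Im : J → Submodule k (ι → Fin t → k) := fun j =>
    (LinearMap.ker ((lev j).toLinearMap.comp (rhoSum hl x hx b))).map τ
  have hIm : ∀ i j, i ≤ j → Im i ≤ Im j := by
    intro i j hij
    exact Submodule.map_mono (fun f hf => hl.mono i j hij _ hf)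
  obtain ⟨j, hj⟩ : ∃ j, ∀ i, Module.finrank k (Im j) ≤ Module.finrank k (Im i) := by
    obtain ⟨j, hj⟩ := Nat.sInf_mem (Set.range_nonempty fun j => Module.finrank k (Im j))
    exact ⟨j, fun i => hj.trans_le (Nat.sInf_le ⟨i, rfl⟩)⟩
  have heq : ∀ i, i ≤ j → Im i = Im j := fun i hij =>
    Submodule.eq_of_le_of_finrank_le (hIm i j hij) (hj i)
  have hall : ∀ i, Im j ≤ Im i := by
    intro i
    obtain ⟨l, h1, h2⟩ := hl.dir i j
    rw [← heq l h2]
    exact hIm _ _ h1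
  refine ⟨j, fun f hf => ?_⟩
  have hv : ∀ i, ∃ v : ι → PowerSeries k, lev i (rhoSum hl x hx b v) = 0 ∧ τ v = τ f := by
    intro i
    obtain ⟨v, hv1, hv2⟩ := hall i (Submodule.mem_map_of_mem (show f ∈ LinearMap.ker _ from hf))
    exact ⟨v, hv1, hv2⟩
  choose v hv1 hv2 using hv
  obtain ⟨w, hw1, hw2⟩ := exists_rhoSum_lift hl x hx b t v (fun _ => 0) (fun _ _ _ => rfl)
    (fun i => by rw [hv1, map_zero]) (fun i i' l d hd => by
      have := congrFun (congrFun ((hv2 i).trans (hv2 i').symm) l) ⟨d, hd⟩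
      exact this)
  have hw0 : rhoSum hl x hx b w = 0 := hl.ext _ _ hw1
  have hdvd : ∀ l, ∃ g, f l - w l = PowerSeries.X ^ t * g := by
    intro l
    apply (PowerSeries.X_pow_dvd_iff.2 _)
    intro d hd
    have := congrFun (congrFun (hv2 j) l) ⟨d, hd⟩
    rw [map_sub, hw2 j l d hd, sub_eq_zero]
    exact this.symm
  choose g hg using hdvd
  refine ⟨g, ?_⟩
  have : ∑ i, rho hl x hx (f i) * b i = rhoSum hl x hx b (f - w) := by
    rw [map_sub, hw0, sub_zero]; rfl
  rw [this, Finset.mul_sum]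
  refine Finset.sum_congr rfl fun i _ => ?_
  rw [Pi.sub_apply, hg, map_mul, map_pow, rho_X, mul_assoc]

end LevelSystems

section Fitting

/-- A Fitting decomposition of `a`: on the image of the idempotent `ε` the element `a` has
inverse `b`, on the complement `1 - a` has inverse `c`. -/
structure Fit {R : Type*} [Ring R] (a ε b c : R) : Prop where
  ab : a * b = ε
  ba : b * a = ε
  εb : ε * b = b
  bε : b * ε = b
  lc : (1 - a) * c = 1 - ε
  rc : c * (1 - a) = 1 - ε
  cε : c * ε = 0
  εc : ε * c = 0

variable {k} {R : Type} [Ring R] [Algebra k R] {J : Type} [Preorder J]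
    {A : J → Type} [∀ j, Ring (A j)] [∀ j, Algebra k (A j)] {lev : ∀ j, R →ₐ[k] A j}

lemma Fit.idem {R : Type*} [Ring R] {a ε b c : R} (h : Fit a ε b c) : ε * ε = ε := by
  conv_lhs => rw [← h.ab, mul_assoc, h.ab, h.bε]
  exact h.ab

lemma Fit.pow {R : Type*} [Ring R] {a ε b c : R} (h : Fit a ε b c) (N : ℕ) :
    b ^ (N + 1) * a ^ (N + 1) = ε ∧ a ^ (N + 1) * b ^ (N + 1) = ε := by
  have aε : a * ε = ε * a := by rw [← h.ab, mul_assoc, h.ba, h.ab]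
  induction N with
  | zero => simp [h.ab, h.ba]
  | succ N ih =>
    constructor
    · rw [pow_succ b, pow_succ' a, mul_assoc, ← mul_assoc b a, h.ba, ← mul_assoc, pow_succ b,
        mul_assoc _ b ε, h.bε, ← pow_succ, ih.1]
    · rw [pow_succ a, pow_succ' b, mul_assoc, ← mul_assoc a b, h.ab, ← mul_assoc, mul_assoc,
        pow_succ' b N, ← mul_assoc ε, h.εb, ← pow_succ', ih.2]

lemma Fit.unique {R : Type*} [Ring R] {a ε b c ε' b' c' : R} (h : Fit a ε b c)
    (h' : Fit a ε' b' c') {N N' : ℕ} (hN : a ^ (N + 1) * (1 - ε) = 0)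
    (hN' : a ^ (N' + 1) * (1 - ε') = 0) : ε = ε' ∧ b = b' ∧ c = c' := by
  have comm : ∀ {ε b c : R}, Fit a ε b c → ∀ n, a ^ n * (1 - ε) = (1 - ε) * a ^ n := by
    intro ε b c h n
    have aε : Commute a ε := by
      change a * ε = ε * a
      rw [← h.ab, mul_assoc, h.ba, h.ab]
    exact (Commute.sub_right (Commute.one_right _) aε).pow_left n
  have h1 : ε' * (1 - ε) = 0 := by
    rw [← (h'.pow N).1, mul_assoc, hN, mul_zero]
  have h2 : (1 - ε') * ε = 0 := by
    rw [← (h.pow N').2, ← mul_assoc, ← comm h', hN', zero_mul]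
  have e : ε = ε' := by
    rw [mul_sub, mul_one, sub_eq_zero] at h1
    rw [sub_mul, one_mul, sub_eq_zero] at h2
    rw [h1, ← h2]
  subst e
  refine ⟨rfl, ?_, ?_⟩
  · rw [← h.bε, ← h'.ab, ← mul_assoc, h.ba, h'.εb]
  · have e1 : c * (1 - ε) = c := by rw [mul_sub, h.cε, mul_one, sub_zero]
    have e2 : (1 - ε) * c' = c' := by rw [sub_mul, h'.εc, one_mul, sub_zero]
    rw [← e1, ← h'.lc, ← mul_assoc, h.rc, e2]

open Polynomial in
lemma exists_fit_of_finite {B : Type*} [Ring B] [Algebra k B] [Module.Finite k B] (a : B) :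
    ∃ ε b c : B, Fit a ε b c ∧ ∃ N : ℕ, a ^ (N + 1) * (1 - ε) = 0 := by
  have hinteg : IsIntegral k a := IsIntegral.of_finite k a
  have hne : minpoly k a ≠ 0 := minpoly.ne_zero hinteg
  obtain ⟨q, hq, hnd⟩ := exists_eq_pow_rootMultiplicity_mul_and_not_dvd (minpoly k a) hne 0
  set n := rootMultiplicity 0 (minpoly k a) with hn
  rw [C_0, sub_zero] at hq hnd
  obtain ⟨u, v, huv⟩ : IsCoprime (X ^ (n + 1) : k[X]) q :=
    ((Polynomial.irreducible_X.coprime_iff_not_dvd).2 hnd).pow_left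
  have hz : ∀ P : k[X], aeval a (P * (X ^ n * q)) = 0 := by
    intro P; rw [map_mul, ← hq, minpoly.aeval, mul_zero]
  have key : ∀ P Q W : k[X], P - Q = W * (X ^ n * q) → aeval a P = aeval a Q := by
    intro P Q W h
    rw [← sub_eq_zero, ← map_sub, h, hz]
  let E : k[X] := u * X ^ (n + 1)
  have hE : 1 - E = v * q := by rw [← huv]; ring
  refine ⟨aeval a E, aeval a (u * X ^ n * E),
    aeval a ((1 - E) * ∑ i ∈ Finset.range (n + 1), X ^ i), ?_, n, ?_⟩
  · have hg : ((1 : k[X]) - X) * ∑ i ∈ Finset.range (n + 1), X ^ i = 1 - X ^ (n + 1) :=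
      mul_neg_geom_sum _ _
    have h1a : 1 - a = aeval a (1 - X : k[X]) := by simp
    have hid : aeval a (E * E) = aeval a E := by
      refine key _ _ (-(u * X * v)) ?_
      have : E * E - E = - (E * (1 - E)) := by ring
      rw [this, hE]; simp only [E]; ring
    have hEo : aeval a ((1 - E) * E) = 0 := by
      rw [sub_mul, one_mul, map_sub, hid, sub_self]
    have hXE : X * (u * X ^ n * E) = E * E := by simp only [E]; ring
    constructor
    · rw [← hid, ← hXE, map_mul _ X, aeval_X]
    · rw [← hid, ← hXE, mul_comm X, map_mul _ _ X, aeval_X]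
    · rw [← map_mul]
      rw [show E * (u * X ^ n * E) = u * X ^ n * (E * E) by ring, map_mul, hid, ← map_mul]
    · rw [← map_mul]
      rw [show (u * X ^ n * E) * E = u * X ^ n * (E * E) by ring, map_mul, hid, ← map_mul]
    · rw [h1a, ← map_mul, mul_left_comm, hg, show (1 : B) = aeval a (1 : k[X]) by simp, ← map_sub]
      refine key _ _ (-(v * X)) ?_
      rw [hE]; ring
    · rw [h1a, ← map_mul, mul_comm, mul_left_comm, hg, show (1 : B) = aeval a (1 : k[X]) by simp,
        ← map_sub]
      refine key _ _ (-(v * X)) ?_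
      rw [hE]; ring
    · rw [← map_mul, mul_right_comm, map_mul, hEo, zero_mul]
    · rw [← map_mul, mul_comm E, mul_right_comm, map_mul, hEo, zero_mul]
  · have : a ^ (n + 1) * (1 - aeval a E) = aeval a (X ^ (n + 1) * (1 - E)) := by simp
    rw [this, ← map_zero (aeval (R := k) a)]
    refine key _ _ (X * v) ?_
    rw [hE]; ring

lemma Fit.map {R S : Type*} [Ring R] [Ring S] (f : R →+* S) {a ε b c : R}
    (h : Fit a ε b c) : Fit (f a) (f ε) (f b) (f c) := by
  constructor <;> simp only [← map_mul, ← map_one f, ← map_sub, h.ab, h.ba, h.εb, h.bε, h.lc,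
    h.rc, h.cε, h.εc, map_zero]

lemma exists_fit (hl : IsLevSys lev) (a : R) : ∃ ε b c : R, Fit a ε b c := by
  have h : ∀ j, ∃ ε b c : R, Fit (lev j a) (lev j ε) (lev j b) (lev j c) ∧
      ∃ N : ℕ, lev j a ^ (N + 1) * (1 - lev j ε) = 0 := by
    intro j
    have := hl.fin j
    obtain ⟨ε, b, c, h⟩ := exists_fit_of_finite (k := k) (lev j a)
    obtain ⟨ε, rfl⟩ := hl.surj j ε
    obtain ⟨b, rfl⟩ := hl.surj j b
    obtain ⟨c, rfl⟩ := hl.surj j c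
    exact ⟨ε, b, c, h⟩
  choose ε b c hfit N hN using h
  have hdown : ∀ i j, i ≤ j → lev j (ε i) = lev j (ε j) ∧ lev j (b i) = lev j (b j) ∧
      lev j (c i) = lev j (c j) := by
    intro i j hij
    have hm : ∀ {x y : R}, lev i x = lev i y → lev j x = lev j y := hl.mono_eq hij
    refine Fit.unique (a := lev j a) (N := N i) (N' := N j) ?_ (hfit j) ?_ (hN j)
    · have hf := hfit i
      constructor
      · simpa using hm (x := a * b i) (y := ε i) (by simpa using hf.ab)
      · simpa using hm (x := b i * a) (y := ε i) (by simpa using hf.ba)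
      · simpa using hm (x := ε i * b i) (y := b i) (by simpa using hf.εb)
      · simpa using hm (x := b i * ε i) (y := b i) (by simpa using hf.bε)
      · simpa using hm (x := (1 - a) * c i) (y := 1 - ε i) (by simpa using hf.lc)
      · simpa using hm (x := c i * (1 - a)) (y := 1 - ε i) (by simpa using hf.rc)
      · simpa using hm (x := c i * ε i) (y := 0) (by simpa using hf.cε)
      · simpa using hm (x := ε i * c i) (y := 0) (by simpa using hf.εc)
    · simpa using hm (x := a ^ (N i + 1) * (1 - ε i)) (y := 0) (by simpa using hN i)
  obtain ⟨ε', hε⟩ := hl.complete (fun j => lev j (ε j))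
    (fun i j hij r hr => (hl.mono_eq hij hr).trans (hdown i j hij).1)
  obtain ⟨b', hb⟩ := hl.complete (fun j => lev j (b j))
    (fun i j hij r hr => (hl.mono_eq hij hr).trans (hdown i j hij).2.1)
  obtain ⟨c', hc⟩ := hl.complete (fun j => lev j (c j))
    (fun i j hij r hr => (hl.mono_eq hij hr).trans (hdown i j hij).2.2)
  refine ⟨ε', b', c', ?_⟩
  constructor <;> apply hl.ext <;> intro j <;>
    simp only [map_mul, map_sub, map_one, map_zero, hε, hb, hc]
  exacts [(hfit j).ab, (hfit j).ba, (hfit j).εb, (hfit j).bε, (hfit j).lc, (hfit j).rc,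
    (hfit j).cε, (hfit j).εc]

/-- `f` is a primitive idempotent. -/
structure IsPrimIdem {R : Type*} [Ring R] (f : R) : Prop where
  idem : f * f = f
  ne_zero : f ≠ 0
  prim : ∀ ε : R, ε * ε = ε → f * ε = ε → ε * f = ε → ε = 0 ∨ ε = f

/-- The corner ring of a primitive idempotent is local. -/
lemma IsPrimIdem.local (hl : IsLevSys lev) {f : R} (hf : IsPrimIdem f) (a : R) (h1 : f * a = a)
    (h2 : a * f = a) :
    (∃ b, f * b = b ∧ b * f = b ∧ a * b = f ∧ b * a = f) ∨
    (∃ b, f * b = b ∧ b * f = b ∧ (f - a) * b = f ∧ b * (f - a) = f) := by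
  obtain ⟨ε, b, c, h⟩ := exists_fit hl a
  have e1 : f * ε = ε := by rw [← h.ab, ← mul_assoc, h1]
  have e2 : ε * f = ε := by rw [← h.ba, mul_assoc, h2]
  rcases hf.prim ε h.idem e1 e2 with rfl | rfl
  · right
    have lc : (1 - a) * c = 1 := by rw [h.lc, sub_zero]
    have rc : c * (1 - a) = 1 := by rw [h.rc, sub_zero]
    have fa : f * (1 - a) = f - a := by rw [mul_sub, mul_one, h1]
    have af : (1 - a) * f = f - a := by rw [sub_mul, one_mul, h2]
    have fc : f * c = c * f := by
      calc f * c = c * (1 - a) * (f * c) := by rw [rc, one_mul]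
        _ = c * ((1 - a) * f) * c := by simp only [mul_assoc]
        _ = c * (f * (1 - a)) * c := by rw [af, fa]
        _ = c * f * ((1 - a) * c) := by simp only [mul_assoc]
        _ = c * f := by rw [lc, mul_one]
    refine ⟨f * c, by rw [← mul_assoc, hf.idem], by rw [fc, mul_assoc, hf.idem], ?_, ?_⟩
    · rw [fc, ← fa, mul_assoc, ← mul_assoc (1 - a), lc, one_mul, hf.idem]
    · rw [← af, fc, mul_assoc, ← mul_assoc f, fa, ← af, mul_assoc (1 - a), hf.idem,
        ← mul_assoc, rc, one_mul]
  · left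
    exact ⟨b, h.εb, h.bε, h.ab, h.ba⟩

end Fitting

section Structure

/-- The structural properties of the block `Re` over the power series ring `K` from which the
shape of the block is deduced. -/
structure BlockSetup {k : Type} [Field k] {R : Type} [Ring R] [Algebra k R] {J : Type} [Preorder J]
    {A : J → Type} [∀ j, Ring (A j)] [∀ j, Algebra k (A j)] (lev : ∀ j, R →ₐ[k] A j)
    (K : Type) [CommRing K] [IsDomain K] [IsPrincipalIdealRing K] [Module K R] [IsScalarTower K R R]
    (e : R) {n : ℕ} (S : Fin n → Type) [∀ i, AddCommGroup (S i)] [∀ i, Module R (S i)] : Prop where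
  sys : IsLevSys lev
  block : IsBlockIdem R e
  fin : ∀ L : Submodule R R, (∀ x ∈ L, x * e = x) → Module.Finite K L
  torsionFree : ∀ L : Submodule R R, (∀ x ∈ L, x * e = x) → Module.IsTorsionFree K L
  proj : ∀ L : Submodule R R, (∀ x ∈ L, x * e = x) → Module.Projective R L
  nondeg : ∀ f a : R, f * f = f → a * f = a → a ≠ 0 → ∃ g, f * g * a ≠ 0
  tors : ∀ j, ∃ c : K, c ≠ 0 ∧ ∀ r : R, lev j (c • r) = 0
  opn : ∀ c : K, c ≠ 0 → ∃ j, ∀ r : R, r * e = r → lev j r = 0 → ∃ r', r' * e = r' ∧ r = c • r'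
  simple : ∀ i, IsSimpleModule R (S i)
  inBlock : ∀ i, InBlock R (X := S i) e
  noniso : ∀ i j, i ≠ j → IsEmpty (S i ≃ₗ[R] S j)
  complete : ∀ (T : Type) [AddCommGroup T] [Module R T],
    IsSimpleModule R T → InBlock R (X := T) e → ∃ i, Nonempty (T ≃ₗ[R] S i)

variable {k} {R : Type} [Ring R] [Algebra k R] {J : Type} [Preorder J]
    {A : J → Type} [∀ j, Ring (A j)] [∀ j, Algebra k (A j)] {lev : ∀ j, R →ₐ[k] A j}
    {K : Type} [CommRing K] [IsDomain K] [IsPrincipalIdealRing K] [Module K R] [IsScalarTower K R R]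
    {e : R} {n : ℕ} {S : Fin n → Type} [∀ i, AddCommGroup (S i)] [∀ i, Module R (S i)]

/-- The left ideal `Rf` of an idempotent, as the set of elements fixed by right
multiplication. -/
def lid (f : R) : Submodule R R where
  carrier := {r | r * f = r}
  add_mem' := by intro a b ha hb; simp only [Set.mem_ofPred_eq, add_mul] at *; rw [ha, hb]
  zero_mem' := by simp
  smul_mem' := by
    intro c a ha
    simp only [Set.mem_ofPred_eq, smul_eq_mul, mul_assoc] at *
    rw [ha]

lemma mem_lid {f r : R} : r ∈ lid f ↔ r * f = r := Iff.rfl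

lemma mul_e_of_mem {f r : R} (hfe : f * e = f) (hr : r * f = r) : r * e = r := by
  rw [← hr, mul_assoc, hfe]

/-- Right multiplication as a map between left ideals. -/
def rmul (L L' : Submodule R R) (t : R) (h : ∀ x ∈ L, x * t ∈ L') : L →ₗ[R] L' where
  toFun x := ⟨x * t, h x x.2⟩
  map_add' x y := by ext; simp [add_mul]
  map_smul' c x := by ext; simp [mul_assoc]

/-- The set of elements of `Rf` which do not generate `Rf`. -/
def radl (hl : IsLevSys lev) (f : R) (hf : IsPrimIdem f) : Submodule R R where
  carrier := {r | r * f = r ∧ ∀ s, s * r ≠ f}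
  add_mem' := by
    rintro a b ⟨ha, ha'⟩ ⟨hb, hb'⟩
    refine ⟨by rw [add_mul, ha, hb], fun s hs => ?_⟩
    have h2 : f * s * b = f - f * s * a := by
      rw [eq_sub_iff_add_eq, add_comm, ← mul_add, mul_assoc, hs, hf.idem]
    rcases hf.local hl (f * s * a) (by simp only [← mul_assoc, hf.idem])
        (by rw [mul_assoc, ha]) with ⟨x, -, -, -, hx⟩ | ⟨x, -, -, -, hx⟩
    · exact ha' (x * (f * s)) (by rw [mul_assoc, hx])
    · rw [← h2] at hx
      exact hb' (x * (f * s)) (by rw [mul_assoc, hx])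
  zero_mem' := ⟨zero_mul _, fun s hs => hf.ne_zero (by rw [← hs, mul_zero])⟩
  smul_mem' := by
    rintro c a ⟨ha, ha'⟩
    exact ⟨by rw [smul_eq_mul, mul_assoc, ha], fun s hs => ha' (s * c) (by rw [mul_assoc]; exact hs)⟩

lemma mem_radl {hl : IsLevSys lev} {f : R} {hf : IsPrimIdem f} {r : R} :
    r ∈ radl hl f hf ↔ r * f = r ∧ ∀ s, s * r ≠ f := Iff.rfl

/-- In the corner ring of `f`, elements of `radl f` are quasi-regular. -/
lemma exists_quasi_inv (hl : IsLevSys lev) {f : R} (hf : IsPrimIdem f) {a : R}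
    (ha : a ∈ radl hl f hf) (r : R) : ∃ b, b * (f - f * r * a) = f := by
  rcases hf.local hl (f * r * a) (by simp only [← mul_assoc, hf.idem])
      (by rw [mul_assoc, ha.1]) with ⟨x, -, -, -, hx⟩ | ⟨x, -, -, -, hx⟩
  · exact absurd (by rw [mul_assoc, hx]) (ha.2 (x * (f * r)))
  · exact ⟨x, hx⟩

/-- The annihilator of a generator `s = fs` of a simple module. -/
lemma smul_eq_zero_iff (hl : IsLevSys lev) {f : R} (hf : IsPrimIdem f) {T : Type*} [AddCommGroup T]
    [Module R T] [IsSimpleModule R T] {s : T} (hs : s ≠ 0) (hfs : f • s = s) (r : R) :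
    r • s = 0 ↔ r * f ∈ radl hl f hf := by
  constructor
  · intro h
    refine ⟨by rw [mul_assoc, hf.idem], fun x hx => hs ?_⟩
    rw [← hfs, ← hx, mul_smul, mul_smul, hfs, h, smul_zero]
  · intro h
    by_contra hne
    obtain ⟨x, hx⟩ := IsSimpleModule.toSpanSingleton_surjective R hne s
    rw [LinearMap.toSpanSingleton_apply] at hx
    obtain ⟨b, hb⟩ := exists_quasi_inv hl hf h x
    apply hs
    rw [← hfs, ← hb, mul_smul, sub_smul, mul_smul, mul_smul, mul_smul r, hfs, hx, hfs, sub_self,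
      smul_zero]

lemma nonempty_equiv_of_prim (hl : IsLevSys lev) {f : R} (hf : IsPrimIdem f) {T T' : Type*}
    [AddCommGroup T] [Module R T] [IsSimpleModule R T] [AddCommGroup T'] [Module R T']
    [IsSimpleModule R T'] {s : T} (hs : s ≠ 0) (hfs : f • s = s) {s' : T'} (hs' : s' ≠ 0)
    (hfs' : f • s' = s') : Nonempty (T ≃ₗ[R] T') := by
  have h : LinearMap.ker (LinearMap.toSpanSingleton R T s) =
      LinearMap.ker (LinearMap.toSpanSingleton R T' s') := by
    ext r
    rw [LinearMap.mem_ker, LinearMap.mem_ker, LinearMap.toSpanSingleton_apply,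
      LinearMap.toSpanSingleton_apply, smul_eq_zero_iff hl hf hs hfs,
      smul_eq_zero_iff hl hf hs' hfs']
  exact ⟨(LinearMap.quotKerEquivOfSurjective _
    (IsSimpleModule.toSpanSingleton_surjective R hs)).symm ≪≫ₗ (Submodule.quotEquivOfEq _ _ h) ≪≫ₗ
    (LinearMap.quotKerEquivOfSurjective _ (IsSimpleModule.toSpanSingleton_surjective R hs'))⟩

/-- Rank-nullity for left ideals inside the block. -/
lemma BlockSetup.finrank_ker (hB : BlockSetup lev K e S) {L L' : Submodule R R}
    (hL : ∀ x ∈ L, x * e = x) (φ : L →ₗ[R] L') (hφ : Function.Surjective φ) :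
    Module.finrank K L = Module.finrank K L' +
      Module.finrank K ((LinearMap.ker φ).map L.subtype : Submodule R R) := by
  have := hB.fin L hL
  let φK : L →ₗ[K] L' := φ.restrictScalars K
  have h1 := Submodule.finrank_quotient_add_finrank (LinearMap.ker φK)
  have h2 : Module.finrank K (L ⧸ LinearMap.ker φK) = Module.finrank K L' :=
    (LinearMap.quotKerEquivOfSurjective φK hφ).finrank_eq
  have h3 : Module.finrank K (LinearMap.ker φK) =
      Module.finrank K ((LinearMap.ker φ).map L.subtype : Submodule R R) := by
    let E : LinearMap.ker φ ≃ₗ[R] ((LinearMap.ker φ).map L.subtype : Submodule R R) :=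
      Submodule.equivSubtypeMap _ _
    exact (E.restrictScalars K).finrank_eq
  omega

lemma BlockSetup.eq_bot (hB : BlockSetup lev K e S) {L : Submodule R R}
    (hL : ∀ x ∈ L, x * e = x) (h : Module.finrank K L = 0) : L = ⊥ := by
  have := hB.fin L hL
  have := hB.torsionFree L hL
  rw [Module.finrank_eq_zero_iff_isTorsion] at h
  rw [eq_bot_iff]
  intro x hx
  obtain ⟨a, ha⟩ := @h ⟨x, hx⟩
  have h1 : (a : K) • (⟨x, hx⟩ : L) = 0 := ha
  rcases (smul_eq_zero.1 h1) with h2 | h2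
  · exact absurd h2 (nonZeroDivisors.ne_zero a.2)
  · simpa using congrArg Subtype.val h2

lemma BlockSetup.finrank_le (hB : BlockSetup lev K e S) {L L' : Submodule R R}
    (hL : ∀ x ∈ L', x * e = x) (φ : L →ₗ[R] L') (hφ : Function.Injective φ) :
    Module.finrank K L ≤ Module.finrank K L' := by
  have := hB.fin L' hL
  exact LinearMap.finrank_le_finrank_of_injective (f := φ.restrictScalars K) hφ

/-- Non-zero maps from an indecomposable projective into the block are injective. -/
lemma BlockSetup.inj_of_prim (hB : BlockSetup lev K e S) {f t : R} (hf : IsPrimIdem f)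
    (hft : f * t = t) (hte : t * e = t) (ht : t ≠ 0) {r : R} (hr : r * f = r) (h : r * t = 0) :
    r = 0 := by
  let L := Submodule.span R {t}
  have hL : ∀ x ∈ L, x * e = x := by
    intro x hx
    obtain ⟨a, rfl⟩ := Submodule.mem_span_singleton.1 hx
    rw [smul_eq_mul, mul_assoc, hte]
  have htL : t ∈ L := Submodule.mem_span_singleton_self t
  have := hB.proj L hL
  let φ : lid f →ₗ[R] L := rmul _ _ t (fun x _ => L.smul_mem x htL)
  have hφ : Function.Surjective φ := by
    rintro ⟨x, hx⟩
    obtain ⟨a, rfl⟩ := Submodule.mem_span_singleton.1 hx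
    refine ⟨⟨a * f, by rw [mem_lid, mul_assoc, hf.idem]⟩, ?_⟩
    ext
    change a * f * t = a * t
    rw [mul_assoc, hft]
  obtain ⟨s, hs⟩ := Module.projective_lifting_property φ LinearMap.id hφ
  set w : R := ((s ⟨t, htL⟩ : lid f) : R) with hw
  have hwf : w * f = w := (s ⟨t, htL⟩).2
  have hwt : w * t = t := congrArg Subtype.val (LinearMap.congr_fun hs ⟨t, htL⟩)
  have hsw : ∀ a : R, a * t = t → a * w = w := by
    intro a ha
    have h1 : a • (⟨t, htL⟩ : L) = ⟨t, htL⟩ := Subtype.ext ha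
    have h2 := congrArg (fun z => ((s z : lid f) : R)) h1
    simpa only [map_smul, Submodule.coe_smul, smul_eq_mul] using h2
  rcases hf.prim w (hsw w hwt) (hsw f hft) hwf with h0 | h0
  · rw [h0, zero_mul] at hwt; exact absurd hwt.symm ht
  · have h1 : r • (⟨t, htL⟩ : L) = 0 := Subtype.ext h
    have h2 := congrArg (fun z => ((s z : lid f) : R)) h1
    simp only [map_smul, Submodule.coe_smul, smul_eq_mul, map_zero, Submodule.coe_zero] at h2
    rw [← hw, h0, hr] at h2
    exact h2

/-- Each simple module of the block is the head of an indecomposable projective. -/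
lemma BlockSetup.exists_prim (hB : BlockSetup lev K e S) (i : Fin n) :
    ∃ f : R, IsPrimIdem f ∧ f * e = f ∧ ∃ s : S i, s ≠ 0 ∧ f • s = s := by
  have := hB.simple i
  let Pr : R → Prop := fun f => f * f = f ∧ f * e = f ∧ ∃ s : S i, f • s ≠ 0
  have he : Pr e := by
    refine ⟨hB.block.idem, hB.block.idem, ?_⟩
    have := IsSimpleModule.nontrivial R (S i)
    obtain ⟨s, hs⟩ := exists_ne (0 : S i)
    exact ⟨s, by rwa [hB.inBlock i s]⟩
  obtain ⟨⟨f, hf⟩, hr⟩ := Nat.sInf_mem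
    (Set.range_nonempty (ι := {f // Pr f}) (h := ⟨⟨e, he⟩⟩) fun f => Module.finrank K (lid f.1))
  have hmin : ∀ g, Pr g → Module.finrank K (lid f) ≤ Module.finrank K (lid g) :=
    fun g hg => hr.trans_le (Nat.sInf_le ⟨⟨g, hg⟩, rfl⟩)
  obtain ⟨hff, hfe, s, hs⟩ := hf
  have key : ∀ ε : R, ε * ε = ε → f * ε = ε → ε * f = ε → ε • s ≠ 0 → f - ε = 0 := by
    intro ε h1 h2 h3 h4
    have hle := hmin ε ⟨h1, mul_e_of_mem hfe h3, s, h4⟩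
    let φ : lid f →ₗ[R] lid ε := rmul _ _ ε (fun x _ => by rw [mem_lid, mul_assoc, h1])
    have hφ : Function.Surjective φ := by
      rintro ⟨x, hx⟩
      refine ⟨⟨x, by rw [mem_lid, ← mem_lid.1 hx, mul_assoc, h3]⟩, Subtype.ext hx⟩
    have hk := hB.finrank_ker (fun x hx => mul_e_of_mem hfe hx) φ hφ
    have hz := hB.eq_bot (L := (LinearMap.ker φ).map (lid f).subtype) (by
      rintro x ⟨y, -, rfl⟩
      exact mul_e_of_mem hfe y.2) (by omega)
    have hmem : f - ε ∈ (LinearMap.ker φ).map (lid f).subtype := by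
      refine ⟨⟨f - ε, by rw [mem_lid, sub_mul, hff, h3]⟩, ?_, rfl⟩
      ext
      change (f - ε) * ε = 0
      rw [sub_mul, h2, h1, sub_self]
    rw [hz] at hmem
    exact hmem
  refine ⟨f, ⟨hff, ?_, ?_⟩, hfe, f • s, hs, by rw [← mul_smul, hff]⟩
  · rintro rfl; exact hs (zero_smul _ _)
  · intro ε h1 h2 h3
    by_cases h : ε • s = 0
    · left
      have := key (f - ε) (by simp only [mul_sub, sub_mul, hff, h1, h2, h3]; abel)
        (by rw [mul_sub, hff, h2]) (by rw [sub_mul, hff, h3]) (by rwa [sub_smul, h, sub_zero])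
      rwa [sub_sub_cancel] at this
    · right
      exact (sub_eq_zero.1 (key ε h1 h2 h3 h)).symm

end Structure

section Structure

variable {k} {R : Type} [Ring R] [Algebra k R] {J : Type} [Preorder J]
    {A : J → Type} [∀ j, Ring (A j)] [∀ j, Algebra k (A j)] {lev : ∀ j, R →ₐ[k] A j}
    {K : Type} [CommRing K] [IsDomain K] [IsPrincipalIdealRing K] [Module K R] [IsScalarTower K R R]
    {e : R} {n : ℕ} {S : Fin n → Type} [∀ i, AddCommGroup (S i)] [∀ i, Module R (S i)]

/-- A choice of primitive idempotents, one for each simple module of the block. -/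
structure PrimSystem (e : R) {n : ℕ} (S : Fin n → Type) [∀ i, AddCommGroup (S i)]
    [∀ i, Module R (S i)] (f : Fin n → R) (s : ∀ i, S i) : Prop where
  prim : ∀ i, IsPrimIdem (f i)
  mul_e : ∀ i, f i * e = f i
  ne_zero : ∀ i, s i ≠ 0
  smul : ∀ i, f i • s i = s i

lemma BlockSetup.exists_primSystem (hB : BlockSetup lev K e S) :
    ∃ (f : Fin n → R) (s : ∀ i, S i), PrimSystem e S f s := by
  choose f h1 h2 s h3 h4 using hB.exists_prim
  exact ⟨f, s, h1, h2, h3, h4⟩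

variable {f : Fin n → R} {s : ∀ i, S i}

lemma BlockSetup.mem_radl_of_ne (hB : BlockSetup lev K e S) (hf : PrimSystem e S f s)
    {i j : Fin n} (hij : i ≠ j) {a : R} (h1 : f i * a = a) (h2 : a * f j = a) :
    a ∈ radl hB.sys (f j) (hf.prim j) := by
  refine ⟨h2, fun r hr => ?_⟩
  have := hB.simple i
  have := hB.simple j
  have hne : a • s j ≠ 0 := by
    intro h0
    apply hf.ne_zero j
    rw [← hf.smul j, ← hr, mul_smul, h0, smul_zero]
  obtain ⟨E⟩ := nonempty_equiv_of_prim hB.sys (hf.prim i) (hf.ne_zero i) (hf.smul i) hne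
    (by rw [← mul_smul, h1])
  exact (hB.noniso i j hij).false E

lemma BlockSetup.finrank_radl (hB : BlockSetup lev K e S) {g : R} (hg : IsPrimIdem g)
    (hge : g * e = g) :
    Module.finrank K (radl hB.sys g hg) = Module.finrank K (lid g) := by
  have hle : radl hB.sys g hg ≤ lid g := fun x hx => hx.1
  have h1 : ∀ x ∈ lid g, x * e = x := fun x hx => mul_e_of_mem hge hx
  have h2 : ∀ x ∈ radl hB.sys g hg, x * e = x := fun x hx => h1 x (hle hx)
  apply le_antisymm
  · exact hB.finrank_le h1 (Submodule.inclusion hle) (Submodule.inclusion_injective hle)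
  · obtain ⟨j, hj⟩ : ∃ j, lev j g ≠ 0 := by
      by_contra! h
      exact hg.ne_zero (hB.sys.ext _ _ fun j => by rw [h j, map_zero])
    obtain ⟨c, hc, hc'⟩ := hB.tors j
    have := hB.fin _ h2
    have := hB.torsionFree _ h1
    let φ : lid g →ₗ[K] radl hB.sys g hg :=
      { toFun := fun x => ⟨c • (x : R), by
          refine ⟨by rw [smul_mul_assoc, mem_lid.1 x.2], fun r hr => hj ?_⟩
          rw [← hr, map_mul, hc', mul_zero]⟩
        map_add' := fun x y => by ext; simp
        map_smul' := fun d x => by ext; simp [smul_comm c d] }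
    refine LinearMap.finrank_le_finrank_of_injective (f := φ) ?_
    intro x y hxy
    have h3 : c • (x : R) = c • (y : R) := congrArg Subtype.val hxy
    have h4 : c • x = c • y := Subtype.ext h3
    exact smul_right_injective _ hc h4

lemma BlockSetup.radl_ne_bot (hB : BlockSetup lev K e S) {g : R} (hg : IsPrimIdem g)
    (hge : g * e = g) : ∃ a ∈ radl hB.sys g hg, a ≠ 0 := by
  by_contra! h
  have h0 : radl hB.sys g hg = ⊥ := (Submodule.eq_bot_iff _).2 h
  have h1 := hB.finrank_radl hg hge
  rw [h0, Module.finrank_zero_of_subsingleton] at h1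
  have h2 := hB.eq_bot (fun x hx => mul_e_of_mem hge hx) h1.symm
  apply hg.ne_zero
  have : g ∈ lid g := hg.idem
  rw [h2] at this
  exact this

lemma BlockSetup.exists_corner (hB : BlockSetup lev K e S) {g : R} (hg : IsPrimIdem g)
    (hge : g * e = g) : ∃ u ∈ radl hB.sys g hg, g * u = u ∧ u ≠ 0 := by
  obtain ⟨a, ha, ha0⟩ := hB.radl_ne_bot hg hge
  obtain ⟨x, hx⟩ := hB.nondeg g a hg.idem ha.1 ha0
  exact ⟨g * x * a, Submodule.smul_mem _ (g * x) ha, by simp only [← mul_assoc, hg.idem], hx⟩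

/-- The radical of an indecomposable projective is again an indecomposable projective. -/
lemma BlockSetup.exists_next (hB : BlockSetup lev K e S) (hf : PrimSystem e S f s) (i : Fin n) :
    ∃ (j : Fin n) (t : R), f j * t = t ∧ t ∈ radl hB.sys (f i) (hf.prim i) ∧ t ≠ 0 ∧
      ∀ x ∈ radl hB.sys (f i) (hf.prim i), ∃ r, r * f j = r ∧ x = r * t := by
  set L := radl hB.sys (f i) (hf.prim i) with hLdef
  have hL : ∀ x ∈ L, x * e = x := fun x hx => mul_e_of_mem (hf.mul_e i) hx.1
  have hP : ∀ j, ∀ x ∈ lid (f j), x * e = x := fun j x hx => mul_e_of_mem (hf.mul_e j) hx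
  have := hB.fin L hL
  have : Module.Finite R L := Module.Finite.of_restrictScalars_finite K R L
  have := hB.proj L hL
  obtain ⟨a, ha, ha0⟩ := hB.radl_ne_bot (hf.prim i) (hf.mul_e i)
  have : Nontrivial L := ⟨⟨⟨a, ha⟩, 0, fun h => ha0 (congrArg Subtype.val h)⟩⟩
  obtain ⟨m, hm, -⟩ := (eq_top_or_exists_le_coatom (⊥ : Submodule R L)).resolve_left bot_ne_top
  have hsim : IsSimpleModule R (L ⧸ m) := isSimpleModule_iff_isCoatom.2 hm
  have hblk : InBlock R (X := L ⧸ m) e := by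
    intro x
    obtain ⟨x, rfl⟩ := Submodule.Quotient.mk_surjective m x
    rw [← Submodule.Quotient.mk_smul]
    congr 1
    ext
    change e * (x : R) = x
    rw [(Set.mem_center_iff.1 hB.block.central).comm, hL x x.2]
  obtain ⟨j, ⟨E⟩⟩ := hB.complete (L ⧸ m) hsim hblk
  have := hB.simple j
  have := IsSimpleModule.nontrivial R (S j)
  let α : L →ₗ[R] S j := E.toLinearMap.comp m.mkQ
  have hα : Function.Surjective α := E.surjective.comp (Submodule.mkQ_surjective m)
  let π : lid (f j) →ₗ[R] S j := (LinearMap.toSpanSingleton R (S j) (s j)).comp (lid (f j)).subtype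
  have hπa : ∀ x : lid (f j), π x = (x : R) • s j := fun x => rfl
  have hπ : Function.Surjective π := by
    intro x
    obtain ⟨r, hr⟩ := IsSimpleModule.toSpanSingleton_surjective R (hf.ne_zero j) x
    refine ⟨⟨r * f j, by rw [mem_lid, mul_assoc, (hf.prim j).idem]⟩, ?_⟩
    rw [hπa]
    change (r * f j) • s j = x
    rw [mul_smul, hf.smul]; exact hr
  obtain ⟨γ, hγ⟩ := Module.projective_lifting_property π α hπ
  have hγs : Function.Surjective γ := by
    obtain ⟨x0, hx0⟩ := exists_ne (0 : S j)
    obtain ⟨z, hz⟩ := hα x0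
    have h1 : π (γ z) ≠ 0 := by
      rw [← LinearMap.comp_apply, hγ, hz]; exact hx0
    rw [hπa, ne_eq, smul_eq_zero_iff hB.sys (hf.prim j) (hf.ne_zero j) (hf.smul j),
      mem_lid.1 (γ z).2, mem_radl, not_and] at h1
    have h2 := h1 (γ z).2
    push Not at h2
    obtain ⟨r, hr⟩ := h2
    rintro ⟨y, hy⟩
    refine ⟨(y * r) • z, ?_⟩
    ext
    rw [map_smul]
    change y * r * (γ z : R) = y
    rw [mul_assoc, hr, mem_lid.1 hy]
  set kerL : Submodule R R := (LinearMap.ker γ).map L.subtype with hker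
  have hkL : ∀ x ∈ kerL, x * e = x := by
    rintro x ⟨y, -, rfl⟩
    exact hL y y.2
  have hrk := hB.finrank_ker hL γ hγs
  rw [hB.finrank_radl (hf.prim i) (hf.mul_e i), ← hker] at hrk
  have hpos : 0 < Module.finrank K (lid (f j)) := by
    by_contra h
    have h2 := hB.eq_bot (hP j) (by omega)
    have : f j ∈ lid (f j) := (hf.prim j).idem
    rw [h2] at this
    exact (hf.prim j).ne_zero this
  obtain ⟨u, huL, hfu, hu0⟩ := hB.exists_corner (hf.prim i) (hf.mul_e i)
  set v : R := ((γ ⟨u, huL⟩ : lid (f j)) : R) with hv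
  have hvP : v ∈ lid (f j) := (γ ⟨u, huL⟩).2
  have hfv : f i * v = v := by
    have h1 : f i • (⟨u, huL⟩ : L) = ⟨u, huL⟩ := Subtype.ext hfu
    have h2 := congrArg (fun z => ((γ z : lid (f j)) : R)) h1
    simpa only [map_smul, Submodule.coe_smul, smul_eq_mul] using h2
  have hker0 : kerL = ⊥ := by
    by_cases hv0 : v = 0
    · exfalso
      have hmem : u ∈ kerL := ⟨⟨u, huL⟩, Subtype.ext hv0, rfl⟩
      have := hB.finrank_le hkL (rmul (lid (f i)) kerL u (fun x _ => kerL.smul_mem x hmem)) (by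
        rw [← LinearMap.ker_eq_bot, LinearMap.ker_eq_bot']
        rintro ⟨x, hx⟩ h
        ext
        exact hB.inj_of_prim (hf.prim i) hfu (hL u huL) hu0 hx (congrArg Subtype.val h))
      omega
    · have := hB.finrank_le (hP j)
        (rmul (lid (f i)) (lid (f j)) v (fun x _ => Submodule.smul_mem _ x hvP)) (by
        rw [← LinearMap.ker_eq_bot, LinearMap.ker_eq_bot']
        rintro ⟨x, hx⟩ h
        ext
        exact hB.inj_of_prim (hf.prim i) hfv (hP j v hvP) hv0 hx (congrArg Subtype.val h))
      exact hB.eq_bot hkL (by omega)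
  have hγi : ∀ z : L, γ z = 0 → z = 0 := by
    intro z hz
    have : (z : R) ∈ kerL := ⟨z, hz, rfl⟩
    rw [hker0] at this
    exact Subtype.ext this
  have hinj : Function.Injective γ := (injective_iff_map_eq_zero γ).2 hγi
  have hfj : f j ∈ lid (f j) := (hf.prim j).idem
  obtain ⟨t, ht⟩ := hγs ⟨f j, hfj⟩
  have htv : ∀ r : R, r * f j = (γ (r • t) : R) := by
    intro r
    rw [map_smul, ht]; rfl
  refine ⟨j, t, ?_, t.2, ?_, ?_⟩
  · have : f j • t = t := by
      apply hinj
      ext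
      rw [← htv, ht]
      exact (hf.prim j).idem
    exact congrArg Subtype.val this
  · intro h0
    have : t = 0 := Subtype.ext h0
    rw [this, map_zero] at ht
    exact (hf.prim j).ne_zero (congrArg Subtype.val ht).symm
  · intro x hx
    refine ⟨γ ⟨x, hx⟩, (γ ⟨x, hx⟩).2, ?_⟩
    have : (⟨x, hx⟩ : L) = ((γ ⟨x, hx⟩ : lid (f j)) : R) • t := by
      apply hinj
      ext
      rw [← htv, mem_lid.1 (γ ⟨x, hx⟩).2]
    exact congrArg Subtype.val this

end Structure

section Cycle

variable {k} {R : Type} [Ring R] [Algebra k R] {J : Type} [Preorder J]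
    {A : J → Type} [∀ j, Ring (A j)] [∀ j, Algebra k (A j)] {lev : ∀ j, R →ₐ[k] A j}
    {K : Type} [CommRing K] [IsDomain K] [IsPrincipalIdealRing K] [Module K R] [IsScalarTower K R R]
    {e : R} {n : ℕ} {S : Fin n → Type} [∀ i, AddCommGroup (S i)] [∀ i, Module R (S i)]

/-- The composite of `m` consecutive arrows starting at the vertex `b`. -/
def tau (F T : ℕ → R) (b : ℕ) : ℕ → R
  | 0 => F b
  | m + 1 => T (b + m) * tau F T b m

/-- The description of the block `Re` as a completed path algebra of a cycle: vertex
idempotents `F m` and arrows `T m`, indexed by natural numbers modulo `n`. -/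
structure CycData (lev : ∀ j, R →ₐ[k] A j) (e : R) (n : ℕ) (F T : ℕ → R) : Prop where
  pos : 0 < n
  F_per : ∀ m, F (m + n) = F m
  T_per : ∀ m, T (m + n) = T m
  prim : ∀ m, IsPrimIdem (F m)
  mul_e : ∀ m, F m * e = F m
  FT : ∀ m, F (m + 1) * T m = T m
  TF : ∀ m, T m * F m = T m
  inj : ∀ m r, r * F (m + 1) = r → r * T m = 0 → r = 0
  step_eq : ∀ m x, F m * x = x → x * F m = x →
    ∃ (c : k) (r : R), F m * r = r ∧ r * F (m + 1) = r ∧ x = c • F m + r * T m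
  step_ne : ∀ a b : ℕ, (a : ZMod n) ≠ b → ∀ x, F a * x = x → x * F b = x →
    ∃ r : R, F a * r = r ∧ r * F (b + 1) = r ∧ x = r * T b
  scal : ∀ m (c : k) (r : R), c • F m = r * T m → c = 0
  nilp : ∀ j b, ∃ m, lev j (tau F T b m) = 0
  opn : ∀ b m, ∃ j, ∀ x, x * F b = x → lev j x = 0 →
    ∃ r, r * F (b + m) = r ∧ x = r * tau F T b m
  full : ∃ (Λ : Type) (_ : Fintype Λ) (α β : Λ → R) (l : Λ → Fin n),
    e = ∑ p, α p * F (l p) * β p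

lemma exists_scalar [IsAlgClosed k] (hl : IsLevSys lev) {g : R} (hg : IsPrimIdem g) {a : R}
    (h1 : g * a = a) (h2 : a * g = a) : ∃ c : k, a - c • g ∈ radl hl g hg := by
  by_contra! h
  have h' : ∀ c : k, ∃ r, r * (a - c • g) = g := by
    intro c
    have := h c
    rw [mem_radl, not_and] at this
    have := this (by rw [sub_mul, h2, smul_mul_assoc, hg.idem])
    push Not at this
    exact this
  obtain ⟨j, hj⟩ : ∃ j, lev j g ≠ 0 := by
    by_contra! h
    exact hg.ne_zero (hl.ext _ _ fun j => by rw [h j, map_zero])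
  have := hl.fin j
  have hinteg : IsIntegral k (lev j a) := IsIntegral.of_finite k _
  have hsp := IsAlgClosed.splits (minpoly k (lev j a))
  have hprod : ∀ s : Multiset k, ∃ r,
      r * (g * Polynomial.aeval a (s.map (fun c => Polynomial.X - Polynomial.C c)).prod) = g := by
    intro s
    induction s using Multiset.induction_on with
    | empty => exact ⟨1, by simp⟩
    | cons c s ih =>
      obtain ⟨r, hr⟩ := ih
      obtain ⟨x, hx⟩ := h' c
      refine ⟨r * x, ?_⟩
      have hga : g * (a - algebraMap k R c) = (a - c • g) * g := by
        rw [mul_sub, sub_mul, h1, h2, smul_mul_assoc, hg.idem, ← Algebra.commutes,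
          Algebra.smul_def]
      rw [Multiset.map_cons, Multiset.prod_cons, map_mul, map_sub, Polynomial.aeval_X,
        Polynomial.aeval_C, ← mul_assoc g, hga, mul_assoc r, ← mul_assoc x, ← mul_assoc x, hx,
        hg.idem, hr]
  obtain ⟨r, hr⟩ := hprod (minpoly k (lev j a)).roots
  have hroots := hsp.eq_prod_roots_of_monic (minpoly.monic hinteg)
  rw [← hroots] at hr
  apply hj
  rw [← hr, map_mul, map_mul, ← Polynomial.aeval_algHom_apply, minpoly.aeval, mul_zero, mul_zero]

section Nilpotent

variable {F T : ℕ → R}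

lemma F_mul_tau (hF : ∀ m, F m * F m = F m) (hFT : ∀ m, F (m + 1) * T m = T m) (b m : ℕ) :
    F (b + m) * tau F T b m = tau F T b m := by
  cases m with
  | zero => exact hF b
  | succ m =>
    change F (b + m + 1) * (T (b + m) * _) = T (b + m) * _
    rw [← mul_assoc, hFT]

lemma tau_mul_F (hF : ∀ m, F m * F m = F m) (b m : ℕ) :
    tau F T b m * F b = tau F T b m := by
  induction m with
  | zero => exact hF b
  | succ m ih =>
    change T (b + m) * tau F T b m * F b = T (b + m) * tau F T b m
    rw [mul_assoc, ih]

lemma exists_lev_tau_eq_zero (hl : IsLevSys lev) (prim : ∀ m, IsPrimIdem (F m))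
    (hFT : ∀ m, F (m + 1) * T m = T m) (hT : ∀ m, T m ∈ radl hl (F m) (prim m)) (j : J) (b : ℕ) :
    ∃ m, lev j (tau F T b m) = 0 := by
  have := hl.fin j
  have : IsArtinian (A j) (A j) := isArtinian_of_tower k inferInstance
  have hanti : ∀ m, Submodule.span (A j) {lev j (tau F T b (m + 1))} ≤
      Submodule.span (A j) {lev j (tau F T b m)} := by
    intro m
    rw [Submodule.span_singleton_le_iff_mem, Submodule.mem_span_singleton]
    exact ⟨lev j (T (b + m)), by rw [smul_eq_mul, ← map_mul]; rfl⟩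
  obtain ⟨m, hm⟩ := IsArtinian.monotone_stabilizes (R := A j) (M := A j)
    ⟨fun m => OrderDual.toDual (Submodule.span (A j) {lev j (tau F T b m)}),
      monotone_nat_of_le_succ hanti⟩
  refine ⟨m, ?_⟩
  have h1 : Submodule.span (A j) {lev j (tau F T b m)} =
    Submodule.span (A j) {lev j (tau F T b (m + 1))} := hm (m + 1) (Nat.le_succ m)
  have h2 : lev j (tau F T b m) ∈ Submodule.span (A j) {lev j (tau F T b (m + 1))} := by
    rw [← h1]; exact Submodule.mem_span_singleton_self _
  obtain ⟨r', hr'⟩ := Submodule.mem_span_singleton.1 h2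
  obtain ⟨r, rfl⟩ := hl.surj j r'
  obtain ⟨x, hx⟩ := exists_quasi_inv hl (prim (b + m)) (hT (b + m)) r
  have h3 : lev j ((F (b + m) - F (b + m) * r * T (b + m)) * tau F T b m) = 0 := by
    rw [sub_mul, F_mul_tau (fun m => (prim m).idem) hFT, mul_assoc, mul_assoc, map_sub, map_mul,
      map_mul]
    change _ - _ * (_ * lev j (tau F T b (m + 1))) = 0
    rw [← smul_eq_mul (lev j r), hr', ← map_mul, F_mul_tau (fun m => (prim m).idem) hFT, sub_self]
  rw [← F_mul_tau (fun m => (prim m).idem) hFT, ← hx, mul_assoc, map_mul, h3, mul_zero]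

end Nilpotent

variable {f : Fin n → R} {s : ∀ i, S i}

/-- The left ideals generated by long paths contain a nonzero multiple of everything. -/
lemma BlockSetup.exists_smul_eq_mul_tau (hB : BlockSetup lev K e S) {F T : ℕ → R}
    (prim : ∀ m, IsPrimIdem (F m))
    (hgen : ∀ m, ∀ x ∈ radl hB.sys (F m) (prim m), ∃ r, r * F (m + 1) = r ∧ x = r * T m)
    (b m : ℕ) : ∃ c : K, c ≠ 0 ∧ ∀ x, x * F b = x → ∃ r, r * F (b + m) = r ∧
      c • x = r * tau F T b m := by
  induction m with
  | zero => exact ⟨1, one_ne_zero, fun x hx => ⟨x, hx, by rw [one_smul]; exact hx.symm⟩⟩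
  | succ m ih =>
    obtain ⟨c, hc, h⟩ := ih
    obtain ⟨j, hj⟩ : ∃ j, lev j (F (b + m)) ≠ 0 := by
      by_contra! h
      exact (prim (b + m)).ne_zero (hB.sys.ext _ _ fun j => by rw [h j, map_zero])
    obtain ⟨d, hd, hd'⟩ := hB.tors j
    refine ⟨d * c, mul_ne_zero hd hc, fun x hx => ?_⟩
    obtain ⟨r, hr, hr'⟩ := h x hx
    obtain ⟨q, hq, hq'⟩ := hgen (b + m) (d • r) ⟨by rw [smul_mul_assoc, hr], fun s hs => hj (by
      rw [← hs, map_mul, hd', mul_zero])⟩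
    refine ⟨q, hq, ?_⟩
    rw [mul_smul, hr', ← smul_mul_assoc, hq', mul_assoc]; rfl

/-- The block is generated by its primitive idempotents. -/
lemma BlockSetup.exists_full (hB : BlockSetup lev K e S) (hf : PrimSystem e S f s) :
    ∃ (Λ : Type) (_ : Fintype Λ) (α β : Λ → R) (l : Λ → Fin n),
      e = ∑ p, α p * f (l p) * β p := by
  let I : Submodule R R := Submodule.span R (Set.range fun p : Fin n × R => f p.1 * p.2)
  have hcen : ∀ x, e * x = x * e := fun x => (Set.mem_center_iff.1 hB.block.central).comm x
  have hI : ∀ x ∈ I, x * e ∈ I := by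
    intro x hx
    induction hx using Submodule.span_induction with
    | mem x hx =>
      obtain ⟨p, rfl⟩ := hx
      exact Submodule.subset_span ⟨(p.1, p.2 * e), by simp [mul_assoc]⟩
    | zero => simp
    | add x y _ _ hx hy => rw [add_mul]; exact I.add_mem hx hy
    | smul a x _ hx => rw [smul_mul_assoc]; exact I.smul_mem a hx
  have heI : e ∈ I := by
    by_contra hne
    have htop : I ⊔ Submodule.span R {1 - e} ≠ ⊤ := by
      intro h
      have h1 : (1 : R) ∈ I ⊔ Submodule.span R {1 - e} := by rw [h]; trivial
      obtain ⟨x, hx, y, hy, hxy⟩ := Submodule.mem_sup.1 h1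
      obtain ⟨a, rfl⟩ := Submodule.mem_span_singleton.1 hy
      apply hne
      have h2 : x * e = e := by
        have := congrArg (· * e) hxy
        simp only [add_mul, one_mul, smul_eq_mul, mul_assoc, sub_mul, hB.block.idem.eq, sub_self,
          mul_zero, add_zero] at this
        exact this
      rw [← h2]
      exact hI x hx
    obtain ⟨M, hM, hle⟩ := (eq_top_or_exists_le_coatom _).resolve_left htop
    have hsim : IsSimpleModule R (R ⧸ M) := isSimpleModule_iff_isCoatom.2 hM
    have hblk : InBlock R (X := R ⧸ M) e := by
      intro x
      obtain ⟨x, rfl⟩ := Submodule.Quotient.mk_surjective M x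
      rw [← Submodule.Quotient.mk_smul, Submodule.Quotient.eq]
      apply hle
      apply Submodule.mem_sup_right
      rw [Submodule.mem_span_singleton]
      exact ⟨-x, by rw [smul_eq_mul, smul_eq_mul, mul_sub, mul_one, hcen]; noncomm_ring⟩
    obtain ⟨i, ⟨E⟩⟩ := hB.complete _ hsim hblk
    apply hf.ne_zero i
    obtain ⟨y, hy⟩ := E.surjective (s i)
    obtain ⟨x, rfl⟩ := Submodule.Quotient.mk_surjective M y
    rw [← hf.smul i, ← hy, ← map_smul, ← Submodule.Quotient.mk_smul,
      (Submodule.Quotient.mk_eq_zero M).2, map_zero]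
    exact hle (Submodule.mem_sup_left (Submodule.subset_span ⟨(i, x), rfl⟩))
  obtain ⟨c, hc⟩ := (Finsupp.mem_span_range_iff_exists_finsupp).1 heI
  refine ⟨c.support, inferInstance, fun p => c p, fun p => p.1.2, fun p => p.1.1, ?_⟩
  rw [← hc, Finsupp.sum, ← Finset.sum_coe_sort]
  simp [mul_assoc]

variable {σ : Fin n → Fin n} {t : Fin n → R}

/-- Nonzero maps between indecomposable projectives are given by paths. -/
lemma BlockSetup.reach (hB : BlockSetup lev K e S) (hf : PrimSystem e S f s)
    (h1 : ∀ i, f (σ i) * t i = t i) (h2 : ∀ i, t i ∈ radl hB.sys (f i) (hf.prim i))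
    (h3 : ∀ i, ∀ x ∈ radl hB.sys (f i) (hf.prim i), ∃ r, r * f (σ i) = r ∧ x = r * t i)
    {l i : Fin n} {x : R} (hl : f l * x = x) (hi : x * f i = x) (hx : x ≠ 0) :
    ∃ m, σ^[m] i = l := by
  by_contra! hne
  let F : ℕ → R := fun m => f (σ^[m] i)
  let T : ℕ → R := fun m => t (σ^[m] i)
  have hfac : ∀ m, ∃ r, f l * r = r ∧ r * F (0 + m) = r ∧ x = r * tau F T 0 m := by
    intro m
    induction m with
    | zero => exact ⟨x, hl, hi, hi.symm⟩
    | succ m ih =>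
      obtain ⟨r, hr1, hr2, hr3⟩ := ih
      rw [zero_add] at hr2
      obtain ⟨q, hq1, hq2⟩ := h3 _ r (hB.mem_radl_of_ne hf (hne m).symm hr1 hr2)
      refine ⟨f l * q, by rw [← mul_assoc, (hf.prim l).idem], ?_, ?_⟩
      · change f l * q * f (σ^[0 + (m + 1)] i) = f l * q
        rw [zero_add, Function.iterate_succ_apply', mul_assoc, hq1]
      · change x = f l * q * (t (σ^[0 + m] i) * tau F T 0 m)
        rw [zero_add, mul_assoc, ← mul_assoc q, ← hq2, ← hr3, hl]
  apply hx
  apply hB.sys.ext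
  intro j
  obtain ⟨m, hm⟩ := exists_lev_tau_eq_zero (F := F) (T := T) hB.sys (fun m => hf.prim _) (by
    intro m
    change f (σ^[m + 1] i) * t _ = t _
    rw [Function.iterate_succ_apply', h1]) (fun m => h2 _) j 0
  obtain ⟨r, -, -, hr⟩ := hfac m
  rw [hr, map_mul, hm, mul_zero, map_zero]

end Cycle

section Cycle

variable {k} {R : Type} [Ring R] [Algebra k R] {J : Type} [Preorder J]
    {A : J → Type} [∀ j, Ring (A j)] [∀ j, Algebra k (A j)] {lev : ∀ j, R →ₐ[k] A j}
    {K : Type} [CommRing K] [IsDomain K] [IsPrincipalIdealRing K] [Module K R] [IsScalarTower K R R]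
    {e : R} {n : ℕ} {S : Fin n → Type} [∀ i, AddCommGroup (S i)] [∀ i, Module R (S i)]

lemma minimalPeriod_eq_of_orbit {σ : Fin n → Fin n} {i₀ : Fin n}
    (horb : ∀ i, ∃ m, σ^[m] i₀ = i) (hper : ∃ q, 0 < q ∧ σ^[q] i₀ = i₀) :
    Function.minimalPeriod σ i₀ = n := by
  obtain ⟨q, hq, hq'⟩ := hper
  have hpos : 0 < Function.minimalPeriod σ i₀ :=
    Function.IsPeriodicPt.minimalPeriod_pos hq hq'
  have hbij : Function.Bijective
      (fun a : Fin (Function.minimalPeriod σ i₀) => σ^[a.1] i₀) := by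
    constructor
    · intro a b hab
      exact Fin.ext ((Function.iterate_eq_iterate_iff_of_lt_minimalPeriod a.2 b.2).1 hab)
    · intro i
      obtain ⟨m, hm⟩ := horb i
      refine ⟨⟨m % Function.minimalPeriod σ i₀, Nat.mod_lt _ hpos⟩, ?_⟩
      exact (Function.iterate_mod_minimalPeriod_eq).trans hm
  have := Fintype.card_of_bijective hbij
  simpa using this

/-- The indecomposable projectives of a block form a single orbit under `σ`. -/
lemma BlockSetup.exists_iterate (hB : BlockSetup lev K e S) {f : Fin n → R} {s : ∀ i, S i}
    (hf : PrimSystem e S f s) {σ : Fin n → Fin n}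
    (hreach : ∀ l i x, f l * x = x → x * f i = x → x ≠ 0 → ∃ m, σ^[m] i = l)
    (hper : ∀ i, ∃ q, 0 < q ∧ σ^[q] i = i) (i₀ i : Fin n) : ∃ m, σ^[m] i₀ = i := by
  let O : Fin n → Prop := fun i => ∃ m, σ^[m] i₀ = i
  have hsymm : ∀ l i, (∃ m, σ^[m] i = l) → ∃ m, σ^[m] l = i := by
    rintro l i ⟨m, rfl⟩
    obtain ⟨q, hq, hq'⟩ := hper i
    refine ⟨m * q - m, ?_⟩
    rw [← Function.iterate_add_apply, Nat.sub_add_cancel (Nat.le_mul_of_pos_right m hq),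
      mul_comm, Function.iterate_mul]
    exact Function.iterate_fixed hq' m
  have hfwd : ∀ l i, (∃ m, σ^[m] i = l) → O i → O l := by
    rintro l i ⟨m, rfl⟩ ⟨m', rfl⟩
    exact ⟨m + m', Function.iterate_add_apply _ _ _ _⟩
  have horth : ∀ l i x, ¬ (O l ↔ O i) → f l * x * f i = 0 := by
    intro l i x hli
    by_contra hne
    have h := hreach l i (f l * x * f i) (by simp only [← mul_assoc, (hf.prim l).idem])
      (by simp only [mul_assoc, (hf.prim i).idem]) hne
    exact hli ⟨hfwd i l (hsymm l i h), hfwd l i h⟩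
  obtain ⟨Λ, _, α, β, l, hfull⟩ := hB.exists_full hf
  have hcen : ∀ x, e * x = x * e := fun x => (Set.mem_center_iff.1 hB.block.central).comm x
  let u : R := e * ∑ p ∈ Finset.univ.filter (fun p => O (l p)), α p * f (l p) * β p
  let v : R := e * ∑ p ∈ Finset.univ.filter (fun p => ¬ O (l p)), α p * f (l p) * β p
  have huv : e = u + v := by
    rw [← mul_add, Finset.sum_filter_add_sum_filter_not, ← hfull, hB.block.idem.eq]
  have huxv : ∀ x, u * x * v = 0 := by
    intro x
    simp only [u, v, Finset.mul_sum, Finset.sum_mul]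
    refine Finset.sum_eq_zero fun q hq => Finset.sum_eq_zero fun p hp => ?_
    have h := horth (l p) (l q) (β p * x * e * α q) (by
      have h1 := (Finset.mem_filter.1 hq).2
      have h2 := (Finset.mem_filter.1 hp).2
      tauto)
    calc _ = e * α p * (f (l p) * (β p * x * e * α q) * f (l q)) * β q := by
          simp only [mul_assoc]
      _ = 0 := by rw [h]; simp
  have hvxu : ∀ x, v * x * u = 0 := by
    intro x
    simp only [u, v, Finset.mul_sum, Finset.sum_mul]
    refine Finset.sum_eq_zero fun q hq => Finset.sum_eq_zero fun p hp => ?_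
    have h := horth (l p) (l q) (β p * x * e * α q) (by
      have h1 := (Finset.mem_filter.1 hq).2
      have h2 := (Finset.mem_filter.1 hp).2
      tauto)
    calc _ = e * α p * (f (l p) * (β p * x * e * α q) * f (l q)) * β q := by
          simp only [mul_assoc]
      _ = 0 := by rw [h]; simp
  have hue : u * e = u := by
    simp only [u]; rw [mul_assoc, ← hcen, ← mul_assoc, hB.block.idem.eq]
  have hve : v * e = v := by
    simp only [v]; rw [mul_assoc, ← hcen, ← mul_assoc, hB.block.idem.eq]
  have heu : e * u = u := by rw [hcen, hue]
  have hev : e * v = v := by rw [hcen, hve]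
  have huc : ∀ x, u * x = x * u := by
    intro x
    have h1 : u * x = u * x * u := by
      conv_lhs => rw [← hue, mul_assoc, hcen, ← mul_assoc, huv, mul_add, huxv, add_zero]
    have h2 : x * u = u * x * u := by
      conv_lhs => rw [← heu, ← mul_assoc, ← hcen, huv, add_mul, add_mul, hvxu, add_zero]
    rw [h1, h2]
  have hvc : ∀ x, v * x = x * v := by
    intro x
    have h1 : v * x = v * x * v := by
      conv_lhs => rw [← hve, mul_assoc, hcen, ← mul_assoc, huv, mul_add, hvxu, zero_add]
    have h2 : x * v = v * x * v := by
      conv_lhs => rw [← hev, ← mul_assoc, ← hcen, huv, add_mul, add_mul, huxv, zero_add]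
    rw [h1, h2]
  have huv0 : u * v = 0 := by simpa using huxv 1
  have hvu0 : v * u = 0 := by simpa using hvxu 1
  have huu : u * u = u := by
    conv_rhs => rw [← hue, huv, mul_add, huv0, add_zero]
  have hvv : v * v = v := by
    conv_rhs => rw [← hve, huv, mul_add, hvu0, zero_add]
  have hfu : ∀ i, ¬ O i → f i * u = 0 := by
    intro i hi
    simp only [u]
    rw [← mul_assoc, hf.mul_e, Finset.mul_sum]
    refine Finset.sum_eq_zero fun p hp => ?_
    have h := horth i (l p) (α p) (fun h => hi (h.2 (Finset.mem_filter.1 hp).2))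
    rw [← mul_assoc, ← mul_assoc, h, zero_mul]
  have hfv : ∀ i, O i → f i * v = 0 := by
    intro i hi
    simp only [v]
    rw [← mul_assoc, hf.mul_e, Finset.mul_sum]
    refine Finset.sum_eq_zero fun p hp => ?_
    have h := horth i (l p) (α p) (fun h => (Finset.mem_filter.1 hp).2 (h.1 hi))
    rw [← mul_assoc, ← mul_assoc, h, zero_mul]
  have hfuv : ∀ i, f i = f i * u + f i * v := fun i => by rw [← mul_add, ← huv, hf.mul_e]
  rcases hB.block.primitive u v (Semigroup.mem_center_iff.2 fun x => (huc x).symm)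
    (Semigroup.mem_center_iff.2 fun x => (hvc x).symm) huu hvv huv0 hvu0 huv with h0 | h0
  · exfalso
    apply (hf.prim i₀).ne_zero
    rw [hfuv, hfv i₀ ⟨0, rfl⟩, h0, mul_zero, add_zero]
  · by_contra hi
    apply (hf.prim i).ne_zero
    rw [hfuv, hfu _ hi, h0, mul_zero, add_zero]

/-- A block with the structural properties `BlockSetup` is described by a cycle. -/
theorem BlockSetup.exists_cycData [IsAlgClosed k] (hB : BlockSetup lev K e S) :
    ∃ F T : ℕ → R, CycData lev e n F T := by
  obtain ⟨f, s, hf⟩ := hB.exists_primSystem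
  have hfull := hB.exists_full hf
  choose σ t h1 h2 h0 h3 using hB.exists_next hf
  have hreach : ∀ l i x, f l * x = x → x * f i = x → x ≠ 0 → ∃ m, σ^[m] i = l :=
    fun l i x hl hi hx => hB.reach hf h1 h2 h3 hl hi hx
  have hper : ∀ i, ∃ q, 0 < q ∧ σ^[q] i = i := by
    intro i
    obtain ⟨u, hu1, hu2, hu0⟩ := hB.exists_corner (hf.prim i) (hf.mul_e i)
    obtain ⟨r, hr1, hr2⟩ := h3 i u hu1
    obtain ⟨m, hm⟩ := hreach i (σ i) (f i * r) (by rw [← mul_assoc, (hf.prim i).idem])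
      (by rw [mul_assoc, hr1]) (fun h => hu0 (by rw [← hu2, hr2, ← mul_assoc, h, zero_mul]))
    exact ⟨m + 1, Nat.succ_pos m, hm⟩
  have hn : 0 < n := by
    rcases Nat.eq_zero_or_pos n with rfl | h
    · obtain ⟨Λ, _, α, β, l, hl⟩ := hfull
      exact absurd (hl.trans (Finset.sum_eq_zero fun p _ => (l p).elim0)) hB.block.ne_zero
    · exact h
  let i₀ : Fin n := ⟨0, hn⟩
  have horb := hB.exists_iterate hf hreach hper i₀
  have hmin : Function.minimalPeriod σ i₀ = n := minimalPeriod_eq_of_orbit horb (hper i₀)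
  let F : ℕ → R := fun m => f (σ^[m] i₀)
  let T : ℕ → R := fun m => t (σ^[m] i₀)
  have hmod : ∀ m, σ^[m % n] i₀ = σ^[m] i₀ := fun m => by
    have h := Function.iterate_mod_minimalPeriod_eq (f := σ) (x := i₀) (n := m)
    rwa [hmin] at h
  have hiter : ∀ m, σ^[m + n] i₀ = σ^[m] i₀ := fun m => by
    rw [← hmod, Nat.add_mod_right, hmod]
  have hs : ∀ m, f (σ^[m + 1] i₀) = f (σ (σ^[m] i₀)) := fun m => by
    rw [Function.iterate_succ_apply']
  have hprim : ∀ m, IsPrimIdem (F m) := fun m => hf.prim _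
  have hTR : ∀ m, T m ∈ radl hB.sys (F m) (hprim m) := fun m => h2 _
  have hFT : ∀ m, F (m + 1) * T m = T m := fun m => by
    change f (σ^[m + 1] i₀) * _ = _
    rw [hs]; exact h1 _
  have hgen : ∀ m, ∀ x ∈ radl hB.sys (F m) (hprim m),
      ∃ r, r * F (m + 1) = r ∧ x = r * T m := by
    intro m x hx
    obtain ⟨r, hr1, hr2⟩ := h3 _ x hx
    exact ⟨r, by change r * f (σ^[m + 1] i₀) = r; rw [hs]; exact hr1, hr2⟩
  have hgen' : ∀ m, ∀ x ∈ radl hB.sys (F m) (hprim m), ∀ g : R, g * g = g → g * x = x →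
      ∃ r, g * r = r ∧ r * F (m + 1) = r ∧ x = r * T m := by
    intro m x hx g hg hgx
    obtain ⟨r, hr1, hr2⟩ := hgen m x hx
    exact ⟨g * r, by rw [← mul_assoc, hg], by rw [mul_assoc, hr1], by
      rw [mul_assoc, ← hr2, hgx]⟩
  refine ⟨F, T, ?_⟩
  constructor
  · exact hn
  · intro m; change f _ = f _; rw [hiter]
  · intro m; change t _ = t _; rw [hiter]
  · exact hprim
  · intro m; exact hf.mul_e _
  · exact hFT
  · intro m; exact (hTR m).1
  · intro m r hr h
    exact hB.inj_of_prim (hprim (m + 1)) (hFT m) (mul_e_of_mem (hf.mul_e _) (hTR m).1)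
      (h0 _) hr h
  · intro m x hx1 hx2
    obtain ⟨c, hc⟩ := exists_scalar hB.sys (hprim m) hx1 hx2
    obtain ⟨r, hr1, hr2, hr3⟩ := hgen' m _ hc (F m) (hprim m).idem (by
      rw [mul_sub, hx1, mul_smul_comm, (hprim m).idem])
    exact ⟨c, r, hr1, hr2, by rw [← hr3]; abel⟩
  · intro a b hab x hx1 hx2
    have hne : σ^[a] i₀ ≠ σ^[b] i₀ := by
      intro h
      apply hab
      rw [ZMod.natCast_eq_natCast_iff']
      rw [← hmod a, ← hmod b] at h
      exact (Function.iterate_eq_iterate_iff_of_lt_minimalPeriod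
        (by rw [hmin]; exact Nat.mod_lt _ hn) (by rw [hmin]; exact Nat.mod_lt _ hn)).1 h
    exact hgen' b x (hB.mem_radl_of_ne hf hne hx1 hx2) (F a) (hprim a).idem hx1
  · intro m c r h
    by_contra hc
    refine (hTR m).2 (c⁻¹ • r) ?_
    rw [smul_mul_assoc, ← h, smul_smul, inv_mul_cancel₀ hc, one_smul]
  · exact fun j b => exists_lev_tau_eq_zero hB.sys hprim hFT hTR j b
  · intro b m
    obtain ⟨c, hc, h⟩ := hB.exists_smul_eq_mul_tau hprim hgen b m
    obtain ⟨j, hj⟩ := hB.opn c hc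
    refine ⟨j, fun x hx hx0 => ?_⟩
    obtain ⟨x', -, hx'⟩ := hj x (mul_e_of_mem (hf.mul_e _) hx) hx0
    obtain ⟨r, hr1, hr2⟩ := h (x' * F b) (by rw [mul_assoc, (hprim b).idem])
    exact ⟨r, hr1, by rw [← hr2, ← smul_mul_assoc, ← hx', hx]⟩
  · obtain ⟨Λ, hΛ, α, β, l, hl⟩ := hfull
    choose m hm using horb
    refine ⟨Λ, hΛ, α, β, fun p => ⟨m (l p) % n, Nat.mod_lt _ hn⟩, ?_⟩
    have : ∀ p, F (m (l p) % n) = f (l p) := fun p => by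
      change f _ = f _
      rw [hmod, hm]
    simp only [this]
    exact hl

end Cycle

section Theta

variable {k} {R : Type} [Ring R] [Algebra k R] {J : Type} [Preorder J]
    {A : J → Type} [∀ j, Ring (A j)] [∀ j, Algebra k (A j)] {lev : ∀ j, R →ₐ[k] A j}
    {e : R} {n : ℕ} {F T : ℕ → R}

namespace CycData

lemma F_congr (hC : CycData lev e n F T) {a b : ℕ} (h : (a : ZMod n) = b) : F a = F b := by
  rw [ZMod.natCast_eq_natCast_iff'] at h
  have : Function.Periodic F n := hC.F_per
  rw [← this.map_mod_nat a, ← this.map_mod_nat b, h]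

lemma T_congr (hC : CycData lev e n F T) {a b : ℕ} (h : (a : ZMod n) = b) : T a = T b := by
  rw [ZMod.natCast_eq_natCast_iff'] at h
  have : Function.Periodic T n := hC.T_per
  rw [← this.map_mod_nat a, ← this.map_mod_nat b, h]

lemma tau_congr (hC : CycData lev e n F T) {a b : ℕ} (h : (a : ZMod n) = b) (m : ℕ) :
    tau F T a m = tau F T b m := by
  induction m with
  | zero => exact hC.F_congr h
  | succ m ih =>
    change T (a + m) * _ = T (b + m) * _
    rw [ih, hC.T_congr (a := a + m) (b := b + m) (by push_cast; rw [h])]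

lemma F_mul_tau (hC : CycData lev e n F T) (b m : ℕ) :
    F (b + m) * tau F T b m = tau F T b m :=
  ProfiniteBlocks.F_mul_tau (fun m => (hC.prim m).idem) hC.FT b m

lemma tau_mul_F (hC : CycData lev e n F T) (b m : ℕ) :
    tau F T b m * F b = tau F T b m :=
  ProfiniteBlocks.tau_mul_F (fun m => (hC.prim m).idem) b m

lemma tau_mul_tau (hC : CycData lev e n F T) (b m m' : ℕ) :
    tau F T (b + m) m' * tau F T b m = tau F T b (m + m') := by
  induction m' with
  | zero => exact hC.F_mul_tau b m
  | succ m' ih =>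
    change T (b + m + m') * tau F T (b + m) m' * _ = T (b + (m + m')) * tau F T b (m + m')
    rw [mul_assoc, ih, add_assoc]

lemma tau_one (hC : CycData lev e n F T) (b : ℕ) : tau F T b 1 = T b := hC.TF b

lemma tau_succ (hC : CycData lev e n F T) (b m : ℕ) :
    tau F T (b + 1) m * T b = tau F T b (m + 1) := by
  have := hC.tau_mul_tau b 1 m
  rwa [hC.tau_one, add_comm 1 m] at this

lemma exists_lev_tau_eq_zero (hC : CycData lev e n F T) (j : J) (b : ℕ) :
    ∃ N, ∀ m, N ≤ m → lev j (tau F T b m) = 0 := by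
  obtain ⟨N, hN⟩ := hC.nilp j b
  refine ⟨N, fun m hm => ?_⟩
  obtain ⟨d, rfl⟩ := Nat.exists_eq_add_of_le hm
  rw [← hC.tau_mul_tau, map_mul, hN, mul_zero]

/-- The element of `Re` represented by a formal sum of paths starting at `b`. -/
lemma exists_th (hC : CycData lev e n F T) (hl : IsLevSys lev) (b : ℕ) (f : PowerSeries k) :
    ∃ y : R, ∀ j N, (∀ m, N ≤ m → lev j (tau F T b m) = 0) →
      lev j y = ∑ m ∈ Finset.range N, PowerSeries.coeff m f • lev j (tau F T b m) := by
  choose N hN using fun j => hC.exists_lev_tau_eq_zero j b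
  have key : ∀ j N N', (∀ m, N ≤ m → lev j (tau F T b m) = 0) →
      (∀ m, N' ≤ m → lev j (tau F T b m) = 0) →
      ∑ m ∈ Finset.range N, PowerSeries.coeff m f • lev j (tau F T b m) =
      ∑ m ∈ Finset.range N', PowerSeries.coeff m f • lev j (tau F T b m) := by
    intro j
    have : ∀ N N', N ≤ N' → (∀ m, N ≤ m → lev j (tau F T b m) = 0) →
        ∑ m ∈ Finset.range N, PowerSeries.coeff m f • lev j (tau F T b m) =
        ∑ m ∈ Finset.range N', PowerSeries.coeff m f • lev j (tau F T b m) := by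
      intro N N' h h0
      refine Finset.sum_subset (Finset.range_mono h) fun m _ hm => ?_
      rw [h0 m (by simpa using hm), smul_zero]
    intro N N' h h'
    rcases le_total N N' with hle | hle
    · exact this _ _ hle h
    · exact (this _ _ hle h').symm
  obtain ⟨y, hy⟩ := hl.complete
    (fun j => ∑ m ∈ Finset.range (N j), PowerSeries.coeff m f • lev j (tau F T b m)) (by
      intro i j hij r hr
      have hr' : lev i r = lev i (∑ m ∈ Finset.range (N i),
          PowerSeries.coeff m f • tau F T b m) := by
        simp only [map_sum, map_smul]; exact hr
      have h2 := hl.mono_eq hij hr'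
      rw [h2]
      simp only [map_sum, map_smul]
      refine key j _ _ (fun m hm => ?_) (hN j)
      exact hl.mono i j hij _ (hN i m hm))
  exact ⟨y, fun j N' h => (hy j).trans (key j _ _ (hN j) h)⟩

/-- The element of `Re` represented by a formal sum of paths starting at `b`. -/
def th (hC : CycData lev e n F T) (hl : IsLevSys lev) (b : ℕ) (f : PowerSeries k) : R :=
  (hC.exists_th hl b f).choose

variable (hC : CycData lev e n F T) (hl : IsLevSys lev)

lemma lev_th (b : ℕ) (f : PowerSeries k) (j : J) (N : ℕ)
    (h : ∀ m, N ≤ m → lev j (tau F T b m) = 0) :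
    lev j (hC.th hl b f) = ∑ m ∈ Finset.range N, PowerSeries.coeff m f • lev j (tau F T b m) :=
  (hC.exists_th hl b f).choose_spec j N h

lemma th_add (b : ℕ) (f g : PowerSeries k) :
    hC.th hl b (f + g) = hC.th hl b f + hC.th hl b g := by
  refine hl.ext _ _ fun j => ?_
  obtain ⟨N, hN⟩ := hC.exists_lev_tau_eq_zero j b
  simp only [map_add, lev_th hC hl b _ j N hN, add_smul, Finset.sum_add_distrib]

lemma th_smul (b : ℕ) (c : k) (f : PowerSeries k) :
    hC.th hl b (c • f) = c • hC.th hl b f := by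
  refine hl.ext _ _ fun j => ?_
  obtain ⟨N, hN⟩ := hC.exists_lev_tau_eq_zero j b
  rw [map_smul, lev_th hC hl b _ j N hN, lev_th hC hl b _ j N hN, Finset.smul_sum]
  simp only [map_smul, smul_eq_mul, mul_smul]

lemma th_zero (b : ℕ) : hC.th hl b 0 = 0 := by
  have := th_smul hC hl b 0 0
  simpa using this

lemma th_one (b : ℕ) : hC.th hl b 1 = F b := by
  refine hl.ext _ _ fun j => ?_
  obtain ⟨N, hN⟩ := hC.exists_lev_tau_eq_zero j b
  rw [lev_th hC hl b _ j (N + 1) (fun m hm => hN m (by omega)), Finset.sum_range_succ']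
  simp [PowerSeries.coeff_one, tau]

lemma th_sub (b : ℕ) (f g : PowerSeries k) :
    hC.th hl b (f - g) = hC.th hl b f - hC.th hl b g := by
  rw [eq_sub_iff_add_eq, ← th_add, sub_add_cancel]

lemma th_mul_F (b : ℕ) (f : PowerSeries k) : hC.th hl b f * F b = hC.th hl b f := by
  refine hl.ext _ _ fun j => ?_
  obtain ⟨N, hN⟩ := hC.exists_lev_tau_eq_zero j b
  rw [map_mul, lev_th hC hl b _ j N hN, Finset.sum_mul]
  simp only [smul_mul_assoc, ← map_mul, hC.tau_mul_F]

lemma F_mul_th {a b : ℕ} {f : PowerSeries k}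
    (hf : ∀ m : ℕ, (m : ZMod n) ≠ (a : ZMod n) - b → PowerSeries.coeff m f = 0) :
    F a * hC.th hl b f = hC.th hl b f := by
  refine hl.ext _ _ fun j => ?_
  obtain ⟨N, hN⟩ := hC.exists_lev_tau_eq_zero j b
  rw [map_mul, lev_th hC hl b _ j N hN, Finset.mul_sum]
  refine Finset.sum_congr rfl fun m _ => ?_
  by_cases hm : (m : ZMod n) = (a : ZMod n) - b
  · rw [mul_smul_comm, ← map_mul, hC.F_congr (a := a) (b := b + m) (by push_cast; rw [hm]; ring),
      hC.F_mul_tau]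
  · rw [hf m hm, zero_smul, mul_zero]

lemma th_mul_th {a b : ℕ} (f : PowerSeries k) {g : PowerSeries k}
    (hg : ∀ m : ℕ, (m : ZMod n) ≠ (a : ZMod n) - b → PowerSeries.coeff m g = 0) :
    hC.th hl a f * hC.th hl b g = hC.th hl b (f * g) := by
  refine hl.ext _ _ fun j => ?_
  obtain ⟨N₁, hN₁⟩ := hC.exists_lev_tau_eq_zero j a
  obtain ⟨N₂, hN₂⟩ := hC.exists_lev_tau_eq_zero j b
  have ha : ∀ m, max N₁ N₂ ≤ m → lev j (tau F T a m) = 0 := fun m hm => hN₁ m (by omega)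
  have hb : ∀ m, max N₁ N₂ ≤ m → lev j (tau F T b m) = 0 := fun m hm => hN₂ m (by omega)
  generalize max N₁ N₂ = N at ha hb
  let φ : ℕ → ℕ → A j := fun i i' =>
    (PowerSeries.coeff i f * PowerSeries.coeff i' g) • lev j (tau F T b (i + i'))
  have hL : lev j (hC.th hl a f * hC.th hl b g) =
      ∑ i ∈ Finset.range N, ∑ i' ∈ Finset.range N, φ i i' := by
    rw [map_mul, lev_th hC hl a _ j N ha, lev_th hC hl b _ j N hb, Finset.sum_mul_sum]
    refine Finset.sum_congr rfl fun i _ => Finset.sum_congr rfl fun i' _ => ?_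
    by_cases hm : (i' : ZMod n) = (a : ZMod n) - b
    · rw [smul_mul_smul_comm, ← map_mul, hC.tau_congr (a := a) (b := b + i')
        (by push_cast; rw [hm]; ring), hC.tau_mul_tau, add_comm i']
    · simp only [φ, hg i' hm, zero_smul, mul_zero]
  have hR : lev j (hC.th hl b (f * g)) =
      ∑ m ∈ Finset.range N, ∑ i ∈ Finset.range (m + 1), φ i (m - i) := by
    rw [lev_th hC hl b _ j N hb]
    refine Finset.sum_congr rfl fun m _ => ?_
    rw [PowerSeries.coeff_mul, Finset.sum_smul, Finset.Nat.sum_antidiagonal_eq_sum_range_succ_mk]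
    refine Finset.sum_congr rfl fun i hi => ?_
    simp only [φ]
    rw [Nat.add_sub_cancel' (by simpa [Nat.lt_succ_iff] using hi)]
  rw [hL, hR, Finset.sum_range_diag_flip]
  refine Finset.sum_congr rfl fun i hi => ?_
  symm
  refine Finset.sum_subset (Finset.range_mono (Nat.sub_le _ _)) fun i' _ hi' => ?_
  simp only [φ]
  rw [hb, smul_zero]
  simp only [Finset.mem_range] at hi hi'
  omega

lemma th_succ (b : ℕ) (f : PowerSeries k) :
    hC.th hl b f = PowerSeries.coeff 0 f • F b +
      hC.th hl (b + 1) (PowerSeries.mk fun m => PowerSeries.coeff (m + 1) f) * T b := by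
  refine hl.ext _ _ fun j => ?_
  obtain ⟨N₁, hN₁⟩ := hC.exists_lev_tau_eq_zero j b
  obtain ⟨N₂, hN₂⟩ := hC.exists_lev_tau_eq_zero j (b + 1)
  rw [lev_th hC hl b _ j (max N₁ N₂ + 1) (fun m hm => hN₁ m (by omega)),
    Finset.sum_range_succ', map_add, map_mul,
    lev_th hC hl (b + 1) _ j (max N₁ N₂) (fun m hm => hN₂ m (by omega)), Finset.sum_mul, add_comm]
  congr 1
  · rw [map_smul]; rfl
  · refine Finset.sum_congr rfl fun m _ => ?_
    rw [PowerSeries.coeff_mk, smul_mul_assoc, ← map_mul, hC.tau_succ]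

lemma coeff_eq_zero_of_th_eq (m : ℕ) : ∀ (b : ℕ) (f : PowerSeries k) (r : R),
    hC.th hl b f = r * tau F T b m →
    ∀ i < m, PowerSeries.coeff i f = 0 := by
  induction m with
  | zero => intro b f r _ i hi; omega
  | succ m ih =>
    intro b f r h i hi
    have hd : PowerSeries.coeff 0 f • F b = (r * tau F T (b + 1) m -
        hC.th hl (b + 1) (PowerSeries.mk fun m => PowerSeries.coeff (m + 1) f)) * T b := by
      rw [sub_mul, mul_assoc, hC.tau_succ, ← h, th_succ hC hl b f]; abel
    have h0 : PowerSeries.coeff 0 f = 0 := hC.scal _ _ _ hd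
    rw [h0, zero_smul] at hd
    have h1 := hC.inj b _ (by rw [sub_mul, mul_assoc, hC.tau_mul_F, th_mul_F]) hd.symm
    have h2 := ih (b + 1) _ r (sub_eq_zero.1 h1).symm
    cases i with
    | zero => exact h0
    | succ i => simpa using h2 i (by omega)

lemma th_injective {b : ℕ} {f : PowerSeries k} (h : hC.th hl b f = 0) : f = 0 := by
  ext m
  exact coeff_eq_zero_of_th_eq hC hl (m + 1) b f 0 (by rw [h, zero_mul]) m (Nat.lt_succ_self m)

lemma exists_step (hC : CycData lev e n F T) (a b m : ℕ) (r : R) (h1 : F a * r = r) (h2 : r * F (b + m) = r) :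
    ∃ (c : k) (r' : R), ((m : ZMod n) ≠ (a : ZMod n) - b → c = 0) ∧ F a * r' = r' ∧
      r' * F (b + (m + 1)) = r' ∧ r = c • F (b + m) + r' * T (b + m) := by
  by_cases hm : (m : ZMod n) = (a : ZMod n) - b
  · have hF : F a = F (b + m) := hC.F_congr (by push_cast; rw [hm]; ring)
    obtain ⟨c, r', h3, h4, h5⟩ := hC.step_eq (b + m) r (by rw [← hF, h1]) h2
    exact ⟨c, r', fun h => absurd hm h, by rw [hF, h3], h4, h5⟩
  · obtain ⟨r', h3, h4, h5⟩ := hC.step_ne a (b + m) (fun h => hm (by rw [h]; push_cast; ring))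
      r h1 h2
    exact ⟨0, r', fun _ => rfl, h3, h4, by rw [zero_smul, zero_add, h5]⟩

lemma exists_th_eq (a b : ℕ) (x : R) (h1 : F a * x = x) (h2 : x * F b = x) :
    ∃ f : PowerSeries k, (∀ m : ℕ, (m : ZMod n) ≠ (a : ZMod n) - b → PowerSeries.coeff m f = 0) ∧
      hC.th hl b f = x := by
  choose! c r' hc hr1 hr2 hr using hC.exists_step a b
  let r : ℕ → R := fun m => Nat.rec x (fun m r => r' m r) m
  have hrr : ∀ m, F a * r m = r m ∧ r m * F (b + m) = r m := by
    intro m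
    induction m with
    | zero => exact ⟨h1, h2⟩
    | succ m ih => exact ⟨hr1 m _ ih.1 ih.2, hr2 m _ ih.1 ih.2⟩
  have hx : ∀ M, x = ∑ m ∈ Finset.range M, c m (r m) • tau F T b m + r M * tau F T b M := by
    intro M
    induction M with
    | zero => rw [Finset.sum_range_zero, zero_add]; exact h2.symm
    | succ M ih =>
      have h3 : r M = c M (r M) • F (b + M) + r (M + 1) * T (b + M) :=
        hr M _ (hrr M).1 (hrr M).2
      have h4 : r M * tau F T b M =
          c M (r M) • tau F T b M + r (M + 1) * tau F T b (M + 1) := by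
        conv_lhs => rw [h3, add_mul, smul_mul_assoc, hC.F_mul_tau, mul_assoc]
        rfl
      rw [Finset.sum_range_succ, add_assoc, ← h4]
      exact ih
  refine ⟨PowerSeries.mk fun m => c m (r m), fun m hm => ?_, ?_⟩
  · rw [PowerSeries.coeff_mk]
    exact hc m _ (hrr m).1 (hrr m).2 hm
  · refine hl.ext _ _ fun j => ?_
    obtain ⟨N, hN⟩ := hC.exists_lev_tau_eq_zero j b
    rw [lev_th hC hl b _ j N hN]
    conv_rhs => rw [hx N, map_add, map_mul, hN N le_rfl, mul_zero, add_zero, map_sum]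
    simp

end CycData

/-- The description of a block in terms of the completed path algebra of the cycle: the
`θ i j` are the entries of an isomorphism from the path algebra onto the matrices with
entries in `F i * R * F j`, with inverse given by the `ψ i j`. -/
structure ThetaData (lev : ∀ j, R →ₐ[k] A j) (e : R) (n : ℕ) (F : Fin n → R)
    (θ : Fin n → Fin n → cycleAlgebra k n →ₗ[k] R)
    (ψ : Fin n → Fin n → R →ₗ[k] cycleAlgebra k n) : Prop where
  one : ∀ i j, θ i j 1 = if i = j then F i else 0
  mul : ∀ i j C C', θ i j (C * C') = ∑ l, θ i l C * θ l j C'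
  left : ∀ i j C, F i * θ i j C = θ i j C
  right : ∀ i j C, θ i j C * F j = θ i j C
  inj : ∀ C, (∀ i j, θ i j C = 0) → C = 0
  θψ : ∀ a b i j r, θ a b (ψ i j r) = if a = i ∧ b = j then F i * r * F j else 0
  contθ : ∀ v i j, ∃ N, ∀ C : cycleAlgebra k n,
    (∀ m < N, PowerSeries.coeff m (C.1 i j) = 0) → lev v (θ i j C) = 0
  contψ : ∀ i j m, ∃ v, ∀ r, lev v r = 0 → ∀ a b,
    PowerSeries.coeff m ((ψ i j r).1 a b) = 0
  mul_e : ∀ i, F i * e = F i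
  full : ∃ (Λ : Type) (_ : Fintype Λ) (α β : Λ → R) (l : Λ → Fin n),
    e = ∑ p, α p * F (l p) * β p

theorem CycData.exists_thetaData (hC : CycData lev e n F T) (hl : IsLevSys lev) :
    ∃ (F : Fin n → R) (θ : Fin n → Fin n → cycleAlgebra k n →ₗ[k] R)
      (ψ : Fin n → Fin n → R →ₗ[k] cycleAlgebra k n), ThetaData lev e n F θ ψ := by
  have hFF : ∀ m, F m * F m = F m := fun m => (hC.prim m).idem
  have hex : ∀ (i j : Fin n) (r : R), ∃ f : PowerSeries k,
      (∀ m : ℕ, (m : ZMod n) ≠ ((i : ℕ) : ZMod n) - ((j : ℕ) : ZMod n) →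
        PowerSeries.coeff m f = 0) ∧ hC.th hl j f = F i * r * F j := fun i j r =>
    hC.exists_th_eq hl i j _ (by rw [← mul_assoc, ← mul_assoc, hFF]) (by rw [mul_assoc, hFF])
  choose g hg1 hg2 using hex
  have huniq : ∀ (j : Fin n) (f f' : PowerSeries k), hC.th hl j f = hC.th hl j f' → f = f' := by
    intro j f f' h
    exact sub_eq_zero.1 (th_injective hC hl (b := j) (by rw [th_sub, h, sub_self]))
  let θ : Fin n → Fin n → cycleAlgebra k n →ₗ[k] R := fun i j =>
    { toFun := fun C => hC.th hl j (C.1 i j)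
      map_add' := fun C C' => by
        rw [← th_add]; rfl
      map_smul' := fun c C => by
        rw [RingHom.id_apply, ← th_smul]; rfl }
  let ψ : Fin n → Fin n → R →ₗ[k] cycleAlgebra k n := fun i j =>
    { toFun := fun r => ⟨Matrix.single i j (g i j r), by
        intro a b m hm
        by_cases h : i = a ∧ j = b
        · obtain ⟨rfl, rfl⟩ := h
          rw [Matrix.single_apply_same]
          exact hg1 _ _ r m hm
        · rw [Matrix.single_apply, if_neg h, map_zero]⟩
      map_add' := fun r r' => by
        apply Subtype.ext
        change Matrix.single i j _ = Matrix.single i j _ + Matrix.single i j _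
        rw [← Matrix.single_add]
        congr 1
        apply huniq j
        rw [th_add, hg2, hg2, hg2, mul_add, add_mul]
      map_smul' := fun c r => by
        apply Subtype.ext
        change Matrix.single i j _ = c • Matrix.single i j _
        rw [Matrix.smul_single]
        congr 1
        apply huniq j
        rw [th_smul, hg2, hg2, mul_smul_comm, smul_mul_assoc] }
  refine ⟨fun i => F i, θ, ψ, ?_⟩
  constructor
  · intro i j
    change hC.th hl j ((1 : Matrix (Fin n) (Fin n) (PowerSeries k)) i j) = _
    rw [Matrix.one_apply]
    split_ifs with h
    · rw [h, th_one]
    · rw [th_zero]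
  · intro i j C C'
    change hC.th hl j ((C.1 * C'.1) i j) = ∑ l : Fin n, hC.th hl l (C.1 i l) * hC.th hl j (C'.1 l j)
    have hs : ∀ (s : Finset (Fin n)) (φ : Fin n → PowerSeries k),
        hC.th hl j (∑ l ∈ s, φ l) = ∑ l ∈ s, hC.th hl j (φ l) := by
      intro s φ
      induction s using Finset.induction_on with
      | empty => simp [th_zero]
      | insert a s ha ih => rw [Finset.sum_insert ha, Finset.sum_insert ha, th_add, ih]
    rw [Matrix.mul_apply, hs]
    exact Finset.sum_congr rfl fun l _ => (hC.th_mul_th hl _ (C'.2 l j)).symm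
  · intro i j C
    exact hC.F_mul_th hl (C.2 i j)
  · intro i j C
    exact hC.th_mul_F hl _ _
  · intro C h
    apply Subtype.ext
    ext1 i j
    exact th_injective hC hl (h i j)
  · intro a b i j r
    change hC.th hl b (Matrix.single i j (g i j r) a b) = _
    rw [Matrix.single_apply]
    by_cases h : i = a ∧ j = b
    · obtain ⟨rfl, rfl⟩ := h
      simp [hg2]
    · rw [if_neg h, if_neg (fun h' => h ⟨h'.1.symm, h'.2.symm⟩), th_zero]
  · intro v i j
    obtain ⟨N, hN⟩ := hC.exists_lev_tau_eq_zero v j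
    refine ⟨N, fun C h => ?_⟩
    change lev v (hC.th hl j (C.1 i j)) = 0
    rw [lev_th hC hl j _ v N hN]
    exact Finset.sum_eq_zero fun m hm => by rw [h m (Finset.mem_range.1 hm), zero_smul]
  · intro i j m
    obtain ⟨v, hv⟩ := hC.opn j (m + 1)
    refine ⟨v, fun r hr a b => ?_⟩
    change PowerSeries.coeff m (Matrix.single i j (g i j r) a b) = 0
    rw [Matrix.single_apply]
    split_ifs with h
    · obtain ⟨q, -, hq⟩ := hv (F i * r * F j) (by rw [mul_assoc, hFF]) (by
        rw [map_mul, map_mul, hr, mul_zero, zero_mul])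
      exact coeff_eq_zero_of_th_eq hC hl (m + 1) j _ q (by rw [hg2, hq]) m (Nat.lt_succ_self m)
    · rw [map_zero]
  · intro i; exact hC.mul_e _
  · exact hC.full

end Theta

section Transfer

variable {k} {A B Y Z : Type} [Ring A] [Algebra k A] [TopologicalSpace A]
  [Ring B] [Algebra k B] [TopologicalSpace B]
  [AddCommGroup Y] [Module k Y] [Module A Y] [IsScalarTower k A Y] [TopologicalSpace Y]
  [AddCommGroup Z] [Module k Z] [Module B Z] [IsScalarTower k B Z] [TopologicalSpace Z]

/-- The open submodules of finite codimension are closed under finite intersections. -/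
lemma IsPseudocompactMod.exists_iInf {Λ : Type} [Finite Λ] (V : Λ → Submodule A Y)
    (hV : ∀ l, IsOpen (V l : Set Y) ∧ FiniteDimensional k (Y ⧸ (V l).restrictScalars k)) :
    IsOpen ((⨅ l, V l : Submodule A Y) : Set Y) ∧
      FiniteDimensional k (Y ⧸ (⨅ l, V l : Submodule A Y).restrictScalars k) := by
  constructor
  · rw [Submodule.coe_iInf]
    exact isOpen_iInter_of_finite fun l => (hV l).1
  · have := fun l => (hV l).2
    have := Fintype.ofFinite Λ
    let φ : (Y ⧸ (⨅ l, V l : Submodule A Y).restrictScalars k) →ₗ[k]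
        (∀ l, Y ⧸ (V l).restrictScalars k) :=
      LinearMap.pi fun l => Submodule.mapQ _ _ LinearMap.id (fun x hx => by
        have : x ∈ ⨅ l, V l := hx
        exact (Submodule.mem_iInf _).1 this l)
    refine FiniteDimensional.of_injective φ ?_
    rw [← LinearMap.ker_eq_bot, eq_bot_iff]
    intro x hx
    obtain ⟨x, rfl⟩ := Submodule.Quotient.mk_surjective _ x
    rw [Submodule.mem_bot, Submodule.Quotient.mk_eq_zero]
    change x ∈ ⨅ l, V l
    rw [Submodule.mem_iInf]
    intro l
    have h1 := congrFun (LinearMap.mem_ker.1 hx) l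
    exact (Submodule.Quotient.mk_eq_zero _).1 h1

/-- Pseudocompactness passes to closed subspaces of finite powers, over any algebra which
preserves the subspaces cut out by the open submodules. -/
theorem IsPseudocompactMod.transfer (hY : IsPseudocompactMod k A Y) {Λ : Type} [Finite Λ]
    (ι : Z →ₗ[k] (Λ → Y)) (hι : Topology.IsClosedEmbedding ι) [ContinuousSMul B Z]
    (hsub : ∀ V : Submodule A Y, ∀ (b : B) (z : Z), (∀ l, ι z l ∈ V) → ∀ l, ι (b • z) l ∈ V) :
    IsPseudocompactMod k B Z := by
  have := hY.t2
  have := hY.addGroup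
  let P : Submodule A Y → Prop := fun V => IsOpen (V : Set Y) ∧
      FiniteDimensional k (Y ⧸ V.restrictScalars k)
  let Q : Submodule B Z → Prop := fun V => IsOpen (V : Set Z) ∧
      FiniteDimensional k (Z ⧸ V.restrictScalars k)
  let W : Submodule A Y → Submodule B Z := fun V =>
    { carrier := {z | ∀ l, ι z l ∈ V}
      add_mem' := fun {a b} ha hb l => by
        rw [map_add]; exact V.add_mem (ha l) (hb l)
      zero_mem' := fun l => by rw [map_zero]; exact V.zero_mem
      smul_mem' := fun b z hz l => hsub V b z hz l }
  have hmemW : ∀ V z, z ∈ W V ↔ ∀ l, ι z l ∈ V := fun V z => Iff.rfl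
  have hWmono : ∀ V V', V ≤ V' → W V ≤ W V' := fun V V' h z hz l => h (hz l)
  have hWQ : ∀ V, P V → Q (W V) := by
    intro V hV
    constructor
    · have : ((W V : Submodule B Z) : Set Z) = ⋂ l, (fun z => ι z l) ⁻¹' (V : Set Y) := by
        ext z; simp only [Set.mem_iInter]; exact hmemW V z
      rw [this]
      exact isOpen_iInter_of_finite fun l =>
        hV.1.preimage ((continuous_apply l).comp hι.continuous)
    · have := hV.2
      have := Fintype.ofFinite Λ
      let φ : (Z ⧸ (W V).restrictScalars k) →ₗ[k] (Λ → Y ⧸ V.restrictScalars k) :=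
        LinearMap.pi fun l => Submodule.mapQ _ _ ((LinearMap.proj l).comp ι)
          (fun z hz => (hmemW V z).1 hz l)
      refine FiniteDimensional.of_injective φ ?_
      rw [← LinearMap.ker_eq_bot, eq_bot_iff]
      intro x hx
      obtain ⟨x, rfl⟩ := Submodule.Quotient.mk_surjective _ x
      rw [Submodule.mem_bot, Submodule.Quotient.mk_eq_zero]
      intro l
      have h1 := congrFun (LinearMap.mem_ker.1 hx) l
      exact (Submodule.Quotient.mk_eq_zero _).1 h1
  have hWbasis : ∀ U ∈ nhds (0 : Z), ∃ V, P V ∧ (W V : Set Z) ⊆ U := by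
    intro U hU
    rw [hι.isInducing.nhds_eq_comap, map_zero, Filter.mem_comap] at hU
    obtain ⟨U', hU', hUU'⟩ := hU
    rw [nhds_pi, Filter.mem_pi] at hU'
    obtain ⟨I, -, t, ht, htU⟩ := hU'
    choose V hV hVt using fun l => hY.basis.mem_iff.1 (ht l)
    refine ⟨⨅ l, V l, IsPseudocompactMod.exists_iInf V hV, fun z hz => hUU' (htU ?_)⟩
    intro l _
    exact hVt l ((Submodule.mem_iInf _).1 (hz l) l)
  refine ⟨hι.isEmbedding.t2Space, hι.isInducing.topologicalAddGroup ι, inferInstance, ?_, ?_, ?_⟩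
  · refine ⟨fun U => ⟨fun hU => ?_, ?_⟩⟩
    · obtain ⟨V, hV, hVU⟩ := hWbasis U hU
      exact ⟨W V, hWQ V hV, hVU⟩
    · rintro ⟨V, hV, hVU⟩
      exact Filter.mem_of_superset (hV.1.mem_nhds V.zero_mem) hVU
  · rw [eq_bot_iff]
    intro z hz
    rw [Submodule.mem_bot]
    apply hι.injective
    rw [map_zero]
    ext l
    have h1 : ι z l ∈ (⨅ (V : Submodule A Y) (_ : P V), V) := by
      simp only [Submodule.mem_iInf] at hz ⊢
      intro V hV
      exact hz (W V) (hWQ V hV) l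
    have h2 := hY.inf_bot
    rw [show (⨅ (V : Submodule A Y) (_ : P V), V) = ⊥ from h2] at h1
    exact h1
  · intro c hc
    have hmap : ∀ (V V' : Submodule B Z) (_ : V ≤ V') (z : Z),
        mapQ' V V' LinearMap.id (Submodule.Quotient.mk z) = Submodule.Quotient.mk z := by
      intro V V' h z
      have h' : V ≤ V'.comap LinearMap.id := h
      rw [mapQ', dif_pos h']
      rfl
    have hmapY : ∀ (V V' : Submodule A Y) (_ : V ≤ V') (z : Y),
        mapQ' V V' LinearMap.id (Submodule.Quotient.mk z) = Submodule.Quotient.mk z := by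
      intro V V' h z
      have h' : V ≤ V'.comap LinearMap.id := h
      rw [mapQ', dif_pos h']
      rfl
    choose z hz using fun V : {V : Submodule A Y // P V} =>
      Submodule.Quotient.mk_surjective _ (c ⟨W V.1, hWQ V.1 V.2⟩)
    have hzz : ∀ V V' : {V : Submodule A Y // P V}, V.1 ≤ V'.1 → z V - z V' ∈ W V'.1 := by
      intro V V' h
      have h1 := hc ⟨W V.1, hWQ V.1 V.2⟩ ⟨W V'.1, hWQ V'.1 V'.2⟩ (hWmono _ _ h)
      rw [← hz, ← hz] at h1
      rw [hmap _ _ (hWmono _ _ h)] at h1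
      exact (Submodule.Quotient.eq _).1 h1
    have hy : ∀ l, ∃ y : Y, ∀ V : {V : Submodule A Y // P V}, ι (z V) l - y ∈ V.1 := by
      intro l
      obtain ⟨y, hy⟩ := hY.complete (fun V => Submodule.Quotient.mk (ι (z V) l)) (by
        intro V V' h
        rw [hmapY _ _ h, Submodule.Quotient.eq]
        have := hzz V V' h l
        rwa [map_sub] at this)
      exact ⟨y, fun V => (Submodule.Quotient.eq _).1 (hy V)⟩
    choose y hy using hy
    have hyr : y ∈ Set.range ι := by
      rw [← hι.isClosed_range.closure_eq, mem_closure_iff_nhds]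
      intro U hU
      have hU2 : (fun x => y + x) ⁻¹' U ∈ nhds (0 : Λ → Y) := by
        apply (continuous_const.add continuous_id).continuousAt
        simpa using hU
      rw [nhds_pi, Filter.mem_pi] at hU2
      obtain ⟨I, -, t, ht, htU⟩ := hU2
      choose V hV hVt using fun l => hY.basis.mem_iff.1 (ht l)
      let V₀ : {V : Submodule A Y // P V} := ⟨⨅ l, V l, IsPseudocompactMod.exists_iInf V hV⟩
      refine ⟨ι (z V₀), ?_, ⟨_, rfl⟩⟩
      have h1 : ι (z V₀) - y ∈ (fun x => y + x) ⁻¹' U := by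
        apply htU
        intro l _
        exact hVt l ((Submodule.mem_iInf _).1 (hy l V₀) l)
      simpa using h1
    obtain ⟨x, hx⟩ := hyr
    refine ⟨x, fun V => ?_⟩
    obtain ⟨V₀, hV₀, hVV⟩ := hWbasis V.1 (V.2.1.mem_nhds V.1.zero_mem)
    have h1 := hc ⟨W V₀, hWQ V₀ hV₀⟩ V hVV
    rw [← h1, ← hz ⟨V₀, hV₀⟩, hmap _ _ hVV, Submodule.Quotient.eq]
    apply hVV
    intro l
    rw [map_sub, hx]
    exact hy l ⟨V₀, hV₀⟩

end Transfer

/-- A Morita context between the block `Re` of a topological algebra `R` and a topological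
algebra `B` which is isomorphic, through `θ`, to the algebra of matrices with entries in
`F i * R * F j`. -/
structure MorCtx (k : Type) [Field k] (R B : Type) [Ring R] [Algebra k R] [TopologicalSpace R]
    [Ring B] [Algebra k B] [TopologicalSpace B] (e : R) (n : ℕ) where
  F : Fin n → R
  θ : Fin n → Fin n → B →ₗ[k] R
  ψ : Fin n → Fin n → R →ₗ[k] B
  Λ : Type
  fin : Fintype Λ
  α : Λ → R
  β : Λ → R
  l : Λ → Fin n
  one : ∀ i j, θ i j 1 = if i = j then F i else 0
  mul : ∀ i j C C', θ i j (C * C') = ∑ l, θ i l C * θ l j C'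
  left : ∀ i j C, F i * θ i j C = θ i j C
  right : ∀ i j C, θ i j C * F j = θ i j C
  inj : ∀ C, (∀ i j, θ i j C = 0) → C = 0
  θψ : ∀ a b i j r, θ a b (ψ i j r) = if a = i ∧ b = j then F i * r * F j else 0
  contθ : ∀ i j, Continuous (θ i j)
  contψ : ∀ i j, Continuous (ψ i j)
  mul_e : ∀ i, F i * e = F i
  full : e = ∑ p, α p * F (l p) * β p
  comm : ∀ x, e * x = x * e

namespace MorCtx

variable {k} {R B : Type} [Ring R] [Algebra k R] [TopologicalSpace R]
    [Ring B] [Algebra k B] [TopologicalSpace B] {e : R} {n : ℕ} (D : MorCtx k R B e n)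

attribute [instance] MorCtx.fin

lemma F_idem (i : Fin n) : D.F i * D.F i = D.F i := by
  have := D.left i i 1
  rwa [D.one, if_pos rfl] at this

lemma e_mul (i : Fin n) : e * D.F i = D.F i := by rw [D.comm, D.mul_e]

lemma ext {C C' : B} (h : ∀ i j, D.θ i j C = D.θ i j C') : C = C' :=
  sub_eq_zero.1 (D.inj _ fun i j => by rw [map_sub, h, sub_self])

lemma ψ_mul_ψ (i j j' l : Fin n) (r r' : R) :
    D.ψ i j r * D.ψ j' l r' = if j = j' then D.ψ i l (r * D.F j * r') else 0 := by
  apply D.ext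
  intro a b
  rw [D.mul]
  by_cases ha : a = i
  · by_cases hb : b = l
    · subst ha hb
      by_cases hj : j = j'
      · subst hj
        rw [Finset.sum_eq_single j]
        · simp only [D.θψ, and_self, if_true]
          simp only [← mul_assoc, mul_assoc _ (D.F j) (D.F j), D.F_idem]
        · intro x _ hx
          rw [D.θψ, if_neg (fun h => hx h.2), zero_mul]
        · simp
      · rw [if_neg hj, map_zero]
        refine Finset.sum_eq_zero fun x _ => ?_
        by_cases hx : x = j
        · rw [D.θψ _ _ j', if_neg (fun h => hj (hx.symm.trans h.1)), mul_zero]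
        · rw [D.θψ, if_neg (fun h => hx h.2), zero_mul]
    · rw [Finset.sum_eq_zero fun x _ => by
        rw [D.θψ _ _ j', if_neg (fun h => hb h.2), mul_zero]]
      split_ifs
      · rw [D.θψ, if_neg (fun h => hb h.2)]
      · rw [map_zero]
  · rw [Finset.sum_eq_zero fun x _ => by
      rw [D.θψ _ _ i, if_neg (fun h => ha h.1), zero_mul]]
    split_ifs
    · rw [D.θψ, if_neg (fun h => ha h.1)]
    · rw [map_zero]

lemma ψ_mul (i j l : Fin n) (r r' : R) :
    D.ψ i j r * D.ψ j l r' = D.ψ i l (r * D.F j * r') := by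
  rw [D.ψ_mul_ψ, if_pos rfl]

lemma ψ_congr {i j : Fin n} {r r' : R} (h : D.F i * r * D.F j = D.F i * r' * D.F j) :
    D.ψ i j r = D.ψ i j r' := by
  apply D.ext
  intro a b
  rw [D.θψ, D.θψ, h]

lemma sum_ψ (C : B) : C = ∑ i, ∑ j, D.ψ i j (D.θ i j C) := by
  apply D.ext
  intro a b
  simp only [map_sum, D.θψ]
  rw [Finset.sum_eq_single a, Finset.sum_eq_single b]
  · rw [if_pos ⟨rfl, rfl⟩, D.left, D.right]
  · intro j _ hj; rw [if_neg (fun h => hj h.2.symm)]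
  · simp
  · intro i _ hi
    exact Finset.sum_eq_zero fun j _ => by rw [if_neg (fun h => hi h.1.symm)]
  · simp

lemma ψ_mul_right (i j : Fin n) (r : R) (C : B) :
    D.ψ i j r * C = ∑ l, D.ψ i l (r * D.θ j l C) := by
  conv_lhs => rw [D.sum_ψ C]
  simp only [Finset.mul_sum, D.ψ_mul_ψ]
  rw [Finset.sum_eq_single j]
  · refine Finset.sum_congr rfl fun l _ => ?_
    rw [if_pos rfl, mul_assoc, D.left]
  · intro j' _ hj'
    exact Finset.sum_eq_zero fun l _ => if_neg (Ne.symm hj')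
  · simp

lemma sum_one : ∑ i, D.ψ i i 1 = 1 := by
  conv_rhs => rw [D.sum_ψ 1]
  refine Finset.sum_congr rfl fun i _ => ?_
  rw [Finset.sum_eq_single i]
  · rw [D.one, if_pos rfl]
    exact D.ψ_congr (by rw [mul_one, D.F_idem, D.F_idem])
  · intro j _ hj
    rw [D.one, if_neg hj.symm, map_zero]
  · simp

lemma sum_ψ_mul (i j : Fin n) (r r' : R) :
    ∑ p, D.ψ i (D.l p) (r * D.α p) * D.ψ (D.l p) j (D.β p * r') = D.ψ i j (r * r') := by
  simp only [D.ψ_mul]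
  rw [← map_sum]
  have : ∑ p, r * D.α p * D.F (D.l p) * (D.β p * r') = r * e * r' := by
    conv_rhs => rw [D.full, Finset.mul_sum, Finset.sum_mul]
    simp only [mul_assoc]
  rw [this]
  apply D.ψ_congr
  rw [mul_assoc r, D.comm, ← mul_assoc r, ← mul_assoc, mul_assoc _ e, D.e_mul]

lemma sum_full (M : Type) [AddCommGroup M] [Module R M] (hM : InBlock R (X := M) e) (m : M) :
    ∑ p, D.α p • D.F (D.l p) • D.β p • m = m := by
  conv_rhs => rw [← hM m, D.full, Finset.sum_smul]
  simp only [mul_smul]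

section Phi

variable (M : Type) [AddCommGroup M] [Module k M] [Module R M] [IsScalarTower k R M]

/-- The underlying vector space of the module over the path algebra associated to `M`. -/
def phiSub : Submodule k (Fin n → M) where
  carrier := {v | ∀ i, D.F i • v i = v i}
  add_mem' ha hb i := by rw [Pi.add_apply, smul_add, ha i, hb i]
  zero_mem' i := smul_zero _
  smul_mem' c v hv i := by
    rw [Pi.smul_apply, ← algebraMap_smul R c (v i), ← mul_smul, ← Algebra.commutes, mul_smul, hv i]

/-- The module over the path algebra associated to `M`. -/
def Phi : Type := D.phiSub M

instance : AddCommGroup (D.Phi M) := inferInstanceAs (AddCommGroup (D.phiSub M))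
instance : Module k (D.Phi M) := inferInstanceAs (Module k (D.phiSub M))

instance : SMul B (D.Phi M) where
  smul C v := ⟨fun i => ∑ j, D.θ i j C • v.1 j, fun i => by
    simp only [Finset.smul_sum, ← mul_smul, D.left]⟩

lemma phi_smul_apply (C : B) (v : D.Phi M) (i : Fin n) :
    (C • v).1 i = ∑ j, D.θ i j C • v.1 j := rfl

instance : Module B (D.Phi M) where
  one_smul v := Subtype.ext (funext fun i => by
    rw [phi_smul_apply, Finset.sum_eq_single i]
    · rw [D.one, if_pos rfl]; exact v.2 i
    · intro j _ hj; rw [D.one, if_neg hj.symm, zero_smul]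
    · simp)
  mul_smul C C' v := Subtype.ext (funext fun i => by
    simp only [phi_smul_apply, D.mul, Finset.sum_smul, Finset.smul_sum, mul_smul]
    exact Finset.sum_comm)
  smul_zero C := Subtype.ext (funext fun i => by
    rw [phi_smul_apply]
    exact Finset.sum_eq_zero fun j _ => smul_zero _)
  smul_add C v w := Subtype.ext (funext fun i => by
    change ∑ j, D.θ i j C • (v.1 j + w.1 j) =
      ∑ j, D.θ i j C • v.1 j + ∑ j, D.θ i j C • w.1 j
    simp only [smul_add, Finset.sum_add_distrib])
  add_smul C C' v := Subtype.ext (funext fun i => by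
    change ∑ j, D.θ i j (C + C') • v.1 j =
      ∑ j, D.θ i j C • v.1 j + ∑ j, D.θ i j C' • v.1 j
    simp only [map_add, add_smul, Finset.sum_add_distrib])
  zero_smul v := Subtype.ext (funext fun i => by
    rw [phi_smul_apply]
    exact Finset.sum_eq_zero fun j _ => by rw [map_zero, zero_smul])

instance : IsScalarTower k B (D.Phi M) where
  smul_assoc c C v := Subtype.ext (funext fun i => by
    change ∑ j, D.θ i j (c • C) • v.1 j = c • ∑ j, D.θ i j C • v.1 j
    simp only [map_smul, smul_assoc, Finset.smul_sum])

variable [TopologicalSpace M]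

instance : TopologicalSpace (D.Phi M) := inferInstanceAs (TopologicalSpace (D.phiSub M))

/-- The inclusion of `Phi M` in a finite power of `M`. -/
def phiVal : D.Phi M →ₗ[k] (Fin n → M) where
  toFun v := v.1
  map_add' _ _ := rfl
  map_smul' _ _ := rfl

lemma phi_pc (hM : IsPseudocompactMod k R M) : IsPseudocompactMod k B (D.Phi M) := by
  have := hM.t2
  have := hM.addGroup
  have := hM.contSMul
  have : ContinuousSMul B (D.Phi M) := ⟨by
    refine Continuous.subtype_mk (continuous_pi fun i => ?_) _
    refine continuous_finsetSum _ fun j _ => ?_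
    exact ((D.contθ i j).comp continuous_fst).smul
      ((continuous_apply j).comp (continuous_subtype_val.comp continuous_snd))⟩
  refine hM.transfer (D.phiVal M) ?_ ?_
  · refine Topology.IsClosedEmbedding.mk Topology.IsEmbedding.subtypeVal ?_
    have : Set.range (D.phiVal M) = ⋂ i, {v : Fin n → M | D.F i • v i = v i} := by
      ext v
      simp only [Set.mem_iInter, Set.mem_range]
      exact ⟨fun ⟨w, hw⟩ i => hw ▸ w.2 i, fun h => ⟨⟨v, h⟩, rfl⟩⟩
    rw [this]
    exact isClosed_iInter fun i => isClosed_eq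
      ((continuous_const_smul _).comp (continuous_apply i)) (continuous_apply i)
  · intro V C v hv i
    rw [show D.phiVal M (C • v) i = ∑ j, D.θ i j C • v.1 j from rfl]
    exact V.sum_mem fun j _ => V.smul_mem _ (hv j)

end Phi

section Psi

variable (X : Type) [AddCommGroup X] [Module k X] [Module B X] [IsScalarTower k B X]

/-- The underlying vector space of the block module associated to `X`. -/
def psiSub : Submodule k (D.Λ → X) where
  carrier := {w | ∀ p, ∑ q, D.ψ (D.l p) (D.l q) (D.β p * D.α q) • w q = w p}
  add_mem' ha hb p := by
    simp only [Pi.add_apply, smul_add, Finset.sum_add_distrib]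
    rw [ha p, hb p]
  zero_mem' p := Finset.sum_eq_zero fun q _ => smul_zero _
  smul_mem' c w hw p := by
    conv_rhs => rw [Pi.smul_apply, ← hw p, Finset.smul_sum]
    refine Finset.sum_congr rfl fun q _ => ?_
    rw [Pi.smul_apply, ← algebraMap_smul B c (w q), ← mul_smul, ← Algebra.commutes, mul_smul,
      algebraMap_smul]

/-- The block module associated to `X`. -/
def Psi : Type := D.psiSub X

instance : AddCommGroup (D.Psi X) := inferInstanceAs (AddCommGroup (D.psiSub X))
instance : Module k (D.Psi X) := inferInstanceAs (Module k (D.psiSub X))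

instance : SMul R (D.Psi X) where
  smul r w := ⟨fun p => ∑ q, D.ψ (D.l p) (D.l q) (D.β p * (r * D.α q)) • w.1 q, fun p => by
    simp only [Finset.smul_sum, ← mul_smul]
    rw [Finset.sum_comm]
    simp only [← Finset.sum_smul, D.sum_ψ_mul]⟩

lemma psi_smul_apply (r : R) (w : D.Psi X) (p : D.Λ) :
    (r • w).1 p = ∑ q, D.ψ (D.l p) (D.l q) (D.β p * (r * D.α q)) • w.1 q := rfl

instance : Module R (D.Psi X) where
  one_smul w := Subtype.ext (funext fun p => by
    rw [psi_smul_apply]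
    simp only [one_mul]
    exact w.2 p)
  mul_smul r r' w := Subtype.ext (funext fun p => by
    simp only [psi_smul_apply, Finset.smul_sum, ← mul_smul]
    rw [Finset.sum_comm]
    refine Finset.sum_congr rfl fun x _ => ?_
    rw [← Finset.sum_smul]
    have := D.sum_ψ_mul (D.l p) (D.l x) (D.β p * r) (r' * D.α x)
    simp only [mul_assoc] at this
    rw [this, mul_assoc])
  smul_zero r := Subtype.ext (funext fun p => by
    rw [psi_smul_apply]
    exact Finset.sum_eq_zero fun j _ => smul_zero _)
  smul_add r v w := Subtype.ext (funext fun p => by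
    change ∑ q, D.ψ (D.l p) (D.l q) (D.β p * (r * D.α q)) • (v.1 q + w.1 q) =
      ∑ q, D.ψ (D.l p) (D.l q) (D.β p * (r * D.α q)) • v.1 q +
      ∑ q, D.ψ (D.l p) (D.l q) (D.β p * (r * D.α q)) • w.1 q
    simp only [smul_add, Finset.sum_add_distrib])
  add_smul r r' v := Subtype.ext (funext fun p => by
    change ∑ q, D.ψ (D.l p) (D.l q) (D.β p * ((r + r') * D.α q)) • v.1 q =
      ∑ q, D.ψ (D.l p) (D.l q) (D.β p * (r * D.α q)) • v.1 q +
      ∑ q, D.ψ (D.l p) (D.l q) (D.β p * (r' * D.α q)) • v.1 q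
    simp only [add_mul, mul_add, map_add, add_smul, Finset.sum_add_distrib])
  zero_smul v := Subtype.ext (funext fun p => by
    rw [psi_smul_apply]
    exact Finset.sum_eq_zero fun j _ => by rw [zero_mul, mul_zero, map_zero, zero_smul])

instance : IsScalarTower k R (D.Psi X) where
  smul_assoc c r v := Subtype.ext (funext fun p => by
    change ∑ q, D.ψ (D.l p) (D.l q) (D.β p * ((c • r) * D.α q)) • v.1 q =
      c • ∑ q, D.ψ (D.l p) (D.l q) (D.β p * (r * D.α q)) • v.1 q
    simp only [smul_mul_assoc, mul_smul_comm, map_smul, smul_assoc, Finset.smul_sum])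

lemma psi_inBlock : InBlock R (X := D.Psi X) e := by
  intro w
  refine Subtype.ext (funext fun p => ?_)
  rw [psi_smul_apply, ← w.2 p]
  refine Finset.sum_congr rfl fun q _ => ?_
  rw [D.ψ_congr (r' := D.β p * D.α q)]
  rw [D.comm, ← mul_assoc (D.β p), ← mul_assoc, mul_assoc _ e, D.e_mul]

variable [TopologicalSpace X]

instance : TopologicalSpace (D.Psi X) := inferInstanceAs (TopologicalSpace (D.psiSub X))

/-- The inclusion of `Psi X` in a finite power of `X`. -/
def psiVal : D.Psi X →ₗ[k] (D.Λ → X) where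
  toFun v := v.1
  map_add' _ _ := rfl
  map_smul' _ _ := rfl

lemma psi_pc [ContinuousMul R] (hX : IsPseudocompactMod k B X) :
    IsPseudocompactMod k R (D.Psi X) := by
  have := hX.t2
  have := hX.addGroup
  have := hX.contSMul
  have : ContinuousSMul R (D.Psi X) := ⟨by
    refine Continuous.subtype_mk (continuous_pi fun i => ?_) _
    refine continuous_finsetSum _ fun j _ => ?_
    refine ((D.contψ _ _).comp ?_).smul
      ((continuous_apply j).comp (continuous_subtype_val.comp continuous_snd))
    exact continuous_const.mul (continuous_fst.mul continuous_const)⟩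
  refine hX.transfer (D.psiVal X) ?_ ?_
  · refine Topology.IsClosedEmbedding.mk Topology.IsEmbedding.subtypeVal ?_
    have : Set.range (D.psiVal X) = ⋂ p, {w : D.Λ → X |
        ∑ q, D.ψ (D.l p) (D.l q) (D.β p * D.α q) • w q = w p} := by
      ext v
      simp only [Set.mem_iInter, Set.mem_range]
      exact ⟨fun ⟨w, hw⟩ i => hw ▸ w.2 i, fun h => ⟨⟨v, h⟩, rfl⟩⟩
    rw [this]
    exact isClosed_iInter fun i => isClosed_eq
      (continuous_finsetSum _ fun j _ =>
        (continuous_const_smul _).comp (continuous_apply j)) (continuous_apply i)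
  · intro V C v hv i
    exact V.sum_mem fun j _ => V.smul_mem _ (hv j)

end Psi

end MorCtx

namespace MorCtx

variable {k} {R B : Type} [Ring R] [Algebra k R] [TopologicalSpace R]
    [Ring B] [Algebra k B] [TopologicalSpace B] {e : R} {n : ℕ} (D : MorCtx k R B e n)

section Functor

variable {M M' : Type} [AddCommGroup M] [Module k M] [Module R M] [IsScalarTower k R M]
  [AddCommGroup M'] [Module k M'] [Module R M'] [IsScalarTower k R M']

lemma psi_smul_phi (i j : Fin n) (r : R) (v : D.Phi M) (a : Fin n) :
    (D.ψ i j r • v).1 a = if a = i then D.F i • r • v.1 j else 0 := by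
  rw [phi_smul_apply]
  split_ifs with h
  · rw [Finset.sum_eq_single j]
    · rw [D.θψ, if_pos ⟨h, rfl⟩, mul_smul, mul_smul, v.2 j]
    · intro b _ hb
      rw [D.θψ, if_neg (fun h => hb h.2), zero_smul]
    · simp
  · exact Finset.sum_eq_zero fun b _ => by rw [D.θψ, if_neg (fun h' => h h'.1), zero_smul]

/-- The map induced by `φ` on the associated modules over `B`. -/
def phiMap (φ : M →ₗ[R] M') : D.Phi M →ₗ[B] D.Phi M' where
  toFun v := ⟨fun i => φ (v.1 i), fun i => by rw [← map_smul, v.2 i]⟩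
  map_add' v w := Subtype.ext (funext fun i => map_add φ _ _)
  map_smul' C v := Subtype.ext (funext fun i => by
    change φ (∑ j, D.θ i j C • v.1 j) = ∑ j, D.θ i j C • φ (v.1 j)
    simp only [map_sum, map_smul])

lemma phiMap_apply (φ : M →ₗ[R] M') (v : D.Phi M) (i : Fin n) :
    (D.phiMap φ v).1 i = φ (v.1 i) := rfl

/-- The element of `Phi M` with only nonzero entry `F i • m`, at `i`. -/
def phiSingle (i : Fin n) : M →+ D.Phi M where
  toFun m := ⟨fun j => if j = i then D.F i • m else 0, fun j => by
    change D.F j • (if j = i then D.F i • m else 0) = if j = i then D.F i • m else 0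
    split_ifs with h
    · rw [h, ← mul_smul, D.F_idem]
    · rw [smul_zero]⟩
  map_zero' := Subtype.ext (funext fun j => by
    change (if j = i then D.F i • (0 : M) else 0) = 0
    rw [smul_zero, ite_self])
  map_add' m m' := Subtype.ext (funext fun j => by
    change (if j = i then D.F i • (m + m') else 0) =
      (if j = i then D.F i • m else 0) + (if j = i then D.F i • m' else 0)
    split_ifs
    · rw [smul_add]
    · rw [add_zero])

lemma phiSingle_apply (i j : Fin n) (m : M) :
    (D.phiSingle i m).1 j = if j = i then D.F i • m else 0 := rfl

lemma psi_smul_eq_single (i j : Fin n) (r : R) (v : D.Phi M) :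
    D.ψ i j r • v = D.phiSingle i (r • v.1 j) :=
  Subtype.ext (funext fun a => by rw [psi_smul_phi, phiSingle_apply])

lemma phiMap_injective (hM : InBlock R (X := M) e) {φ φ' : M →ₗ[R] M'}
    (h : D.phiMap φ = D.phiMap φ') : φ = φ' := by
  ext m
  conv_lhs => rw [← D.sum_full M hM m]
  conv_rhs => rw [← D.sum_full M hM m]
  simp only [map_sum, map_smul φ (D.α _), map_smul φ' (D.α _)]
  refine Finset.sum_congr rfl fun p _ => ?_
  have := congrArg (fun ψ => (ψ (D.phiSingle (D.l p) (D.β p • m))).1 (D.l p)) h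
  simp only [phiMap_apply, phiSingle_apply, if_true] at this
  rw [this]

lemma phiSingle_smul (hM : InBlock R (X := M) e) (i : Fin n) (r : R) (m : M) :
    D.phiSingle i (r • m) =
      ∑ q, D.ψ i (D.l q) (r * D.α q) • D.phiSingle (D.l q) (D.β q • m) := by
  simp only [psi_smul_eq_single]
  rw [← map_sum]
  congr 1
  conv_lhs => rw [← D.sum_full M hM m, Finset.smul_sum]
  refine Finset.sum_congr rfl fun q _ => ?_
  rw [phiSingle_apply, if_pos rfl, mul_smul]

/-- The map between block modules induced by `g`. -/
def phiInv (hM : InBlock R (X := M) e) (hM' : InBlock R (X := M') e)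
    (g : D.Phi M →ₗ[B] D.Phi M') : M →ₗ[R] M' where
  toFun m := ∑ p, D.α p • (g (D.phiSingle (D.l p) (D.β p • m))).1 (D.l p)
  map_add' m m' := by
    rw [← Finset.sum_add_distrib]
    refine Finset.sum_congr rfl fun p _ => ?_
    rw [smul_add, map_add, map_add, ← smul_add]
    rfl
  map_smul' r m := by
    rw [RingHom.id_apply, Finset.smul_sum]
    have h1 : ∀ p, (g (D.phiSingle (D.l p) (D.β p • r • m))).1 (D.l p) =
        D.F (D.l p) • D.β p • ∑ q, r • D.α q • (g (D.phiSingle (D.l q) (D.β q • m))).1 (D.l q) := by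
      intro p
      rw [← mul_smul, D.phiSingle_smul hM, map_sum]
      have : ∀ (s : Finset D.Λ) (f : D.Λ → D.Phi M') a, (∑ q ∈ s, f q).1 a = ∑ q ∈ s, (f q).1 a := by
        intro s f a
        induction s using Finset.induction_on with
        | empty => rfl
        | insert x s hx ih => rw [Finset.sum_insert hx, Finset.sum_insert hx, ← ih]; rfl
      rw [this, Finset.smul_sum, Finset.smul_sum]
      refine Finset.sum_congr rfl fun q _ => ?_
      rw [map_smul, psi_smul_phi, if_pos rfl]
      simp only [mul_smul]
    simp only [h1]
    rw [D.sum_full M' hM']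

lemma phiMap_phiInv (hM : InBlock R (X := M) e) (hM' : InBlock R (X := M') e)
    (g : D.Phi M →ₗ[B] D.Phi M') : D.phiMap (D.phiInv hM hM' g) = g := by
  refine LinearMap.ext fun v => Subtype.ext (funext fun i => ?_)
  rw [phiMap_apply]
  change ∑ p, D.α p • (g (D.phiSingle (D.l p) (D.β p • v.1 i))).1 (D.l p) = _
  simp only [← psi_smul_eq_single, map_smul, psi_smul_phi, if_true]
  rw [D.sum_full M' hM']

end Functor

section EssSurj

variable (X : Type) [AddCommGroup X] [Module k X] [Module B X] [IsScalarTower k B X]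

/-- The element of `Psi X` corresponding to `r` and `x`. -/
def psiEmb (j : Fin n) (r : R) (x : X) : D.Psi X :=
  ⟨fun p => D.ψ (D.l p) j (D.β p * r) • x, fun p => by
    simp only [← mul_smul]
    rw [← Finset.sum_smul, D.sum_ψ_mul]⟩

lemma smul_psiEmb (j : Fin n) (r r' : R) (x : X) :
    r' • D.psiEmb X j r x = D.psiEmb X j (r' * r) x :=
  Subtype.ext (funext fun p => by
    rw [psi_smul_apply]
    change ∑ q, D.ψ (D.l p) (D.l q) (D.β p * (r' * D.α q)) • D.ψ (D.l q) j (D.β q * r) • x =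
      D.ψ (D.l p) j (D.β p * (r' * r)) • x
    simp only [← mul_smul, ← mul_assoc (D.β p)]
    rw [← Finset.sum_smul, D.sum_ψ_mul])

lemma psiEmb_congr {j : Fin n} {r r' : R} (h : r * D.F j = r' * D.F j) (x : X) :
    D.psiEmb X j r x = D.psiEmb X j r' x :=
  Subtype.ext (funext fun p => by
    change D.ψ (D.l p) j (D.β p * r) • x = D.ψ (D.l p) j (D.β p * r') • x
    rw [D.ψ_congr (r' := D.β p * r')]
    simp only [mul_assoc, h])

/-- The comparison map from `X` to `Phi (Psi X)`. -/
def unitMap : X →ₗ[B] D.Phi (D.Psi X) where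
  toFun x := ⟨fun i => D.psiEmb X i 1 x, fun i => by
    rw [smul_psiEmb]
    exact D.psiEmb_congr X (by rw [mul_one, D.F_idem, one_mul]) x⟩
  map_add' x y := Subtype.ext (funext fun i => Subtype.ext (funext fun p => smul_add _ _ _))
  map_smul' C x := Subtype.ext (funext fun i => Subtype.ext (funext fun p => by
    change D.ψ (D.l p) i (D.β p * 1) • C • x = (∑ j, D.θ i j C • D.psiEmb X j 1 x).1 p
    simp only [smul_psiEmb]
    have : ∀ (s : Finset (Fin n)) (f : Fin n → D.Psi X) a,
        (∑ q ∈ s, f q).1 a = ∑ q ∈ s, (f q).1 a := by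
      intro s f a
      induction s using Finset.induction_on with
      | empty => rfl
      | insert x s hx ih => rw [Finset.sum_insert hx, Finset.sum_insert hx, ← ih]; rfl
    rw [this]
    change D.ψ (D.l p) i (D.β p * 1) • C • x =
      ∑ j, D.ψ (D.l p) j (D.β p * (D.θ i j C * 1)) • x
    simp only [mul_one]
    rw [← mul_smul, D.ψ_mul_right, Finset.sum_smul]))

lemma unitMap_apply (x : X) (i : Fin n) (p : D.Λ) :
    ((D.unitMap X x).1 i).1 p = D.ψ (D.l p) i (D.β p) • x := by
  change D.ψ (D.l p) i (D.β p * 1) • x = _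
  rw [mul_one]

/-- The comparison map from `Phi (Psi X)` to `X`. -/
def counitMap (v : D.Phi (D.Psi X)) : X :=
  ∑ i, ∑ p, D.ψ i (D.l p) (D.α p) • (v.1 i).1 p

lemma counitMap_unitMap (x : X) : D.counitMap X (D.unitMap X x) = x := by
  simp only [counitMap, unitMap_apply, ← mul_smul]
  simp only [← Finset.sum_smul]
  have : ∀ i j, ∑ p, D.ψ i (D.l p) (D.α p) * D.ψ (D.l p) j (D.β p) = D.ψ i j 1 := by
    intro i j
    simpa using D.sum_ψ_mul i j 1 1
  simp only [this, D.sum_one, one_smul]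

lemma unitMap_counitMap (v : D.Phi (D.Psi X)) : D.unitMap X (D.counitMap X v) = v := by
  refine Subtype.ext (funext fun i => Subtype.ext (funext fun p => ?_))
  rw [unitMap_apply, counitMap, Finset.smul_sum, Finset.sum_eq_single i]
  · conv_rhs => rw [← v.2 i, psi_smul_apply]
    rw [Finset.smul_sum]
    refine Finset.sum_congr rfl fun q _ => ?_
    rw [← mul_smul, D.ψ_mul, mul_assoc]
  · intro j _ hj
    rw [Finset.smul_sum]
    refine Finset.sum_eq_zero fun q _ => ?_
    rw [← mul_smul, D.ψ_mul_ψ, if_neg hj.symm, zero_smul]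
  · simp

/-- The comparison isomorphism from `X` to `Phi (Psi X)`. -/
def unitEquiv : X ≃ₗ[B] D.Phi (D.Psi X) :=
  { D.unitMap X with
    invFun := D.counitMap X
    left_inv := D.counitMap_unitMap X
    right_inv := D.unitMap_counitMap X }

end EssSurj

section Equivalence

open CategoryTheory

/-- The functor from the modules in the block of `e` to the modules over `B`. -/
def functor : ObjectProperty.FullSubcategory
    (fun M : PCMod k R => InBlock R (X := M.X) e) ⥤ PCMod k B where
  obj M := { X := D.Phi M.obj.X, pc := D.phi_pc _ M.obj.pc }
  map f := ⟨D.phiMap f.hom.1, Continuous.subtype_mk (continuous_pi fun i =>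
    f.hom.2.comp ((continuous_apply i).comp continuous_subtype_val)) _⟩
  map_id _ := rfl
  map_comp _ _ := rfl

instance : D.functor.Faithful where
  map_injective {M _ f g} h := by
    apply ObjectProperty.hom_ext
    exact Subtype.ext (D.phiMap_injective M.property (congrArg Subtype.val h))

instance : D.functor.Full where
  map_surjective {M M'} g := by
    have := M'.obj.pc.addGroup
    have := M'.obj.pc.contSMul
    have := M.obj.pc.contSMul
    refine ⟨ObjectProperty.homMk ⟨D.phiInv M.property M'.property g.1, ?_⟩, Subtype.ext
      (D.phiMap_phiInv M.property M'.property g.1)⟩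
    refine continuous_finsetSum _ fun p _ => (continuous_const_smul _).comp ?_
    refine (continuous_apply (D.l p)).comp (continuous_subtype_val.comp (g.2.comp ?_))
    refine Continuous.subtype_mk (continuous_pi fun i => ?_) _
    by_cases h : i = D.l p
    · simp only [h, if_true]
      exact (continuous_const_smul _).comp (continuous_const_smul _)
    · simp only [h, if_false]
      exact continuous_const

lemma functor_essSurj [ContinuousMul R] : D.functor.EssSurj where
  mem_essImage X := by
    have := X.pc.addGroup
    have := X.pc.contSMul
    refine ⟨⟨{ X := D.Psi X.X, pc := D.psi_pc _ X.pc }, D.psi_inBlock X.X⟩, ⟨?_⟩⟩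
    refine ⟨⟨(D.unitEquiv X.X).symm.toLinearMap, ?_⟩, ⟨(D.unitEquiv X.X).toLinearMap, ?_⟩,
      Subtype.ext ?_, Subtype.ext ?_⟩
    · change Continuous fun v : D.Phi (D.Psi X.X) =>
        (∑ i, ∑ p, D.ψ i (D.l p) (D.α p) • (v.1 i).1 p : X.X)
      refine continuous_finsetSum _ fun i _ => continuous_finsetSum _ fun p _ => ?_
      have h : Continuous fun v : D.Phi (D.Psi X.X) => (v.1 i).1 p := (continuous_apply p).comp (continuous_subtype_val.comp
        ((continuous_apply i).comp continuous_subtype_val))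
      exact h.const_smul _
    · refine Continuous.subtype_mk (continuous_pi fun i =>
        Continuous.subtype_mk (continuous_pi fun p => ?_) _) _
      exact continuous_const_smul (T := X.X) (D.ψ (D.l p) i (D.β p * 1))
    · exact LinearMap.ext fun v => (D.unitEquiv X.X).apply_symm_apply v
    · exact LinearMap.ext fun v => (D.unitEquiv X.X).symm_apply_apply v

theorem nonempty_equivalence [ContinuousMul R] (D : MorCtx k R B e n) :
    Nonempty (ObjectProperty.FullSubcategory
      (fun M : PCMod k R => InBlock R (X := M.X) e) ≌ PCMod k B) := by
  have := D.functor_essSurj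
  have : D.functor.IsEquivalence := {}
  exact ⟨D.functor.asEquivalence⟩

end Equivalence

end MorCtx

section Levels

variable {k G}

/-- The projection of the completed group algebra onto a finite level. -/
def levC (M : OpenNormalSubgroup G) : CGA k G →ₐ[k] MonoidAlgebra k (G ⧸ M.toSubgroup) :=
  (Pi.evalAlgHom k _ M).comp (CGA k G).val

lemma tHom_levC {N M : OpenNormalSubgroup G} (h : N ≤ M) (x : CGA k G) :
    tHom k G N M h (levC N x) = levC M x := x.2 N M h

lemma levC_ofG (M : OpenNormalSubgroup G) (g : G) :
    levC M (ofG k G g) = MonoidAlgebra.single (g : G ⧸ M.toSubgroup) 1 := rfl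

lemma levC_surjective (M : OpenNormalSubgroup G) : Function.Surjective (levC (k := k) M) := by
  intro x
  induction x using MonoidAlgebra.induction_on with
  | of g =>
    obtain ⟨g, rfl⟩ := QuotientGroup.mk_surjective g
    exact ⟨ofG k G g, rfl⟩
  | add a b ha hb =>
    obtain ⟨x, rfl⟩ := ha
    obtain ⟨y, rfl⟩ := hb
    exact ⟨x + y, (levC M).map_add x y⟩
  | smul r a ha =>
    obtain ⟨x, rfl⟩ := ha
    exact ⟨r • x, (levC M).toLinearMap.map_smul r x⟩

lemma finite_quotient [IsTopologicalGroup G] [CompactSpace G] (M : OpenNormalSubgroup G) :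
    Finite (G ⧸ M.toSubgroup) :=
  Subgroup.quotient_finite_of_isOpen _ M.isOpen'

lemma isLevSys_levC [IsTopologicalGroup G] [CompactSpace G] :
    IsLevSys (fun M : OpenNormalSubgroup G => levC (k := k) M) where
  fin M := by
    have := finite_quotient M
    infer_instance
  surj := levC_surjective
  ext x y h := Subtype.ext (funext h)
  mono N M h x hx := by rw [← tHom_levC h, hx, map_zero]
  dir N M := ⟨N ⊓ M, inf_le_left, inf_le_right⟩
  nonempty := ⟨{ (⊤ : Subgroup G) with
    isOpen' := isOpen_univ
    isNormal' := inferInstance }⟩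
  complete x hx := by
    refine ⟨⟨x, fun N M h => ?_⟩, fun j => rfl⟩
    obtain ⟨r, hr⟩ := levC_surjective N (x N)
    rw [← hx N M h r hr, ← hr, tHom_levC]

instance (X : Type) : DiscreteTopology (MonoidAlgebra k X) := ⟨rfl⟩

lemma continuous_levC (M : OpenNormalSubgroup G) : Continuous (levC (k := k) M) :=
  (continuous_apply M).comp continuous_subtype_val

lemma continuous_cga {T : Type*} [TopologicalSpace T] {f : T → CGA k G}
    (h : ∀ M, Continuous fun t => levC M (f t)) : Continuous f :=
  Continuous.subtype_mk (continuous_pi h) _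

instance : ContinuousMul (CGA k G) where
  continuous_mul := continuous_cga fun M => by
    simp only [map_mul]
    have h : Continuous fun x : MonoidAlgebra k (G ⧸ M.toSubgroup) ×
        MonoidAlgebra k (G ⧸ M.toSubgroup) => x.1 * x.2 := continuous_of_discreteTopology
    have h' : Continuous fun x : CGA k G × CGA k G => (levC M x.1, levC M x.2) :=
      ((continuous_levC M).comp continuous_fst).prodMk ((continuous_levC M).comp continuous_snd)
    have h2 := h.comp h'
    exact h2

lemma isLocallyConstant_coeff (n : ℕ) (i j : Fin n) (m : ℕ) :
    IsLocallyConstant fun C : cycleAlgebra k n => PowerSeries.coeff m (C.1 i j) := by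
  intro s
  let _ : TopologicalSpace k := ⊥
  have : DiscreteTopology k := ⟨rfl⟩
  have h' : Continuous fun (C : cycleAlgebra k n) (t : Fin n × Fin n × ℕ) =>
      PowerSeries.coeff t.2.2 (C.1 t.1 t.2.1) := continuous_induced_dom
  have h : Continuous fun C : cycleAlgebra k n => PowerSeries.coeff m (C.1 i j) :=
    (continuous_apply (i, j, m)).comp h'
  exact (isOpen_discrete s).preimage h

lemma continuous_cycleAlgebra {n : ℕ} {T : Type*} [TopologicalSpace T] {f : T → cycleAlgebra k n}
    (h : ∀ i j m, IsLocallyConstant fun t => PowerSeries.coeff m ((f t).1 i j)) :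
    Continuous f := by
  let _ : TopologicalSpace k := ⊥
  refine continuous_induced_rng.2 ?_
  exact (continuous_pi fun t => (h t.1 t.2.1 t.2.2).continuous)

theorem ThetaData.nonempty_morCtx {e : CGA k G} {n : ℕ} {F : Fin n → CGA k G}
    {θ : Fin n → Fin n → cycleAlgebra k n →ₗ[k] CGA k G}
    {ψ : Fin n → Fin n → CGA k G →ₗ[k] cycleAlgebra k n}
    (h : ThetaData (fun M : OpenNormalSubgroup G => levC (k := k) M) e n F θ ψ)
    (he : e ∈ Set.center (CGA k G)) :
    Nonempty (MorCtx k (CGA k G) (cycleAlgebra k n) e n) := by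
  obtain ⟨Λ, fin, α, β, l, hfull⟩ := h.full
  refine ⟨⟨F, θ, ψ, Λ, fin, α, β, l, h.one, h.mul, h.left, h.right, h.inj, h.θψ, fun i j => ?_,
    fun i j => ?_, h.mul_e, hfull, fun x => ((Set.mem_center_iff.1 he).comm x)⟩⟩
  · refine continuous_cga fun M => IsLocallyConstant.continuous ?_
    obtain ⟨N, hN⟩ := h.contθ M i j
    rw [IsLocallyConstant.iff_eventually_eq]
    intro C
    have : ∀ᶠ C' in nhds C, ∀ m ∈ Finset.range N,
        PowerSeries.coeff m (C'.1 i j) = PowerSeries.coeff m (C.1 i j) :=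
      (Filter.eventually_all_finset _).2 fun m _ => (isLocallyConstant_coeff n i j m).eventually_eq C
    filter_upwards [this] with C' hC'
    rw [← sub_eq_zero, ← map_sub, ← map_sub]
    refine hN _ fun m hm => ?_
    change PowerSeries.coeff m (C'.1 i j - C.1 i j) = 0
    rw [map_sub, hC' m (Finset.mem_range.2 hm), sub_self]
  · refine continuous_cycleAlgebra fun a b m => ?_
    obtain ⟨v, hv⟩ := h.contψ i j m
    rw [IsLocallyConstant.iff_eventually_eq]
    intro r
    have : ∀ᶠ r' in nhds r, levC v r' = levC v r :=
      (IsLocallyConstant.iff_continuous _).2 (continuous_levC v) |>.eventually_eq r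
    filter_upwards [this] with r' hr'
    have h0 := hv (r' - r) (by rw [map_sub, hr', sub_self]) a b
    rw [map_sub] at h0
    change PowerSeries.coeff m ((ψ i j r').1 a b - (ψ i j r).1 a b) = 0 at h0
    rwa [map_sub, sub_eq_zero] at h0

end Levels

section ZpFacts

variable {G}

/-- A topological generator of a subgroup isomorphic to `ℤ_p`. -/
structure IsZpGen (p : ℕ) (D : Subgroup G) (h : G) : Prop where
  mem : h ∈ D
  pow_mem : ∀ M : OpenNormalSubgroup G, ∃ a, h ^ p ^ a ∈ M
  pow_ne : ∀ a, h ^ p ^ a ≠ 1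
  dense : ∀ M : OpenNormalSubgroup G, ∀ d ∈ D, ∃ n : ℕ, ∃ m ∈ M, d = h ^ n * m

lemma IsZpGroup.exists_gen {p : ℕ} [Fact p.Prime] {D : Subgroup G} (hD : IsZpGroup G p D) :
    ∃ h, IsZpGen p D h := by
  obtain ⟨φ, hφ⟩ := hD
  let f : D ≃* Multiplicative ℤ_[p] := { φ with map_mul' := hφ }
  let g : ℤ_[p] → G := fun z => f.symm (Multiplicative.ofAdd z)
  have hg : Continuous g := continuous_subtype_val.comp (φ.symm.continuous.comp continuous_ofAdd)
  have hg0 : g 0 = 1 := by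
    change ((f.symm 1 : D) : G) = 1
    rw [map_one]; rfl
  have hgadd : ∀ x y, g (x + y) = g x * g y := by
    intro x y
    change ((f.symm (Multiplicative.ofAdd x * Multiplicative.ofAdd y) : D) : G) = _
    rw [map_mul]; rfl
  have hgn : ∀ m : ℕ, g m = g 1 ^ m := by
    intro m
    induction m with
    | zero => rw [Nat.cast_zero, hg0, pow_zero]
    | succ m ih => rw [Nat.cast_succ, hgadd, ih, pow_succ]
  have hinj : Function.Injective g :=
    Subtype.val_injective.comp (f.symm.injective.comp Multiplicative.ofAdd.injective)
  have hnhds : ∀ M : OpenNormalSubgroup G, ∃ a : ℕ, ∀ z ∈ Ideal.span {(p : ℤ_[p]) ^ a},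
      g z ∈ M := by
    intro M
    have hM : IsOpen (g ⁻¹' (M : Set G)) := M.isOpen'.preimage hg
    obtain ⟨ε, hε, hb⟩ := Metric.isOpen_iff.1 hM 0 (by
      rw [Set.mem_preimage, hg0]; exact one_mem M)
    obtain ⟨a, ha⟩ := PadicInt.exists_pow_neg_lt p hε
    refine ⟨a, fun z hz => hb ?_⟩
    rw [Metric.mem_ball, dist_zero_right]
    exact ((PadicInt.norm_le_pow_iff_mem_span_pow z a).2 hz).trans_lt ha
  refine ⟨g 1, (f.symm _).2, fun M => ?_, fun a ha => ?_, fun M d hd => ?_⟩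
  · obtain ⟨a, ha⟩ := hnhds M
    refine ⟨a, ?_⟩
    rw [← hgn]
    exact ha _ (Ideal.subset_span (by push_cast; rfl))
  · rw [← hgn, ← hg0] at ha
    have h1 := hinj ha
    rw [Nat.cast_eq_zero] at h1
    exact pow_ne_zero a (Fact.out : p.Prime).ne_zero h1
  · obtain ⟨a, ha⟩ := hnhds M
    let z : ℤ_[p] := Multiplicative.toAdd (f ⟨d, hd⟩)
    have hz : g z = d := by
      change ((f.symm (f ⟨d, hd⟩) : D) : G) = d
      rw [f.symm_apply_apply]
    refine ⟨z.appr a, g (z - z.appr a), ha _ (PadicInt.appr_spec a z), ?_⟩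
    rw [← hgn, ← hgadd, add_sub_cancel, hz]

end ZpFacts

section Regular

variable {k G}

lemma sum_eq_zero_of_free {H X : Type*} [Group H] [Fintype H] [Fintype X] [MulAction H X]
    (hfree : ∀ (h : H) (x : X), h • x = x → h = 1) (hcard : (Fintype.card H : k) = 0)
    (f : X → k) (hf : ∀ (h : H) x, f (h • x) = f x) : ∑ x, f x = 0 := by
  rw [← (MulAction.selfEquivSigmaOrbits H X).symm.sum_comp, Fintype.sum_sigma]
  refine Finset.sum_eq_zero fun ω _ => ?_
  have h1 : ∀ x : MulAction.orbit H (Quotient.out ω),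
      f ((MulAction.selfEquivSigmaOrbits H X).symm ⟨ω, x⟩) = f (Quotient.out ω) := by
    rintro ⟨_, h, rfl⟩
    exact hf h _
  simp only [h1, Finset.sum_const, Finset.card_univ, nsmul_eq_mul]
  have h2 := MulAction.card_orbit_mul_card_stabilizer_eq_card_group H (Quotient.out ω)
  have h3 : Fintype.card (MulAction.stabilizer H (Quotient.out ω)) = 1 := by
    rw [Fintype.card_eq_one_iff]
    exact ⟨1, fun y => Subtype.ext (hfree _ _ y.2)⟩
  rw [h3, mul_one] at h2
  rw [h2, hcard, zero_mul]

lemma coeff_tHom {N M : OpenNormalSubgroup G} (h : N ≤ M) [Fintype (G ⧸ N.toSubgroup)]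
    (x : MonoidAlgebra k (G ⧸ N.toSubgroup)) (c : G ⧸ M.toSubgroup) :
    (tHom k G N M h x).coeff c = ∑ g, if qHom G N M h g = c then x.coeff g else 0 := by
  induction x using MonoidAlgebra.induction_linear with
  | zero => simp
  | add x y hx hy =>
    rw [map_add, MonoidAlgebra.coeff_add, Finsupp.add_apply, hx, hy, ← Finset.sum_add_distrib]
    refine Finset.sum_congr rfl fun g _ => ?_
    split_ifs
    · rfl
    · rw [add_zero]
  | single g r =>
    rw [tHom, MonoidAlgebra.mapDomainAlgHom_apply, MonoidAlgebra.mapDomain_single,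
      MonoidAlgebra.coeff_single, Finsupp.single_apply]
    rw [Finset.sum_eq_single g]
    · rw [MonoidAlgebra.coeff_single, Finsupp.single_eq_same]
    · intro b _ hb
      rw [MonoidAlgebra.coeff_single, Finsupp.single_eq_of_ne hb, ite_self]
    · simp

lemma exists_openNormal_notMem [IsTopologicalGroup G]
    [CompactSpace G] [TotallyDisconnectedSpace G] [T2Space G] {t : G} (ht : t ≠ 1) :
    ∃ N : OpenNormalSubgroup G, t ∉ N := by
  obtain ⟨N, hN⟩ := ProfiniteGrp.exist_openNormalSubgroup_sub_open_nhds_of_one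
    (isOpen_compl_singleton (x := t)) (Set.mem_compl_singleton_iff.2 ht.symm)
  exact ⟨N, fun h => hN h rfl⟩

lemma IsZpGen.eq_zero_of_mul_eq {p : ℕ} [Fact p.Prime] [CharP k p] [IsTopologicalGroup G]
    [CompactSpace G] [TotallyDisconnectedSpace G] [T2Space G] {D : Subgroup G} {h : G}
    (hh : IsZpGen p D h) {r : CGA k G} (hr : ofG k G h * r = r) : r = 0 := by
  refine (isLevSys_levC (k := k) (G := G)).ext _ _ fun M => ?_
  rw [map_zero]
  obtain ⟨a, ha⟩ := hh.pow_mem M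
  set t := h ^ p ^ a with ht
  have htr : ofG k G t * r = r := by
    rw [ht, map_pow]
    generalize p ^ a = m
    induction m with
    | zero => rw [pow_zero, one_mul]
    | succ m ih => rw [pow_succ, mul_assoc, hr, ih]
  obtain ⟨N₀, hN₀⟩ := exists_openNormal_notMem (hh.pow_ne a)
  let N : OpenNormalSubgroup G := M ⊓ N₀
  have hNM : N ≤ M := inf_le_left
  have := finite_quotient N
  have := Fintype.ofFinite (G ⧸ N.toSubgroup)
  let t' : G ⧸ N.toSubgroup := (t : G ⧸ N.toSubgroup)
  have ht1 : t' ≠ 1 := fun h1 => hN₀ ((QuotientGroup.eq_one_iff t).1 h1).2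
  obtain ⟨b, hb⟩ := hh.pow_mem N
  have htp : t' ^ p ^ b = 1 := by
    rw [← QuotientGroup.mk_pow, QuotientGroup.eq_one_iff, ht, ← pow_mul, mul_comm, pow_mul]
    exact N.toSubgroup.pow_mem hb _
  have hord : p ∣ orderOf t' := by
    obtain ⟨i, -, hi⟩ := (Nat.dvd_prime_pow Fact.out).1 (orderOf_dvd_of_pow_eq_one htp)
    rw [hi]
    refine dvd_pow_self p fun h0 => ht1 ?_
    rw [h0, pow_zero] at hi
    exact orderOf_eq_one_iff.1 hi
  rw [← tHom_levC hNM]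
  ext c
  rw [coeff_tHom hNM]
  refine sum_eq_zero_of_free (H := Subgroup.zpowers t') (fun x y hxy => ?_) ?_ _ ?_
  · exact Subtype.ext (mul_eq_right.1 hxy)
  · rw [Fintype.card_zpowers]
    exact (CharP.cast_eq_zero_iff k p _).2 hord
  · have h1 : ∀ x, (levC N r).coeff (t' * x) = (levC N r).coeff x := by
      intro x
      have := congrArg (fun s => (levC N s).coeff (t' * x)) htr
      simp only [map_mul, levC_ofG] at this
      rw [MonoidAlgebra.coeff_single_mul_apply, one_mul, inv_mul_cancel_left] at this
      exact this.symm
    have h2 : ∀ x, qHom G N M hNM (t' * x) = qHom G N M hNM x := by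
      intro x
      have : qHom G N M hNM t' = 1 := (QuotientGroup.eq_one_iff t).2 ha
      rw [map_mul, this, one_mul]
    let St : Subgroup (G ⧸ N.toSubgroup) :=
      { carrier := {g | ∀ y, (if qHom G N M hNM (g * y) = c then (levC N r).coeff (g * y) else 0) =
          if qHom G N M hNM y = c then (levC N r).coeff y else 0}
        one_mem' := fun y => by rw [one_mul]
        mul_mem' := fun {u v} hu hv y => by rw [mul_assoc, hu, hv]
        inv_mem' := fun {u} hu y => by rw [← hu, mul_inv_cancel_left] }
    have hle : Subgroup.zpowers t' ≤ St :=
      Subgroup.zpowers_le.2 fun y => by rw [h1, h2]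
    rintro ⟨x, hx⟩ y
    exact hle hx y

end Regular

section PowerSeriesAction

variable {k G}

lemma exists_eq_unit_mul_X_pow {f : PowerSeries k} (hf : f ≠ 0) :
    ∃ (m : ℕ) (u : (PowerSeries k)ˣ), f = (u : PowerSeries k) * PowerSeries.X ^ m := by
  refine ⟨f.order.toNat, PowerSeries.Unit_of_divided_by_X_pow_order f, ?_⟩
  rw [PowerSeries.Unit_of_divided_by_X_pow_order_nonzero hf, mul_comm]
  exact PowerSeries.X_pow_order_mul_divXPowOrder.symm

lemma ofG_sub_one_pow {p : ℕ} [Fact p.Prime] [CharP k p] (h : G) (a : ℕ) :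
    (ofG k G h - 1) ^ p ^ a = ofG k G (h ^ p ^ a) - 1 := by
  have h1 : (Polynomial.X - 1 : Polynomial k) ^ p ^ a = Polynomial.X ^ p ^ a - 1 := by
    rw [sub_pow_char_pow, one_pow]
  have h2 := congrArg (Polynomial.aeval (ofG k G h)) h1
  simpa only [map_pow, map_sub, Polynomial.aeval_X, map_one] using h2

lemma isNilpotent_levC {p : ℕ} [Fact p.Prime] [CharP k p] {h : G}
    (hh : ∀ M : OpenNormalSubgroup G, ∃ a, h ^ p ^ a ∈ M) (M : OpenNormalSubgroup G) :
    IsNilpotent (levC (k := k) M (ofG k G h - 1)) := by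
  obtain ⟨a, ha⟩ := hh M
  refine ⟨p ^ a, ?_⟩
  rw [← map_pow, ofG_sub_one_pow, map_sub, map_one, levC_ofG,
    (QuotientGroup.eq_one_iff (N := M.toSubgroup) _).2 ha, ← MonoidAlgebra.one_def, sub_self]

variable [IsTopologicalGroup G] [CompactSpace G]

/-- The action of power series in `h - 1` on the completed group algebra. -/
def rhoG (k : Type) [Field k] {p : ℕ} [Fact p.Prime] [CharP k p] {h : G}
    (hh : ∀ M : OpenNormalSubgroup G, ∃ a, h ^ p ^ a ∈ M) : PowerSeries k →ₐ[k] CGA k G :=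
  rho isLevSys_levC (ofG k G h - 1) (isNilpotent_levC hh)

variable {p : ℕ} [Fact p.Prime] [CharP k p] {h : G}

lemma rhoG_X (hh : ∀ M : OpenNormalSubgroup G, ∃ a, h ^ p ^ a ∈ M) :
    rhoG k hh PowerSeries.X = ofG k G h - 1 := rho_X _ _ _

lemma rhoG_one_add_X_pow (hh : ∀ M : OpenNormalSubgroup G, ∃ a, h ^ p ^ a ∈ M) (m : ℕ) :
    rhoG k hh ((1 + PowerSeries.X) ^ m) = ofG k G (h ^ m) := by
  rw [map_pow, map_add, map_one, rhoG_X, add_sub_cancel, map_pow]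

lemma exists_levC_rhoG_eq (hh : ∀ M : OpenNormalSubgroup G, ∃ a, h ^ p ^ a ∈ M)
    (f : PowerSeries k) (M : OpenNormalSubgroup G) :
    ∃ P : Polynomial k, levC M (rhoG k hh f) = levC M (Polynomial.aeval (ofG k G h - 1) P) :=
  exists_lev_rho_eq (lev := fun M : OpenNormalSubgroup G => levC (k := k) M) _ _ _ f M

lemma exists_rhoG_sum_eq (hh : ∀ M : OpenNormalSubgroup G, ∃ a, h ^ p ^ a ∈ M)
    {ι : Type} [Fintype ι] (b : ι → CGA k G) (r : CGA k G)
    (H : ∀ M : OpenNormalSubgroup G, ∃ f : ι → PowerSeries k,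
      levC M (∑ i, rhoG k hh (f i) * b i) = levC M r) :
    ∃ f : ι → PowerSeries k, r = ∑ i, rhoG k hh (f i) * b i :=
  exists_rhoSum_eq (lev := fun M : OpenNormalSubgroup G => levC (k := k) M) _ _ _ b r H

variable [TotallyDisconnectedSpace G] [T2Space G]

lemma IsZpGen.eq_zero_of_rhoG_mul {D : Subgroup G} (hh : IsZpGen p D h) {f : PowerSeries k}
    (hf : f ≠ 0) {r : CGA k G} (hr : rhoG k hh.pow_mem f * r = 0) : r = 0 := by
  have hX : ∀ (m : ℕ) (r : CGA k G), (ofG k G h - 1) ^ m * r = 0 → r = 0 := by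
    intro m
    induction m with
    | zero => intro r h0; rwa [pow_zero, one_mul] at h0
    | succ m ih =>
      intro r h0
      rw [pow_succ, mul_assoc] at h0
      have h1 := ih _ h0
      rw [sub_mul, one_mul, sub_eq_zero] at h1
      exact hh.eq_zero_of_mul_eq h1
  obtain ⟨m, u, rfl⟩ := exists_eq_unit_mul_X_pow hf
  refine hX m r ?_
  rw [map_mul, map_pow, rhoG_X] at hr
  have h2 : rhoG k hh.pow_mem ↑u⁻¹ * rhoG k hh.pow_mem ↑u = 1 := by
    rw [← map_mul, Units.inv_mul, map_one]
  have h3 := congrArg (rhoG k hh.pow_mem ↑u⁻¹ * ·) hr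
  simp only [← mul_assoc, h2, one_mul, mul_zero] at h3
  exact h3

end PowerSeriesAction

section TraceForm

variable {k G}

lemma coeff_mul_one_comm {Q : Type*} [Group Q] (x y : MonoidAlgebra k Q) :
    (x * y).coeff 1 = (y * x).coeff 1 := by
  induction x using MonoidAlgebra.induction_linear with
  | zero => rw [zero_mul, mul_zero]
  | add a b ha hb =>
    rw [add_mul, mul_add, MonoidAlgebra.coeff_add, MonoidAlgebra.coeff_add, Finsupp.add_apply,
      Finsupp.add_apply, ha, hb]
  | single g r =>
    rw [MonoidAlgebra.coeff_single_mul_apply, MonoidAlgebra.coeff_mul_single_apply, mul_one,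
      one_mul, mul_comm]

lemma exists_mul_mul_ne_zero [IsTopologicalGroup G] [CompactSpace G] (f a : CGA k G)
    (haf : a * f = a) (ha : a ≠ 0) : ∃ g, f * g * a ≠ 0 := by
  by_contra! H
  refine ha ((isLevSys_levC (k := k) (G := G)).ext _ _ fun M => ?_)
  rw [map_zero]
  ext q
  rw [MonoidAlgebra.coeff_zero, Finsupp.zero_apply]
  obtain ⟨g, hg⟩ := levC_surjective M (MonoidAlgebra.single q⁻¹ (1 : k))
  have h1 : (levC M (g * a)).coeff 1 = (levC M a).coeff q := by
    rw [map_mul, hg, MonoidAlgebra.coeff_single_mul_apply, one_mul, inv_inv, mul_one]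
  rw [← h1, ← haf, ← mul_assoc, map_mul, coeff_mul_one_comm, ← map_mul, ← mul_assoc, H, map_zero,
    MonoidAlgebra.coeff_zero, Finsupp.zero_apply]

end TraceForm

section Span

variable {k G}

/-- Up to any finite level, every element is a linear combination of group elements. -/
lemma exists_levC_eq_of_closed (P : CGA k G → Prop) (hadd : ∀ x y, P x → P y → P (x + y))
    (hsmul : ∀ (c : k) x, P x → P (c • x)) (hof : ∀ g, P (ofG k G g)) (M : OpenNormalSubgroup G)
    (r : CGA k G) : ∃ x, P x ∧ levC M x = levC M r := by
  generalize levC M r = s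
  induction s using MonoidAlgebra.induction_on with
  | of g =>
    obtain ⟨g, rfl⟩ := QuotientGroup.mk_surjective g
    exact ⟨ofG k G g, hof g, rfl⟩
  | add a b ha hb =>
    obtain ⟨x, hx, rfl⟩ := ha
    obtain ⟨y, hy, rfl⟩ := hb
    exact ⟨x + y, hadd x y hx hy, (levC M).map_add x y⟩
  | smul r a ha =>
    obtain ⟨x, hx, rfl⟩ := ha
    exact ⟨r • x, hsmul r x hx, (levC M).toLinearMap.map_smul r x⟩

end Span

section DiscreteSimples

variable {k G}

lemma isSimpleModule_compHom {R A V : Type*} [Ring R] [Ring A] [AddCommGroup V] [Module A V]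
    (hV : IsSimpleModule A V) (f : R →+* A) (hf : Function.Surjective f) :
    @IsSimpleModule R _ V _ (Module.compHom V f) := by
  let _ : Module R V := Module.compHom V f
  have : RingHomSurjective f := ⟨hf⟩
  let l : V →ₛₗ[f] V :=
    { toFun := id
      map_add' := fun _ _ => rfl
      map_smul' := fun _ _ => rfl }
  exact (LinearMap.isSimpleModule_iff_of_bijective l Function.bijective_id).2 hV

/-- `N` acts trivially on the simple modules of the block which factor through a finite level. -/
def TrivOnDiscreteSimples (e : CGA k G) (N : OpenNormalSubgroup G) : Prop :=
  ∀ (T : Type) [AddCommGroup T] [Module (CGA k G) T], IsSimpleModule (CGA k G) T →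
    InBlock (CGA k G) (X := T) e →
    (∃ M : OpenNormalSubgroup G, ∀ r : CGA k G, levC M r = 0 → ∀ t : T, r • t = 0) → NTrivial k G N T

lemma exists_trivOnDiscreteSimples {e : CGA k G} {n : ℕ} {S : Fin n → Type}
    [∀ i, AddCommGroup (S i)] [∀ i, Module (CGA k G) (S i)] (hS : IsSimpleReps k G e S) :
    ∃ N, TrivOnDiscreteSimples e N := by
  have top : OpenNormalSubgroup G := { (⊤ : Subgroup G) with
    isOpen' := isOpen_univ
    isNormal' := inferInstance }
  have : Nonempty (OpenNormalSubgroup G) := ⟨top⟩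
  have hM : ∀ i, ∃ M : OpenNormalSubgroup G,
      (∃ M : OpenNormalSubgroup G, ∀ r : CGA k G, levC M r = 0 → ∀ t : S i, r • t = 0) →
      ∀ r : CGA k G, levC M r = 0 → ∀ t : S i, r • t = 0 := by
    intro i
    by_cases h : ∃ M : OpenNormalSubgroup G, ∀ r : CGA k G, levC M r = 0 → ∀ t : S i, r • t = 0
    · exact ⟨h.choose, fun _ => h.choose_spec⟩
    · exact ⟨top, fun h' => absurd h' h⟩
  choose M hM using hM
  obtain ⟨N, hN⟩ := Finite.exists_ge M
  refine ⟨N, fun T _ _ hT hTe ⟨M', hM'⟩ g hg t => ?_⟩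
  obtain ⟨i, ⟨φ⟩⟩ := hS.2.2 T hT hTe
  have h1 := hM i ⟨M', fun r hr s => by
    obtain ⟨t, rfl⟩ := φ.surjective s
    rw [← map_smul, hM' r hr, map_zero]⟩ (ofG k G g - 1) (by
      rw [map_sub, map_one, levC_ofG, (QuotientGroup.eq_one_iff (N := (M i).toSubgroup) _).2
        (hN i hg), ← MonoidAlgebra.one_def, sub_self]) (φ t)
  rw [sub_smul, one_smul, sub_eq_zero, ← map_smul] at h1
  exact φ.injective h1

lemma smul_eq_zero_or_inBlock {R V : Type} [Ring R] {e : R} (he : IsBlockIdem R e)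
    [AddCommGroup V] [Module R V] (hV : IsSimpleModule R V) :
    (∀ v : V, e • v = 0) ∨ InBlock R (X := V) e := by
  have hc : ∀ x, e * x = x * e := (Set.mem_center_iff.1 he.central).comm
  let W : Submodule R V :=
    { carrier := {v | e • v = v}
      add_mem' := fun {v w} hv hw => by
        rw [Set.mem_ofPred_eq, smul_add, hv, hw]
      zero_mem' := smul_zero _
      smul_mem' := fun c v hv => by
        rw [Set.mem_ofPred_eq, ← mul_smul, hc, mul_smul, hv] }
  rcases eq_bot_or_eq_top W with hW | hW
  · refine Or.inl fun v => ?_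
    have hmem : e • v ∈ W := by
      change e • e • v = e • v
      rw [← mul_smul, he.idem.eq]
    rwa [hW, Submodule.mem_bot] at hmem
  · refine Or.inr fun v => ?_
    have : v ∈ W := hW ▸ Submodule.mem_top
    exact this

variable [IsTopologicalGroup G] [CompactSpace G]

/-- An element of the completed group algebra which kills the discrete simple modules of the
block is nilpotent on the block at each level. -/
lemma isNilpotent_levC_mul {e : CGA k G} (he : IsBlockIdem (CGA k G) e) (M : OpenNormalSubgroup G)
    {r : CGA k G} (H : ∀ (T : Type) [AddCommGroup T] [Module (CGA k G) T],
      IsSimpleModule (CGA k G) T → InBlock (CGA k G) (X := T) e →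
      (∀ r : CGA k G, levC M r = 0 → ∀ t : T, r • t = 0) → ∀ t : T, r • t = 0) :
    IsNilpotent (levC M (r * e)) := by
  have := (isLevSys_levC (k := k) (G := G)).fin M
  have : IsArtinianRing (MonoidAlgebra k (G ⧸ M.toSubgroup)) := isArtinian_of_tower k inferInstance
  have hJ : levC M (r * e) ∈ Ring.jacobson (MonoidAlgebra k (G ⧸ M.toSubgroup)) := by
    rw [Ring.jacobson, Module.jacobson, Submodule.mem_sInf]
    intro m hm
    let V := MonoidAlgebra k (G ⧸ M.toSubgroup) ⧸ m
    have hV : IsSimpleModule (MonoidAlgebra k (G ⧸ M.toSubgroup)) V :=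
      isSimpleModule_iff_isCoatom.2 hm
    let _ : Module (CGA k G) V := Module.compHom V (levC (k := k) M).toRingHom
    have hV' : IsSimpleModule (CGA k G) V :=
      isSimpleModule_compHom hV (levC (k := k) M).toRingHom (levC_surjective M)
    let one : V := Submodule.Quotient.mk 1
    have hone : ∀ r : CGA k G, r • one = Submodule.Quotient.mk (levC M r) := fun r => by
      change Submodule.Quotient.mk (levC M r * 1) = _
      rw [mul_one]
    rw [← Submodule.Quotient.mk_eq_zero, ← hone, mul_smul]
    rcases smul_eq_zero_or_inBlock he hV' with h0 | hB
    · rw [h0, smul_zero]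
    · refine H V hV' hB (fun r hr t => ?_) _
      change levC M r • t = 0
      rw [hr, zero_smul]
  obtain ⟨s, hs⟩ := IsSemiprimaryRing.isNilpotent (R := MonoidAlgebra k (G ⧸ M.toSubgroup))
  refine ⟨s, ?_⟩
  have := Ideal.pow_mem_pow hJ s
  rw [hs] at this
  exact this

lemma TrivOnDiscreteSimples.exists_pow {p : ℕ} [Fact p.Prime] [CharP k p] {e : CGA k G}
    (he : IsBlockIdem (CGA k G) e) {N : OpenNormalSubgroup G} (hN : TrivOnDiscreteSimples e N)
    (M : OpenNormalSubgroup G) {g : G} (hg : g ∈ N) :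
    ∃ a, levC M (ofG k G (g ^ p ^ a) * e) = levC M e := by
  have hc : ∀ x, e * x = x * e := (Set.mem_center_iff.1 he.central).comm
  obtain ⟨s, hu⟩ := isNilpotent_levC_mul he M (r := ofG k G g - 1) fun T _ _ hT hTe hM t => by
    rw [sub_smul, one_smul, sub_eq_zero]
    exact hN T hT hTe ⟨M, hM⟩ g hg t
  refine ⟨s, ?_⟩
  have h2 : levC M ((ofG k G g - 1) * e) ^ p ^ s = 0 :=
    pow_eq_zero_of_le (Nat.lt_pow_self (Fact.out : p.Prime).one_lt).le hu
  rw [← map_pow, (show Commute (ofG k G g - 1) e from (hc _).symm).mul_pow, ofG_sub_one_pow,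
    he.idem.pow_eq (pow_pos (Fact.out : p.Prime).pos s).ne', sub_mul, one_mul, map_sub,
    sub_eq_zero] at h2
  exact h2

lemma exists_discreteSimple {e : CGA k G} (he : IsBlockIdem (CGA k G) e) :
    ∃ (T : Type) (_ : AddCommGroup T) (_ : Module (CGA k G) T), IsSimpleModule (CGA k G) T ∧
      InBlock (CGA k G) (X := T) e ∧
      ∃ M : OpenNormalSubgroup G, ∀ r : CGA k G, levC M r = 0 → ∀ t : T, r • t = 0 := by
  by_contra! H
  refine he.ne_zero ((isLevSys_levC (k := k) (G := G)).ext _ _ fun M => ?_)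
  obtain ⟨s, hs⟩ := isNilpotent_levC_mul he M (r := 1) fun T i₁ i₂ hT hTe hM t => by
    obtain ⟨r, hr, t, h⟩ := H T i₁ i₂ hT hTe M
    exact absurd (hM r hr t) h
  rw [one_mul, ← map_pow] at hs
  have h2 : levC M (e ^ (s + 1)) = 0 := by rw [pow_succ, map_mul, hs, zero_mul]
  rw [he.idem.pow_eq s.succ_ne_zero] at h2
  rw [h2, map_zero]

lemma sum_out_eq_relIndex_smul {X : Type*} [AddCommMonoid X] {H' H : Subgroup G} (hle : H' ≤ H)
    [Fintype (G ⧸ H')] [Fintype (G ⧸ H)] (F : G → X) (hF : ∀ g, ∀ w ∈ H, F (g * w) = F g) :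
    ∑ c : G ⧸ H', F c.out = H'.relIndex H • ∑ c : G ⧸ H, F c.out := by
  let E := Subgroup.quotientEquivProdOfLE hle
  have hfin : Finite (H ⧸ H'.subgroupOf H) :=
    Finite.of_injective (fun d => E.symm ((1 : G), d))
      fun d d' h => (Prod.ext_iff.1 (E.symm.injective h)).2
  have := Fintype.ofFinite (H ⧸ H'.subgroupOf H)
  have h1 : ∀ c : G ⧸ H', F c.out = F (E c).1.out := by
    intro c
    have h2 : (E c).1 = (c.out : G ⧸ H) := by
      conv_lhs => rw [← QuotientGroup.out_eq' c]
      rfl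
    rw [h2]
    obtain ⟨w, hw⟩ := QuotientGroup.mk_out_eq_mul H c.out
    rw [hw, hF _ _ w.2]
  simp only [h1]
  rw [E.sum_comp (fun x => F x.1.out), Fintype.sum_prod_type, Finset.smul_sum]
  refine Finset.sum_congr rfl fun b _ => ?_
  change ∑ _y : H ⧸ H'.subgroupOf H, F b.out = _
  rw [Finset.sum_const, Finset.card_univ, Subgroup.relIndex, Subgroup.index, Nat.card_eq_fintype_card]

lemma finite_quotient_sup (D : Subgroup G) (M : OpenNormalSubgroup G) :
    Finite (G ⧸ (D ⊔ M.toSubgroup)) :=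
  Subgroup.quotient_finite_of_isOpen _ (Subgroup.isOpen_mono le_sup_right M.isOpen')

lemma conj_smul_mul_eq {R T : Type*} [Ring R] [AddCommGroup T] [Module R T] (f : G →* R) {a : R}
    {D N : Subgroup G} (hD : ∀ d ∈ D, f d * a * f d⁻¹ = a) (hN : ∀ n ∈ N, ∀ t : T, f n • t = t)
    {g w : G} (hw : w ∈ D ⊔ N) (t : T) :
    (f (g * w) * a * f (g * w)⁻¹) • t = (f g * a * f g⁻¹) • t := by
  let St : Subgroup G :=
    { carrier := {w | ∀ t : T, f w • a • f w⁻¹ • t = a • t}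
      one_mem' := fun t => by rw [inv_one, map_one, one_smul, one_smul]
      mul_mem' := fun {u v} hu hv t => by
        rw [mul_inv_rev, map_mul, map_mul, mul_smul, mul_smul, hv, hu]
      inv_mem' := fun {u} hu t => by
        have h := hu (f u • t)
        rw [← mul_smul (f u⁻¹), ← map_mul, inv_mul_cancel, map_one, one_smul] at h
        rw [inv_inv, ← h, ← mul_smul (f u⁻¹), ← map_mul, inv_mul_cancel, map_one, one_smul] }
  have hSt : D ⊔ N ≤ St := by
    refine sup_le (fun d hd t => ?_) fun n hn t => ?_
    · rw [← mul_smul, ← mul_smul, hD d hd]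
    · rw [hN n hn, hN _ (N.inv_mem hn)]
  rw [mul_inv_rev, map_mul, map_mul]
  simp only [mul_smul]
  rw [hSt hw]

end DiscreteSimples

section X
variable {k G} [IsTopologicalGroup G] [CompactSpace G]

lemma TrivOnDiscreteSimples.not_dvd_relIndex {p : ℕ} [CharP k p] {e : CGA k G}
    (he : IsBlockIdem (CGA k G) e) {N : OpenNormalSubgroup G} (hN : TrivOnDiscreteSimples e N)
    {D : Subgroup G} (hD : DefectProp k G e D) {M : OpenNormalSubgroup G} (hMN : M ≤ N) :
    ¬ p ∣ (D ⊔ M.toSubgroup).relIndex (D ⊔ N.toSubgroup) := by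
  intro hdvd
  obtain ⟨T, _, _, hT, hTe, hdis⟩ := exists_discreteSimple he
  have hNT := hN T hT hTe hdis
  obtain ⟨a, ha, hae⟩ := hD M
  have hle : D ⊔ M.toSubgroup ≤ D ⊔ N.toSubgroup := sup_le_sup_left (show M.toSubgroup ≤ N.toSubgroup from fun _ hx => hMN hx) D
  have := finite_quotient_sup D M
  have := finite_quotient_sup D N
  have := Fintype.ofFinite (G ⧸ (D ⊔ M.toSubgroup))
  have := Fintype.ofFinite (G ⧸ (D ⊔ N.toSubgroup))
  have := IsSimpleModule.nontrivial (CGA k G) T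
  obtain ⟨t, ht⟩ := exists_ne (0 : T)
  refine ht ?_
  rw [← hTe t, ← hae, trMap, finsum_eq_sum_of_fintype, Finset.sum_smul]
  have h1 : ∀ g, ∀ w ∈ D ⊔ N.toSubgroup, conjAct k G (g * w) a • t = conjAct k G g a • t :=
    fun g w hw => conj_smul_mul_eq (ofG k G) (fun d hd => ha d (Subgroup.mem_sup_left hd)) hNT hw t
  have h2 := sum_out_eq_relIndex_smul hle (fun g => conjAct k G g a • t) h1
  refine h2.trans ?_
  rw [← Nat.cast_smul_eq_nsmul (CGA k G), ← map_natCast (algebraMap k (CGA k G)),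
    (CharP.cast_eq_zero_iff k p _).2 hdvd, map_zero, zero_smul]

end X

section DefectGroup

variable {k G} [IsTopologicalGroup G] [CompactSpace G]

/-- The elements acting trivially on the block at level `M`. -/
def levStab (e : CGA k G) (M : OpenNormalSubgroup G) : Subgroup G where
  carrier := {w | levC M (ofG k G w * e) = levC M e}
  one_mem' := by rw [Set.mem_ofPred_eq, map_one, one_mul]
  mul_mem' {u v} hu hv := by
    rw [Set.mem_ofPred_eq] at *
    rw [map_mul (ofG k G), mul_assoc, map_mul (levC M), hv, ← map_mul (levC M), hu]
  inv_mem' {u} hu := by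
    rw [Set.mem_ofPred_eq] at *
    rw [map_mul (levC M), ← hu, ← map_mul (levC M), ← mul_assoc, ← map_mul (ofG k G), inv_mul_cancel,
      map_one, one_mul, hu]

lemma mem_levStab {e : CGA k G} {M : OpenNormalSubgroup G} {w : G} :
    w ∈ levStab e M ↔ levC M (ofG k G w * e) = levC M e := Iff.rfl

lemma levStab_normal {e : CGA k G} (he : e ∈ Set.center (CGA k G)) (M : OpenNormalSubgroup G) :
    (levStab e M).Normal where
  conj_mem u hu g := by
    have hc : ∀ x, e * x = x * e := (Set.mem_center_iff.1 he).comm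
    rw [mem_levStab] at *
    have h1 : ofG k G (g * u * g⁻¹) * e = ofG k G g * (ofG k G u * e) * ofG k G g⁻¹ := by
      rw [map_mul, map_mul, mul_assoc _ (ofG k G g⁻¹), ← hc]
      simp only [mul_assoc]
    rw [h1, map_mul, map_mul, hu, ← map_mul, ← map_mul, ← hc, mul_assoc, ← map_mul,
      mul_inv_cancel, map_one, mul_one]

lemma le_levStab (e : CGA k G) (M : OpenNormalSubgroup G) : M.toSubgroup ≤ levStab e M := by
  intro w hw
  rw [mem_levStab, map_mul, levC_ofG, (QuotientGroup.eq_one_iff (N := M.toSubgroup) _).2 hw,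
    ← MonoidAlgebra.one_def, one_mul]

lemma IsZpGen.exists_pow_mem {p : ℕ} {D : Subgroup G} {h : G} (hh : IsZpGen p D h)
    (M : OpenNormalSubgroup G) {d : G} (hd : d ∈ D) : ∃ a, d ^ p ^ a ∈ M := by
  obtain ⟨a, ha⟩ := hh.pow_mem M
  obtain ⟨m, w, hw, rfl⟩ := hh.dense M d hd
  refine ⟨a, ?_⟩
  change _ ∈ M.toSubgroup
  rw [← QuotientGroup.eq_one_iff, QuotientGroup.mk_pow, QuotientGroup.mk_mul,
    (QuotientGroup.eq_one_iff (N := M.toSubgroup) w).2 hw, mul_one, QuotientGroup.mk_pow, ← pow_mul,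
    mul_comm, pow_mul, ← QuotientGroup.mk_pow, (QuotientGroup.eq_one_iff (N := M.toSubgroup) _).2 ha,
    one_pow]

variable {p : ℕ} [Fact p.Prime] [CharP k p]

lemma TrivOnDiscreteSimples.exists_levC_eq_pow {e : CGA k G} (he : IsBlockIdem (CGA k G) e)
    {N : OpenNormalSubgroup G} (hN : TrivOnDiscreteSimples e N) {D : Subgroup G}
    (hD : DefectProp k G e D) {h : G} (hh : IsZpGen p D h) (M : OpenNormalSubgroup G) {w : G}
    (hw : w ∈ D ⊔ N.toSubgroup) : ∃ m : ℕ, levC M (ofG k G w * e) = levC M (ofG k G (h ^ m) * e) := by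
  let M' : OpenNormalSubgroup G := M ⊓ N
  have hM'N : M' ≤ N := inf_le_right
  have hM'M : M' ≤ M := inf_le_left
  let St := levStab e M'
  have hnorm : St.Normal := levStab_normal he.central M'
  have hSt : M'.toSubgroup ≤ St := le_levStab e M'
  let q : G →* G ⧸ St := QuotientGroup.mk' St
  have hfin : Finite (G ⧸ St) :=
    Subgroup.quotient_finite_of_isOpen _ (Subgroup.isOpen_mono hSt M'.isOpen')
  have hpow : ∀ L : Subgroup G, (∀ l ∈ L, ∃ a, l ^ p ^ a ∈ St) → IsPGroup p (L.map q) := by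
    rintro L hL ⟨_, l, hl, rfl⟩
    obtain ⟨a, ha⟩ := hL l hl
    refine ⟨a, Subtype.ext ?_⟩
    change q l ^ p ^ a = 1
    rw [← map_pow]
    exact (QuotientGroup.eq_one_iff _).2 ha
  have hDp : IsPGroup p (D.map q) := hpow D fun d hd => by
    obtain ⟨a, ha⟩ := hh.exists_pow_mem M' hd
    exact ⟨a, hSt ha⟩
  have hNp : IsPGroup p (N.toSubgroup.map q) := hpow N.toSubgroup fun d hd =>
    hN.exists_pow he M' hd
  have hNn : (N.toSubgroup.map q).Normal :=
    Subgroup.Normal.map inferInstance q (QuotientGroup.mk'_surjective St)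
  have hHp : IsPGroup p ((D ⊔ N.toSubgroup).map q) := by
    rw [Subgroup.map_sup]
    exact hDp.to_sup_of_normal_right hNp
  obtain ⟨i, hi⟩ := hHp.index ((D.map q).subgroupOf ((D ⊔ N.toSubgroup).map q))
  change (D.map q).relIndex ((D ⊔ N.toSubgroup).map q) = _ at hi
  rw [← Subgroup.relIndex_comap, Subgroup.comap_map_eq, QuotientGroup.ker_mk'] at hi
  have hdvd : (D ⊔ St).relIndex (D ⊔ N.toSubgroup) ∣
      (D ⊔ M'.toSubgroup).relIndex (D ⊔ N.toSubgroup) :=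
    Subgroup.relIndex_dvd_of_le_left _ (sup_le_sup_left hSt D)
  have hi0 : i = 0 := by
    by_contra h0
    refine hN.not_dvd_relIndex (p := p) he hD hM'N ((dvd_pow_self p h0).trans ?_)
    rwa [← hi]
  rw [hi0, pow_zero, Subgroup.relIndex_eq_one] at hi
  obtain ⟨d, hd, s, hs, rfl⟩ := Subgroup.mem_sup_of_normal_right.1 (hi hw)
  obtain ⟨m, t, ht, rfl⟩ := hh.dense M' d hd
  refine ⟨m, (isLevSys_levC (k := k) (G := G)).mono_eq hM'M ?_⟩
  have hts : t * s ∈ St := St.mul_mem (hSt ht) hs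
  change levC M' (ofG k G (h ^ m * t * s) * e) = levC M' (ofG k G (h ^ m) * e)
  rw [mul_assoc (h ^ m), map_mul (ofG k G), mul_assoc, map_mul (levC M'), mem_levStab.1 hts,
    ← map_mul (levC M')]

/-- The elements of `DN` act on the block through power series in `h - 1`. -/
lemma TrivOnDiscreteSimples.exists_rhoG_eq {e : CGA k G} (he : IsBlockIdem (CGA k G) e)
    {N : OpenNormalSubgroup G} (hN : TrivOnDiscreteSimples e N) {D : Subgroup G}
    (hD : DefectProp k G e D) {h : G} (hh : IsZpGen p D h) {w : G}
    (hw : w ∈ D ⊔ N.toSubgroup) : ∃ f, ofG k G w * e = rhoG k hh.pow_mem f * e := by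
  obtain ⟨f, hf⟩ := exists_rhoG_sum_eq hh.pow_mem (fun _ : Unit => e) (ofG k G w * e) fun M => by
    obtain ⟨m, hm⟩ := hN.exists_levC_eq_pow he hD hh M hw
    refine ⟨fun _ => (1 + PowerSeries.X) ^ m, ?_⟩
    rw [Finset.univ_unique, Finset.sum_singleton, rhoG_one_add_X_pow, hm]
  exact ⟨f (), by rw [hf, Finset.univ_unique, Finset.sum_singleton]⟩

end DefectGroup

section Splitting

variable {G}

/-- A Higman type criterion: averaging a section which is equivariant for a subgroup `H` of
finite index. -/
lemma exists_section_of_trace {R F L : Type*} [Ring R] [AddCommGroup F] [Module R F]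
    [AddCommGroup L] [Module R L] (σ : G →* R) (H : Subgroup G) [Fintype (G ⧸ H)] {e a : R}
    (he : ∀ x, e * x = x * e) (hee : e * e = e)
    (hae : ∑ c : G ⧸ H, σ c.out * a * σ c.out⁻¹ = e) (ha : ∀ w ∈ H, σ w * a = a * σ w)
    (hL : ∀ v : L, e • v = v) (π : F →ₗ[R] L) (s : L →+ F) (hs : ∀ v, π (s v) = v)
    (hsH : ∀ w ∈ H, ∀ v, e • s (σ w • v) = e • σ w • s v) (W : Set R)
    (hWa : ∀ z ∈ W, z * a = a * z) (hWs : ∀ z ∈ W, ∀ v, e • s (z • v) = e • z • s v)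
    (hWc : ∀ z ∈ W, ∀ g, σ g⁻¹ * z * σ g ∈ W)
    (hgen : ∀ r, ∃ r' ∈ Subring.closure (W ∪ Set.range σ), r * e = r' * e) :
    ∃ S : L →ₗ[R] F, π.comp S = LinearMap.id := by
  have hσF : ∀ (g : G) (x : F), σ g • σ g⁻¹ • x = x := by
    intro g x
    rw [← mul_smul, ← map_mul, mul_inv_cancel, map_one, one_smul]
  have hσL : ∀ (g : G) (x : L), σ g • σ g⁻¹ • x = x := by
    intro g x
    rw [← mul_smul, ← map_mul, mul_inv_cancel, map_one, one_smul]
  have hcomm : ∀ (r : R) (x : F), e • r • x = r • e • x := by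
    intro r x
    rw [← mul_smul, he, mul_smul]
  let T : G → L →+ F := fun g =>
    { toFun := fun v => σ g • a • e • s (σ g⁻¹ • v)
      map_zero' := by simp only [smul_zero, map_zero]
      map_add' := fun v w => by simp only [smul_add, map_add] }
  have hTdef : ∀ g v, T g v = σ g • a • e • s (σ g⁻¹ • v) := fun _ _ => rfl
  have hTw : ∀ g, ∀ w ∈ H, T (g * w) = T g := by
    intro g w hw
    ext v
    rw [hTdef, hTdef, mul_inv_rev, map_mul σ w⁻¹, mul_smul, hsH _ (H.inv_mem hw), map_mul,
      hcomm, ← mul_smul a, ← ha _ (H.inv_mem hw), mul_smul, mul_smul (σ w⁻¹), hσF]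
  have hTout : ∀ g : G, T (g : G ⧸ H).out = T g := by
    intro g
    obtain ⟨w, hw⟩ := QuotientGroup.mk_out_eq_mul H g
    rw [hw, hTw _ _ w.2]
  let S : L →+ F := ∑ c : G ⧸ H, T c.out
  have hSdef : ∀ v, S v = ∑ c : G ⧸ H, T c.out v := fun v => by
    rw [AddMonoidHom.finsetSum_apply]
  have hSe : ∀ v, e • S v = S v := by
    intro v
    rw [hSdef, Finset.smul_sum]
    refine Finset.sum_congr rfl fun c _ => ?_
    rw [hTdef, hcomm, hcomm a, ← mul_smul e e, hee]
  have hSσ : ∀ u v, S (σ u • v) = σ u • S v := by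
    intro u v
    have h1 : ∀ g, T g (σ u • v) = σ u • T (u⁻¹ * g) v := by
      intro g
      rw [hTdef, hTdef, mul_inv_rev, inv_inv, map_mul, ← mul_smul (σ g⁻¹), ← map_mul,
        ← map_mul, ← mul_smul (σ u), ← map_mul, mul_inv_cancel_left]
    rw [hSdef, hSdef, Finset.smul_sum]
    refine Fintype.sum_equiv (MulAction.toPerm u⁻¹) _ _ fun c => ?_
    rw [h1, MulAction.toPerm_apply]
    congr 2
    conv_rhs => rw [← QuotientGroup.out_eq' c]
    exact (hTout (u⁻¹ * c.out)).symm
  have hSW : ∀ z ∈ W, ∀ v, S (z • v) = z • S v := by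
    intro z hz v
    rw [hSdef, hSdef, Finset.smul_sum]
    refine Finset.sum_congr rfl fun c _ => ?_
    set g := c.out
    have hz' := hWc z hz g
    have h1 : σ g⁻¹ • z • v = (σ g⁻¹ * z * σ g) • σ g⁻¹ • v := by
      rw [mul_smul, mul_smul, hσL]
    have h2 : ∀ x : F, σ g • (σ g⁻¹ * z * σ g) • x = z • σ g • x := by
      intro x
      rw [mul_smul, mul_smul, hσF]
    rw [hTdef, hTdef, h1, hWs _ hz', hcomm, ← mul_smul a, ← hWa _ hz', mul_smul, h2]
  let C : Subring R :=
    { carrier := {r | ∀ v, S (r • v) = r • S v}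
      mul_mem' := fun {x y} hx hy v => by rw [mul_smul, hx, hy, mul_smul]
      one_mem' := fun v => by rw [one_smul, one_smul]
      add_mem' := fun {x y} hx hy v => by rw [add_smul, map_add, hx, hy, add_smul]
      zero_mem' := fun v => by rw [zero_smul, map_zero, zero_smul]
      neg_mem' := fun {x} hx v => by rw [neg_smul, map_neg, hx, neg_smul] }
  have hC : Subring.closure (W ∪ Set.range σ) ≤ C := by
    refine Subring.closure_le.2 (Set.union_subset hSW ?_)
    rintro _ ⟨u, rfl⟩
    exact hSσ u
  refine ⟨{ S with
    map_smul' := fun r v => ?_ }, LinearMap.ext fun v => ?_⟩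
  · obtain ⟨r', hr', hre⟩ := hgen r
    change S (r • v) = r • S v
    have h1 : r • v = r' • v := by
      conv_lhs => rw [← hL v, ← mul_smul, hre, mul_smul, hL]
    have h2 : r • S v = r' • S v := by
      conv_lhs => rw [← hSe v, ← mul_smul, hre, mul_smul, hSe]
    rw [h1, h2, hC hr']
  · change π (S v) = v
    rw [hSdef, map_sum]
    conv_rhs => rw [← hL v, ← hae, Finset.sum_smul]
    refine Finset.sum_congr rfl fun c _ => ?_
    rw [hTdef, map_smul, map_smul, map_smul, hs, hL, mul_smul, mul_smul]

end Splitting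

section Generation

section

variable {k} {K R A : Type*} [Ring K] [Ring R] [Ring A] [Algebra k K] [Algebra k R] [Algebra k A]
  {ι : Type*} [Fintype ι]

lemma map_sum_mul_add (l : R →ₐ[k] A) (ρ : K →ₐ[k] R) (B : ι → R) {f f' : ι → K} {x y e : R}
    (hf : l (∑ i, ρ (f i) * B i) = l (x * e)) (hf' : l (∑ i, ρ (f' i) * B i) = l (y * e)) :
    l (∑ i, ρ ((f + f') i) * B i) = l ((x + y) * e) := by
  simp only [Pi.add_apply, map_add, add_mul, Finset.sum_add_distrib, hf, hf']

lemma map_sum_mul_smul (l : R →ₐ[k] A) (ρ : K →ₐ[k] R) (B : ι → R) (c : k) {f : ι → K} {x e : R}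
    (hf : l (∑ i, ρ (f i) * B i) = l (x * e)) :
    l (∑ i, ρ ((c • f) i) * B i) = l ((c • x) * e) := by
  simp only [Pi.smul_apply, map_smul, smul_mul_assoc, ← Finset.smul_sum, hf]

end

variable {k G} [IsTopologicalGroup G] [CompactSpace G] {p : ℕ} [Fact p.Prime] [CharP k p]

lemma exists_rhoG_sum_of_ofG {g : G} (hg : ∀ M : OpenNormalSubgroup G, ∃ a, g ^ p ^ a ∈ M)
    {ι : Type} [Fintype ι] {e : CGA k G} (B : ι → CGA k G)
    (H : ∀ (M : OpenNormalSubgroup G) (u : G), ∃ (i : ι) (m : ℕ),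
      levC M (ofG k G u * e) = levC M (ofG k G (g ^ m) * B i)) (r : CGA k G) :
    ∃ f : ι → PowerSeries k, r * e = ∑ i, rhoG k hg (f i) * B i := by
  refine exists_rhoG_sum_eq hg B (r * e) fun M => ?_
  obtain ⟨x, ⟨f, hf⟩, hx⟩ := exists_levC_eq_of_closed
    (fun x => ∃ f : ι → PowerSeries k, levC M (∑ i, rhoG k hg (f i) * B i) = levC M (x * e))
    (fun x y ⟨f, hf⟩ ⟨f', hf'⟩ => ⟨f + f', map_sum_mul_add _ _ B hf hf'⟩)
    (fun c x ⟨f, hf⟩ => ⟨c • f, map_sum_mul_smul _ _ B c hf⟩)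
    (by
      intro u
      obtain ⟨i, m, hm⟩ := H M u
      refine ⟨Pi.single i ((1 + PowerSeries.X) ^ m), ?_⟩
      rw [hm, Finset.sum_eq_single i, Pi.single_eq_same, rhoG_one_add_X_pow]
      · intro j _ hj
        rw [Pi.single_eq_of_ne hj, map_zero, zero_mul]
      · intro hi
        exact absurd (Finset.mem_univ i) hi) M r
  exact ⟨f, by rw [hf, map_mul (levC M), hx, ← map_mul (levC M)]⟩

lemma TrivOnDiscreteSimples.exists_levC_ofG_eq {e : CGA k G} (he : IsBlockIdem (CGA k G) e)
    {N : OpenNormalSubgroup G} (hN : TrivOnDiscreteSimples e N) {D : Subgroup G}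
    (hD : DefectProp k G e D) {h : G} (hh : IsZpGen p D h) (M : OpenNormalSubgroup G) (u : G) :
    ∃ (c : G ⧸ (D ⊔ N.toSubgroup)) (m : ℕ),
      levC M (ofG k G u * e) = levC M (ofG k G (h ^ m) * (ofG k G c.out⁻¹ * e)) := by
  have hc : ∀ x, e * x = x * e := (Set.mem_center_iff.1 he.central).comm
  obtain ⟨w, hw⟩ := QuotientGroup.mk_out_eq_mul (D ⊔ N.toSubgroup) u⁻¹
  obtain ⟨m, hm⟩ := hN.exists_levC_eq_pow he hD hh M w.2
  refine ⟨(u⁻¹ : G), m, ?_⟩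
  have hu : u = w * ((u⁻¹ : G) : G ⧸ (D ⊔ N.toSubgroup)).out⁻¹ := by
    rw [hw, mul_inv_rev, inv_inv, mul_inv_cancel_left]
  conv_lhs => rw [hu]
  rw [map_mul (ofG k G), mul_assoc, ← hc, ← mul_assoc, map_mul (levC M), hm, ← map_mul (levC M),
    mul_assoc]

lemma TrivOnDiscreteSimples.exists_rhoG_sum_eq {e : CGA k G} (he : IsBlockIdem (CGA k G) e)
    {N : OpenNormalSubgroup G} (hN : TrivOnDiscreteSimples e N) {D : Subgroup G}
    (hD : DefectProp k G e D) {h : G} (hh : IsZpGen p D h) [Fintype (G ⧸ (D ⊔ N.toSubgroup))]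
    (r : CGA k G) : ∃ f : G ⧸ (D ⊔ N.toSubgroup) → PowerSeries k,
      r * e = ∑ c, rhoG k hh.pow_mem (f c) * (ofG k G c.out⁻¹ * e) :=
  exists_rhoG_sum_of_ofG hh.pow_mem _ (hN.exists_levC_ofG_eq he hD hh) r

lemma pow_pow_mem {h : G} (hh : ∀ M : OpenNormalSubgroup G, ∃ a, h ^ p ^ a ∈ M) (b : ℕ)
    (M : OpenNormalSubgroup G) : ∃ a, (h ^ p ^ b) ^ p ^ a ∈ M := by
  obtain ⟨a, ha⟩ := hh M
  refine ⟨a, ?_⟩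
  rw [← pow_mul, mul_comm, pow_mul]
  exact M.toSubgroup.pow_mem ha _

lemma TrivOnDiscreteSimples.exists_rhoG_pow_sum_eq {e : CGA k G} (he : IsBlockIdem (CGA k G) e)
    {N : OpenNormalSubgroup G} (hN : TrivOnDiscreteSimples e N) {D : Subgroup G}
    (hD : DefectProp k G e D) {h : G} (hh : IsZpGen p D h) [Fintype (G ⧸ (D ⊔ N.toSubgroup))]
    (b : ℕ) (r : CGA k G) : ∃ f : Fin (p ^ b) × G ⧸ (D ⊔ N.toSubgroup) → PowerSeries k,
      r * e = ∑ i, rhoG k (pow_pow_mem hh.pow_mem b) (f i) *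
        (ofG k G (h ^ (i.1 : ℕ) * i.2.out⁻¹) * e) := by
  refine exists_rhoG_sum_of_ofG _ _ (fun M u => ?_) r
  obtain ⟨c, m, hm⟩ := hN.exists_levC_ofG_eq he hD hh M u
  have hp : 0 < p ^ b := pow_pos (Fact.out : p.Prime).pos b
  refine ⟨(⟨m % p ^ b, Nat.mod_lt _ hp⟩, c), m / p ^ b, ?_⟩
  rw [hm, ← mul_assoc, ← mul_assoc, ← map_mul (ofG k G), ← map_mul (ofG k G), ← pow_mul,
    ← mul_assoc, ← pow_add, Nat.div_add_mod]

end Generation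

section NormalPart

variable {k G} [IsTopologicalGroup G] [CompactSpace G]

/-- The closure of the image of `k⟦N⟧` in `k⟦G⟧`. -/
def levAdjoin (k : Type) [Field k] (N : OpenNormalSubgroup G) : Set (CGA k G) :=
  {u | ∀ M : OpenNormalSubgroup G, ∃ x ∈ Algebra.adjoin k (ofG k G '' (N.toSubgroup : Set G)),
    levC M u = levC M x}

lemma conj_mem_levAdjoin {N : OpenNormalSubgroup G} {u : CGA k G} (hu : u ∈ levAdjoin k N)
    (g : G) : ofG k G g⁻¹ * u * ofG k G g ∈ levAdjoin k N := by
  intro M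
  obtain ⟨x, hx, hux⟩ := hu M
  refine ⟨ofG k G g⁻¹ * x * ofG k G g, ?_, by
    rw [map_mul (levC M), map_mul (levC M), hux, ← map_mul (levC M), ← map_mul (levC M)]⟩
  have hg : ofG k G g * ofG k G g⁻¹ = 1 := by rw [← map_mul, mul_inv_cancel, map_one]
  have hg' : ofG k G g⁻¹ * ofG k G g = 1 := by rw [← map_mul, inv_mul_cancel, map_one]
  clear hux
  induction hx using Algebra.adjoin_induction with
  | mem x hx =>
    obtain ⟨w, hw, rfl⟩ := hx
    rw [← map_mul, ← map_mul]
    refine Algebra.subset_adjoin ⟨_, ?_, rfl⟩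
    have h1 := N.isNormal'.conj_mem w hw g⁻¹
    rwa [inv_inv] at h1
  | algebraMap c =>
    rw [← Algebra.commutes, mul_assoc, hg', mul_one]
    exact Subalgebra.algebraMap_mem _ c
  | add x y _ _ hx hy =>
    rw [mul_add, add_mul]
    exact Subalgebra.add_mem _ hx hy
  | mul x y _ _ hx hy =>
    have h1 : ofG k G g⁻¹ * (x * y) * ofG k G g =
        ofG k G g⁻¹ * x * ofG k G g * (ofG k G g⁻¹ * y * ofG k G g) := by
      rw [← mul_assoc (_ * ofG k G g), ← mul_assoc (_ * ofG k G g), mul_assoc _ (ofG k G g), hg,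
        mul_one, mul_assoc _ x]
    rw [h1]
    exact Subalgebra.mul_mem _ hx hy

lemma commute_of_mem_levAdjoin {N : OpenNormalSubgroup G} {a : CGA k G}
    (ha : ∀ w ∈ N.toSubgroup, ofG k G w * a = a * ofG k G w) {u : CGA k G}
    (hu : u ∈ levAdjoin k N) : u * a = a * u := by
  refine (isLevSys_levC (k := k) (G := G)).ext _ _ fun M => ?_
  obtain ⟨x, hx, hux⟩ := hu M
  have hxa : x * a = a * x := by
    clear hux
    induction hx using Algebra.adjoin_induction with
    | mem x hx =>
      obtain ⟨w, hw, rfl⟩ := hx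
      exact ha w hw
    | algebraMap c => exact Algebra.commutes c a
    | add x y _ _ hx hy => rw [add_mul, mul_add, hx, hy]
    | mul x y _ _ hx hy => rw [mul_assoc, hy, ← mul_assoc, hx, mul_assoc]
  rw [map_mul (levC M), map_mul (levC M), hux, ← map_mul (levC M), hxa, map_mul (levC M)]

variable {p : ℕ} [Fact p.Prime] [CharP k p]

lemma rhoG_mem_levAdjoin {g : G} (hg : ∀ M : OpenNormalSubgroup G, ∃ a, g ^ p ^ a ∈ M)
    {N : OpenNormalSubgroup G} (hgN : g ∈ N) (f : PowerSeries k) :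
    rhoG k hg f ∈ levAdjoin k N := by
  intro M
  obtain ⟨P, hP⟩ := exists_levC_rhoG_eq hg f M
  refine ⟨_, ?_, hP⟩
  have h1 : ofG k G g - 1 ∈ Algebra.adjoin k (ofG k G '' (N.toSubgroup : Set G)) :=
    Subalgebra.sub_mem _ (Algebra.subset_adjoin ⟨g, hgN, rfl⟩) (Subalgebra.one_mem _)
  exact Algebra.adjoin_le (Set.singleton_subset_iff.2 h1) (Polynomial.aeval_mem_adjoin_singleton k _)

lemma TrivOnDiscreteSimples.exists_rhoG_eq_of_mem_levAdjoin {e : CGA k G}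
    (he : IsBlockIdem (CGA k G) e) {N : OpenNormalSubgroup G} (hN : TrivOnDiscreteSimples e N)
    {D : Subgroup G} (hD : DefectProp k G e D) {h : G} (hh : IsZpGen p D h) {u : CGA k G}
    (hu : u ∈ levAdjoin k N) : ∃ f, u * e = rhoG k hh.pow_mem f * e := by
  have hc : ∀ x, e * x = x * e := (Set.mem_center_iff.1 he.central).comm
  obtain ⟨f, hf⟩ := ProfiniteBlocks.exists_rhoG_sum_eq hh.pow_mem (fun _ : Unit => e) (u * e)
    fun M => by
      obtain ⟨x, hx, hux⟩ := hu M
      have hxe : ∃ f, x * e = rhoG k hh.pow_mem f * e := by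
        clear hux
        induction hx using Algebra.adjoin_induction with
        | mem x hx =>
          obtain ⟨w, hw, rfl⟩ := hx
          exact hN.exists_rhoG_eq he hD hh (Subgroup.mem_sup_right hw)
        | algebraMap c => exact ⟨algebraMap k _ c, by rw [AlgHom.commutes]⟩
        | add x y _ _ hx hy =>
          obtain ⟨f, hf⟩ := hx
          obtain ⟨f', hf'⟩ := hy
          exact ⟨f + f', by rw [add_mul, hf, hf', map_add, add_mul]⟩
        | mul x y _ _ hx hy =>
          obtain ⟨f, hf⟩ := hx
          obtain ⟨f', hf'⟩ := hy
          refine ⟨f * f', ?_⟩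
          rw [mul_assoc, hf', ← hc, ← mul_assoc, hf, map_mul, mul_assoc, mul_assoc, hc]
      obtain ⟨f, hf⟩ := hxe
      refine ⟨fun _ => f, ?_⟩
      rw [Finset.univ_unique, Finset.sum_singleton, ← hf, map_mul (levC M), ← hux,
        ← map_mul (levC M)]
  exact ⟨f (), by rw [hf, Finset.univ_unique, Finset.sum_singleton]⟩

end NormalPart

section ScalarRing

variable {G} {R K : Type} [Ring R] [CommRing K] [Module K R] [IsScalarTower K R R]

lemma finite_of_exists_sum_eq [IsNoetherianRing K] {ι : Type} [Fintype ι] (b : ι → R)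
    (L : Submodule R R) (hL : ∀ r ∈ L, ∃ f : ι → K, r = ∑ i, f i • b i) : Module.Finite K L := by
  let V : Submodule K R := Submodule.span K (Set.range b)
  have hV : ∀ r : L, (L.subtype.restrictScalars K) r ∈ V := by
    rintro ⟨r, hr⟩
    obtain ⟨f, rfl⟩ := hL r hr
    exact Submodule.sum_mem _ fun i _ =>
      Submodule.smul_mem _ _ (Submodule.subset_span (Set.mem_range_self i))
  have : Module.Finite K V := Module.Finite.span_of_finite K (Set.finite_range b)
  exact Module.Finite.of_injective ((L.subtype.restrictScalars K).codRestrict V hV)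
    fun x y hxy => Subtype.ext (congrArg (Subtype.val : V → R) hxy)

lemma projective_of_trace (σ : G →* R) (H : Subgroup G) [Fintype (G ⧸ H)] {e a : R}
    (he : ∀ x, e * x = x * e) (hee : e * e = e)
    (hae : ∑ c : G ⧸ H, σ c.out * a * σ c.out⁻¹ = e) (ha : ∀ w ∈ H, σ w * a = a * σ w)
    (L : Submodule R R) (hL : ∀ v ∈ L, v * e = v) [Module.Projective K L] (W : Set R)
    (hWa : ∀ z ∈ W, z * a = a * z) (hWc : ∀ z ∈ W, ∀ g, σ g⁻¹ * z * σ g ∈ W)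
    (hHe : ∀ w ∈ H, ∃ f : K, σ w * e = (f • (1 : R)) * e)
    (hWe : ∀ z ∈ W, ∃ f : K, z * e = (f • (1 : R)) * e)
    (hgen : ∀ r, ∃ r' ∈ Subring.closure (W ∪ Set.range σ), r * e = r' * e) :
    Module.Projective R L := by
  let π : (L →₀ R) →ₗ[R] L := Finsupp.linearCombination R id
  have hπ : Function.Surjective π := fun v => ⟨Finsupp.single v 1, by
    rw [Finsupp.linearCombination_single, one_smul, id]⟩
  obtain ⟨s, hs⟩ := Module.projective_lifting_property (π.restrictScalars K) LinearMap.id hπ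
  have hL' : ∀ v : L, e • v = v := fun v => Subtype.ext ((he v.1).trans (hL v v.2))
  have hsu : ∀ (u : R) (f : K), u * e = (f • (1 : R)) * e → ∀ v, e • s (u • v) = e • u • s v := by
    intro u f hu v
    have h1 : u • v = f • v := by
      conv_lhs => rw [← hL' v, ← mul_smul, hu, mul_smul, hL', smul_one_smul]
    rw [h1, map_smul, ← smul_one_smul R f (s v), ← mul_smul, ← mul_smul, he, ← hu, he]
  obtain ⟨S, hS⟩ := exists_section_of_trace σ H he hee hae ha hL' π s.toAddMonoidHom
    (fun v => LinearMap.congr_fun hs v)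
    (fun w hw v => let ⟨f, hf⟩ := hHe w hw; hsu _ f hf v) W hWa
    (fun z hz v => let ⟨f, hf⟩ := hWe z hz; hsu _ f hf v) hWc hgen
  exact Module.Projective.of_split S π hS

end ScalarRing

section Assembly

variable {k G} [IsTopologicalGroup G] [CompactSpace G]
  {p : ℕ} [Fact p.Prime] [CharP k p]

/-- The action of power series in `h - 1` on `k⟦G⟧`, as a module structure. -/
abbrev rhoModule (k : Type) [Field k] [CharP k p] {h : G}
    (hh : ∀ M : OpenNormalSubgroup G, ∃ a, h ^ p ^ a ∈ M) :
    Module (PowerSeries k) (CGA k G) :=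
  Module.compHom _ (rhoG k hh).toRingHom

lemma rhoModule_isScalarTower {h : G} (hh : ∀ M : OpenNormalSubgroup G, ∃ a, h ^ p ^ a ∈ M) :
    letI := rhoModule k hh; IsScalarTower (PowerSeries k) (CGA k G) (CGA k G) := by
  let := rhoModule k hh
  refine ⟨fun f r s => ?_⟩
  change rhoG k hh f * r * s = rhoG k hh f * (r * s)
  exact mul_assoc _ _ _

lemma exists_trace_eq {e : CGA k G} {D : Subgroup G} (hD : DefectProp k G e D)
    (N : OpenNormalSubgroup G) [Fintype (G ⧸ (D ⊔ N.toSubgroup))] :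
    ∃ a, ∑ c : G ⧸ (D ⊔ N.toSubgroup), ofG k G c.out * a * ofG k G c.out⁻¹ = e ∧
      ∀ w ∈ D ⊔ N.toSubgroup, ofG k G w * a = a * ofG k G w := by
  obtain ⟨a, ha, hae⟩ := hD N
  refine ⟨a, ?_, fun w hw => ?_⟩
  · rw [← hae, trMap, finsum_eq_sum_of_fintype]
    rfl
  · have h1 : ofG k G w * a * ofG k G w⁻¹ = a := ha w hw
    conv_rhs => rw [← h1]
    rw [mul_assoc _ (ofG k G w⁻¹), ← map_mul, inv_mul_cancel, map_one, mul_one]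

end Assembly

section Assembly

variable {k G} [IsTopologicalGroup G] [CompactSpace G]
  {p : ℕ} [Fact p.Prime] [CharP k p]

lemma exists_levC_rhoG_X_pow_mul {h : G} (hh : ∀ M : OpenNormalSubgroup G, ∃ a, h ^ p ^ a ∈ M)
    (M : OpenNormalSubgroup G) :
    ∃ c : PowerSeries k, c ≠ 0 ∧ ∀ r, levC M (rhoG k hh c * r) = 0 := by
  obtain ⟨s, hs⟩ := isNilpotent_levC (k := k) hh M
  refine ⟨PowerSeries.X ^ s, pow_ne_zero s PowerSeries.X_ne_zero, fun r => ?_⟩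
  rw [map_mul (levC M), map_pow, rhoG_X, map_pow, hs, zero_mul]

lemma exists_eq_rhoG_mul_of_levC_eq_zero {h : G}
    (hh : ∀ M : OpenNormalSubgroup G, ∃ a, h ^ p ^ a ∈ M) {e : CGA k G} {ι : Type} [Fintype ι]
    (B : ι → CGA k G) (hB : ∀ i, B i * e = B i)
    (hgen : ∀ r, ∃ f : ι → PowerSeries k, r * e = ∑ i, rhoG k hh (f i) * B i)
    {c : PowerSeries k} (hc : c ≠ 0) : ∃ M : OpenNormalSubgroup G, ∀ r, r * e = r →
      levC M r = 0 → ∃ r', r' * e = r' ∧ r = rhoG k hh c * r' := by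
  obtain ⟨t, u, rfl⟩ := exists_eq_unit_mul_X_pow hc
  obtain ⟨M, hM⟩ := exists_lev_ker_le (isLevSys_levC (k := k) (G := G)) (ofG k G h - 1)
    (isNilpotent_levC hh) B t
  refine ⟨M, fun r hr hr0 => ?_⟩
  obtain ⟨f, hf⟩ := hgen r
  rw [hr] at hf
  rw [hf] at hr0
  obtain ⟨g, hg⟩ := hM f hr0
  change ∑ i, rhoG k hh (f i) * B i = _ ^ t * ∑ i, rhoG k hh (g i) * B i at hg
  rw [← hf] at hg
  refine ⟨rhoG k hh ↑u⁻¹ * ∑ i, rhoG k hh (g i) * B i, ?_, ?_⟩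
  · rw [mul_assoc, Finset.sum_mul]
    simp only [mul_assoc, hB]
  · rw [hg, ← mul_assoc, ← map_mul, mul_right_comm, Units.mul_inv, one_mul, map_pow, rhoG_X]

lemma TrivOnDiscreteSimples.exists_mem_closure {e : CGA k G} (he : IsBlockIdem (CGA k G) e)
    {N : OpenNormalSubgroup G} (hN : TrivOnDiscreteSimples e N) {D : Subgroup G}
    (hD : DefectProp k G e D) {h : G} (hh : IsZpGen p D h) (r : CGA k G) :
    ∃ r' ∈ Subring.closure (levAdjoin k N ∪ Set.range (ofG k G)), r * e = r' * e := by
  have := finite_quotient_sup D N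
  have := Fintype.ofFinite (G ⧸ (D ⊔ N.toSubgroup))
  obtain ⟨b, hb⟩ := hh.pow_mem N
  obtain ⟨f, hf⟩ := hN.exists_rhoG_pow_sum_eq he hD hh b r
  refine ⟨∑ i, rhoG k (pow_pow_mem hh.pow_mem b) (f i) * ofG k G (h ^ (i.1 : ℕ) * i.2.out⁻¹), ?_, ?_⟩
  · exact Subring.sum_mem _ fun i _ => Subring.mul_mem _
      (Subring.subset_closure (Or.inl (rhoG_mem_levAdjoin _ hb _)))
      (Subring.subset_closure (Or.inr ⟨_, rfl⟩))
  · rw [hf, Finset.sum_mul]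
    simp only [mul_assoc]

variable [TotallyDisconnectedSpace G] [T2Space G]

theorem blockSetup_of_defect {e : CGA k G} (he : IsBlockIdem (CGA k G) e)
    {N : OpenNormalSubgroup G} (hN : TrivOnDiscreteSimples e N) {D : Subgroup G}
    (hD : DefectProp k G e D) {h : G} (hh : IsZpGen p D h) {n : ℕ} {S : Fin n → Type}
    [∀ i, AddCommGroup (S i)] [∀ i, Module (CGA k G) (S i)] (hS : IsSimpleReps k G e S) :
    letI := rhoModule k hh.pow_mem
    letI := rhoModule_isScalarTower (k := k) hh.pow_mem
    BlockSetup (fun M : OpenNormalSubgroup G => levC (k := k) M) (PowerSeries k) e S := by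
  let := rhoModule k hh.pow_mem
  have := rhoModule_isScalarTower (k := k) hh.pow_mem
  have := finite_quotient_sup D N
  have := Fintype.ofFinite (G ⧸ (D ⊔ N.toSubgroup))
  have hc : ∀ x, e * x = x * e := (Set.mem_center_iff.1 he.central).comm
  have hgen := hN.exists_rhoG_sum_eq he hD hh
  have hfin : ∀ L : Submodule (CGA k G) (CGA k G), (∀ x ∈ L, x * e = x) →
      Module.Finite (PowerSeries k) L := fun L hL =>
    finite_of_exists_sum_eq (fun c : G ⧸ (D ⊔ N.toSubgroup) => ofG k G c.out⁻¹ * e) L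
      fun r hr => by
        obtain ⟨f, hf⟩ := hgen r
        exact ⟨f, (hL r hr).symm.trans hf⟩
  have htf : ∀ L : Submodule (CGA k G) (CGA k G), Module.IsTorsionFree (PowerSeries k) L := by
    refine fun L => ⟨fun f hf x y hxy => sub_eq_zero.1 (Subtype.ext ?_)⟩
    refine hh.eq_zero_of_rhoG_mul (k := k) hf.ne_zero ?_
    have h1 : rhoG k hh.pow_mem f * x.1 = rhoG k hh.pow_mem f * y.1 := congrArg Subtype.val hxy
    change rhoG k hh.pow_mem f * (x.1 - y.1) = 0
    rw [mul_sub, h1, sub_self]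
  have hsmul : ∀ f : PowerSeries k, f • (1 : CGA k G) = rhoG k hh.pow_mem f := fun f =>
    mul_one (rhoG k hh.pow_mem f)
  refine
    { sys := isLevSys_levC
      block := he
      fin := hfin
      torsionFree := fun L _ => htf L
      proj := fun L hL => ?_
      nondeg := fun f a _ haf ha => exists_mul_mul_ne_zero f a haf ha
      tors := exists_levC_rhoG_X_pow_mul hh.pow_mem
      opn := fun c hc0 => exists_eq_rhoG_mul_of_levC_eq_zero hh.pow_mem _
        (fun c => by rw [mul_assoc, he.idem.eq]) hgen hc0
      simple := fun i => (hS.1 i).1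
      inBlock := fun i => (hS.1 i).2
      noniso := hS.2.1
      complete := hS.2.2 }
  have := hfin L hL
  have := htf L
  obtain ⟨a, hae, ha⟩ := exists_trace_eq hD N
  refine projective_of_trace (K := PowerSeries k) (ofG k G) (D ⊔ N.toSubgroup) hc he.idem.eq hae ha
    L hL (levAdjoin k N)
    (fun z hz => commute_of_mem_levAdjoin (fun w hw => ha w (Subgroup.mem_sup_right hw)) hz)
    (fun z hz g => conj_mem_levAdjoin hz g) (fun w hw => ?_) (fun z hz => ?_)
    (hN.exists_mem_closure he hD hh)
  · obtain ⟨f, hf⟩ := hN.exists_rhoG_eq he hD hh hw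
    exact ⟨f, by rw [hf, hsmul]⟩
  · obtain ⟨f, hf⟩ := hN.exists_rhoG_eq_of_mem_levAdjoin he hD hh hz
    exact ⟨f, by rw [hf, hsmul]⟩

end Assembly

/-- Corollary 5.3(3): a block of a profinite group with defect
group `ℤ_p` and exactly `n` isomorphism classes of simple modules is Morita
equivalent (i.e. its category of pseudocompact modules is equivalent) to the
category of pseudocompact modules over the completed path algebra `k⟦Q⟧` of the
cyclic quiver `Q` of length `n`. -/
theorem block_with_Zp_defect_morita_equiv_completed_cycle_algebra
    (p : ℕ) [Fact p.Prime] (k : Type) [Field k] [CharP k p] [IsAlgClosed k]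
    (G : Type) [Group G] [TopologicalSpace G] [IsTopologicalGroup G]
    [CompactSpace G] [TotallyDisconnectedSpace G] [T2Space G]
    (e : CGA k G) (he : IsBlockIdem (CGA k G) e)
    (D : Subgroup G) (hD : IsDefectGroup k G e D)
    (hZp : IsZpGroup G p D)
    (n : ℕ) (S : Fin n → Type) [∀ i, AddCommGroup (S i)]
    [∀ i, Module (CGA k G) (S i)] (hS : IsSimpleReps k G e S) :
    Nonempty
      ((CategoryTheory.ObjectProperty.FullSubcategory
          (fun M : PCMod k (CGA k G) => InBlock (CGA k G) (X := M.X) e)) ≌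
        PCMod k (cycleAlgebra k n)) := by
  obtain ⟨h, hh⟩ := hZp.exists_gen
  obtain ⟨N, hN⟩ := exists_trivOnDiscreteSimples hS
  let := rhoModule k hh.pow_mem
  have := rhoModule_isScalarTower (k := k) hh.pow_mem
  obtain ⟨F, T, hC⟩ := (blockSetup_of_defect he hN hD.defect hh hS).exists_cycData
  obtain ⟨F', θ, ψ, hθ⟩ := hC.exists_thetaData isLevSys_levC
  obtain ⟨ctx⟩ := hθ.nonempty_morCtx he.central
  exact ctx.nonempty_equivalence

end ProfiniteBlocks
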